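/- For any bounded measurable function φ on X and any p ∈ {0, …, n}: (1) E[γ_n^N(1)² v_{p,n}^N(φ)] = γ_n(1)² v_{p,n}(φ) for all N ≥ 1; (2) v_{p,n}^N(φ) → v_{p,n}(φ) in probability and v_{p,n}^N(φ − η_n^N(φ)) → v_{p,n}(φ − η_n(φ)) in probability as N → ∞; (3) E[γ_n^N(1)² v_n^N(φ)] = γ_n(1)² σ_n²(φ) for all N ≥ 1, and v_n^N(φ) → σ_n²(φ) in probability as N → ∞. -/

import Mathlib

open MeasureTheory ProbabilityTheory Filter
open scoped ENNReal NNReal Classical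

noncomputable section

namespace PFVar

variable {X : Type*} [MeasurableSpace X]

/-- The unnormalized Feynman–Kac measures `γ_p`. -/
def gammaFK (M0 : Measure X) (M : ℕ → Kernel X X) (G : ℕ → X → ℝ) : ℕ → Measure X
  | 0 => M0
  | p + 1 =>
      ((gammaFK M0 M G p).withDensity fun x => ENNReal.ofReal (G p x)).bind
        (fun x => M (p + 1) x)

/-- `γ_n(φ)`. -/
def gInt (M0 : Measure X) (M : ℕ → Kernel X X) (G : ℕ → X → ℝ) (n : ℕ) (φ : X → ℝ) : ℝ :=
  ∫ x, φ x ∂(gammaFK M0 M G n)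

/-- `η_n(φ) = γ_n(φ)/γ_n(1)`. -/
def eInt (M0 : Measure X) (M : ℕ → Kernel X X) (G : ℕ → X → ℝ) (n : ℕ) (φ : X → ℝ) : ℝ :=
  gInt M0 M G n φ / gInt M0 M G n 1

/-- Law of the path `(X_0,…,X_k)` of an inhomogeneous Markov chain with initial law `μ0` and
transitions `κ`, recorded as an element of `ℕ → Y` (coordinates beyond `k` are junk). -/
def markovPath {Y : Type*} [MeasurableSpace Y] (μ0 : Measure Y) (κ : ℕ → Y → Measure Y) :
    ℕ → Measure (ℕ → Y)
  | 0 => μ0.map fun y _ => y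
  | k + 1 =>
      (markovPath μ0 κ k).bind fun ω =>
        (κ (k + 1) (ω k)).map fun y => Function.update ω (k + 1) y

/-- Categorical distribution on `{0,…,m−1} ⊆ ℕ` with weights `w`. -/
def cat (m : ℕ) (w : ℕ → ℝ) : Measure ℕ :=
  (∑ j ∈ Finset.range m, ENNReal.ofReal (w j))⁻¹ •
    ∑ j ∈ Finset.range m, ENNReal.ofReal (w j) • Measure.dirac j

/-- Uniform distribution on `{0,…,m−1}`. -/
def unif (m : ℕ) : Measure ℕ := cat m fun _ => 1

/-- Extend a finite tuple to `ℕ` with junk values. -/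
def padF {Y : Type*} [Nonempty Y] {m : ℕ} (f : Fin m → Y) : ℕ → Y := fun i =>
  if h : i < m then f ⟨i, h⟩ else Classical.arbitrary Y

/-- One resampling/mutation step of the particle filter: given the time-`p` configuration `z`,
the joint law of the ancestor indices `A_p` and the time-`p+1` particle configuration;
each of the `Np (p+1)` new particles independently draws an ancestor from the categorical
distribution with weights `G p (z j)`, `j < Np p`, and then moves according to `M (p+1)`. -/
def pfStep [Nonempty X] (M : ℕ → Kernel X X) (G : ℕ → X → ℝ) (Np : ℕ → ℕ) (p : ℕ)
    (z : ℕ → X) : Measure ((ℕ → ℕ) × (ℕ → X)) :=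
  (Measure.pi fun _ : Fin (Np (p + 1)) =>
      (cat (Np p) fun j => G p (z j)).bind fun a =>
        (M (p + 1) (z a)).map fun x => (a, x)).map fun f =>
    (padF fun i => (f i).1, padF fun i => (f i).2)

/-- The law of the particle system `(ζ, A)` run up to time `k`: the first component is
`ζ : time → particle index → X`, the second is `A : time → particle index → ℕ`, where
`A p i` is the ancestor index of particle `i` of generation `p+1`. -/
def pfLaw [Nonempty X] (M0 : Measure X) (M : ℕ → Kernel X X) (G : ℕ → X → ℝ)
    (Np : ℕ → ℕ) : ℕ → Measure ((ℕ → ℕ → X) × (ℕ → ℕ → ℕ))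
  | 0 =>
      (Measure.pi fun _ : Fin (Np 0) => M0).map fun f =>
        (fun p => if p = 0 then padF f else fun _ => Classical.arbitrary X, fun _ _ => 0)
  | k + 1 =>
      (pfLaw M0 M G Np k).bind fun ω =>
        (pfStep M G Np k (ω.1 k)).map fun az =>
          (Function.update ω.1 (k + 1) az.2, Function.update ω.2 k az.1)

/-- Eve indices: `eve A 0 i = i` and `eve A (p+1) i = eve A p (A p i)`. -/
def eve (A : ℕ → ℕ → ℕ) : ℕ → ℕ → ℕ
  | 0 => fun i => i
  | p + 1 => fun i => eve A p (A p i)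

/-- `η_n^N(φ)`. -/
def etaN (Np : ℕ → ℕ) (n : ℕ) (φ : X → ℝ) (ω : (ℕ → ℕ → X) × (ℕ → ℕ → ℕ)) : ℝ :=
  (Np n : ℝ)⁻¹ * ∑ i ∈ Finset.range (Np n), φ (ω.1 n i)

/-- `γ_n^N(φ)`. -/
def gammaN (G : ℕ → X → ℝ) (Np : ℕ → ℕ) (n : ℕ) (φ : X → ℝ)
    (ω : (ℕ → ℕ → X) × (ℕ → ℕ → ℕ)) : ℝ :=
  (∏ p ∈ Finset.range n, etaN Np p (G p) ω) * etaN Np n φ ω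

/-- The variance estimator `V_n^N(φ)`. -/
def Vest (Np : ℕ → ℕ) (n : ℕ) (φ : X → ℝ) (ω : (ℕ → ℕ → X) × (ℕ → ℕ → ℕ)) : ℝ :=
  etaN Np n φ ω ^ 2 -
    (∏ p ∈ Finset.range n, (Np p : ℝ) / ((Np p : ℝ) - 1)) *
      ((Np n : ℝ) * ((Np n : ℝ) - 1))⁻¹ *
      ∑ i ∈ Finset.range (Np n), ∑ j ∈ Finset.range (Np n),
        if eve ω.2 n i ≠ eve ω.2 n j then φ (ω.1 n i) * φ (ω.1 n j) else 0

/-- Initial law of the doubled chain used to define `μ_b`. -/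
def pairInit (M0 : Measure X) (b : ℕ → Bool) : Measure (X × X) :=
  if b 0 then M0.map fun x => (x, x) else M0.prod M0

/-- Transitions of the doubled chain used to define `μ_b`. -/
def pairKer (M : ℕ → Kernel X X) (b : ℕ → Bool) (p : ℕ) (q : X × X) : Measure (X × X) :=
  if b p then (M p q.1).map fun y => (y, y) else (M p q.1).prod (M p q.2)

/-- `μ_b(φ) = E_b[φ(X_n, X_n') ∏_{p<n} G_p(X_p) G_p(X_p')]`. -/
def muB (M0 : Measure X) (M : ℕ → Kernel X X) (G : ℕ → X → ℝ) (n : ℕ) (b : ℕ → Bool)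
    (φ : X × X → ℝ) : ℝ :=
  ∫ ω, φ (ω n) * ∏ p ∈ Finset.range n, G p (ω p).1 * G p (ω p).2
    ∂(markovPath (pairInit M0 b) (pairKer M b) n)

/-- `φ ⊗ φ`. -/
def tens (φ : X → ℝ) : X × X → ℝ := fun q => φ q.1 * φ q.2

/-- The binary string `e_p`. -/
def eVec (p : ℕ) : ℕ → Bool := fun q => q == p

/-- The zero binary string `0_n`. -/
def zeroVec : ℕ → Bool := fun _ => false

/-- Extension of a finite binary string to `ℕ → Bool`. -/
def extB (n : ℕ) (b : Fin (n + 1) → Bool) : ℕ → Bool := fun p =>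
  if h : p < n + 1 then b ⟨p, h⟩ else false

/-- `v_{p,n}(φ) = (μ_{e_p}(φ⊗φ) − μ_{0_n}(φ⊗φ)) / γ_n(1)²`. -/
def vpn (M0 : Measure X) (M : ℕ → Kernel X X) (G : ℕ → X → ℝ) (n p : ℕ) (φ : X → ℝ) : ℝ :=
  (muB M0 M G n (eVec p) (tens φ) - muB M0 M G n zeroVec (tens φ)) / gInt M0 M G n 1 ^ 2

/-- `σ_n²(φ) = Σ_{p=0}^n c_p⁻¹ v_{p,n}(φ)`. -/
def sigma2 (M0 : Measure X) (M : ℕ → Kernel X X) (G : ℕ → X → ℝ) (c : ℕ → ℝ) (n : ℕ)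
    (φ : X → ℝ) : ℝ :=
  ∑ p ∈ Finset.range (n + 1), (c p)⁻¹ * vpn M0 M G n p φ

/-- Particle numbers `N_p = ⌈c_p N⌉`. -/
def npart (c : ℕ → ℝ) (N : ℕ) (p : ℕ) : ℕ := ⌈c p * (N : ℝ)⌉₊

/-- Backward tracing: `traceAux A n kn j = K_{n-j}` where `K_n = kn`, `K_p = A p (K_{p+1})`. -/
def traceAux (A : ℕ → ℕ → ℕ) (n kn : ℕ) : ℕ → ℕ
  | 0 => kn
  | j + 1 => A (n - (j + 1)) (traceAux A n kn j)

/-- The deterministic ancestral trace `K¹`: `trace A n kn p = K_p¹` given `K_n¹ = kn`. -/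
def trace (A : ℕ → ℕ → ℕ) (n kn : ℕ) : ℕ → ℕ := fun p => traceAux A n kn (n - p)

/-- Conditional law of the broken-lineage trace `(K_0²,…,K_p²)` given `K_p² = v`
(entries above `p` are junk, to be overwritten). -/
def k2Law (G : ℕ → X → ℝ) (Np : ℕ → ℕ) (ω : (ℕ → ℕ → X) × (ℕ → ℕ → ℕ)) (K1 : ℕ → ℕ) :
    ℕ → ℕ → Measure (ℕ → ℕ)
  | 0 => fun v => Measure.dirac fun q => if q = 0 then v else 0
  | p + 1 => fun v =>
      ((if v = K1 (p + 1) then cat (Np p) fun j => G p (ω.1 p j)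
          else Measure.dirac (ω.2 p v)).bind fun w =>
        (k2Law G Np ω K1 p w).map fun f => Function.update f (p + 1) v)

/-- Conditional law of `(K¹, K²)` given the particle system `ω = (ζ, A)`. -/
def kLaw (G : ℕ → X → ℝ) (Np : ℕ → ℕ) (n : ℕ) (ω : (ℕ → ℕ → X) × (ℕ → ℕ → ℕ)) :
    Measure ((ℕ → ℕ) × (ℕ → ℕ)) :=
  (unif (Np n)).bind fun k1n =>
    (unif (Np n)).bind fun k2n =>
      (k2Law G Np ω (trace ω.2 n k1n) n k2n).map fun k2 => (trace ω.2 n k1n, k2)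

/-- Joint law of the particle system together with the tracing variables `(K¹, K²)`. -/
def pfkLaw [Nonempty X] (M0 : Measure X) (M : ℕ → Kernel X X) (G : ℕ → X → ℝ)
    (Np : ℕ → ℕ) (n : ℕ) :
    Measure (((ℕ → ℕ → X) × (ℕ → ℕ → ℕ)) × ((ℕ → ℕ) × (ℕ → ℕ))) :=
  (pfLaw M0 M G Np n).bind fun ω => (kLaw G Np n ω).map fun k => (ω, k)

/-- `(k¹, k²) ∈ I(b)`. -/
def inI (Np : ℕ → ℕ) (n : ℕ) (b : ℕ → Bool) (k : (ℕ → ℕ) × (ℕ → ℕ)) : Prop :=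
  ∀ p ≤ n, k.1 p < Np p ∧ k.2 p < Np p ∧ (k.1 p = k.2 p ↔ b p = true)

/-- The particle approximation `μ_b^N(φ)` (a function of the realization `ω = (ζ, A)`);
the conditional expectation given `(A, ζ)` is the integral with respect to `kLaw`. -/
def muBN (G : ℕ → X → ℝ) (Np : ℕ → ℕ) (n : ℕ) (b : ℕ → Bool) (φ : X × X → ℝ)
    (ω : (ℕ → ℕ → X) × (ℕ → ℕ → ℕ)) : ℝ :=
  (∏ p ∈ Finset.range (n + 1),
      if b p then (Np p : ℝ) else (Np p : ℝ) / ((Np p : ℝ) - 1)) *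
    gammaN G Np n 1 ω ^ 2 *
    ∫ k, (if inI Np n b k then (1 : ℝ) else 0) * φ (ω.1 n (k.1 n), ω.1 n (k.2 n))
      ∂(kLaw G Np n ω)

/-- `v_{p,n}^N(φ)`. -/
def vpnN (G : ℕ → X → ℝ) (Np : ℕ → ℕ) (n p : ℕ) (φ : X → ℝ)
    (ω : (ℕ → ℕ → X) × (ℕ → ℕ → ℕ)) : ℝ :=
  (muBN G Np n (eVec p) (tens φ) ω - muBN G Np n zeroVec (tens φ) ω) / gammaN G Np n 1 ω ^ 2

/-- `v_n^N(φ) = Σ_{p=0}^n c_p⁻¹ v_{p,n}^N(φ)`. -/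
def vnN (G : ℕ → X → ℝ) (Np : ℕ → ℕ) (c : ℕ → ℝ) (n : ℕ) (φ : X → ℝ)
    (ω : (ℕ → ℕ → X) × (ℕ → ℕ → ℕ)) : ℝ :=
  ∑ p ∈ Finset.range (n + 1), (c p)⁻¹ * vpnN G Np n p φ ω

/-- `QAux M G n φ j = Q_{n-j,n}(φ)`. -/
def QAux (M : ℕ → Kernel X X) (G : ℕ → X → ℝ) (n : ℕ) (φ : X → ℝ) : ℕ → X → ℝ
  | 0 => φ
  | j + 1 => fun x => G (n - (j + 1)) x * ∫ y, QAux M G n φ j y ∂(M (n - j) x)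

/-- `Q_{p,n}(φ)` where `Q_p(x, dx') = G_{p-1}(x) M_p(x, dx')`, `Q_{n,n} = Id`,
`Q_{p,n} = Q_{p+1} ⋯ Q_n`. -/
def Qpn (M : ℕ → Kernel X X) (G : ℕ → X → ℝ) (n p : ℕ) (φ : X → ℝ) : X → ℝ :=
  QAux M G n φ (n - p)

/-- `φ̂ = G_n · φ`. -/
def hatf (G : ℕ → X → ℝ) (n : ℕ) (φ : X → ℝ) : X → ℝ := fun x => G n x * φ x

/-- `γ̂_n(φ) = γ_n(G_n φ)`. -/
def gHatInt (M0 : Measure X) (M : ℕ → Kernel X X) (G : ℕ → X → ℝ) (n : ℕ) (φ : X → ℝ) : ℝ :=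
  gInt M0 M G n (hatf G n φ)

/-- `η̂_n(φ) = γ̂_n(φ)/γ̂_n(1)`. -/
def eHatInt (M0 : Measure X) (M : ℕ → Kernel X X) (G : ℕ → X → ℝ) (n : ℕ) (φ : X → ℝ) : ℝ :=
  gHatInt M0 M G n φ / gHatInt M0 M G n 1

/-- `γ̂_n^N(φ) = γ_n^N(G_n φ)`. -/
def gammaHatN (G : ℕ → X → ℝ) (Np : ℕ → ℕ) (n : ℕ) (φ : X → ℝ)
    (ω : (ℕ → ℕ → X) × (ℕ → ℕ → ℕ)) : ℝ :=
  gammaN G Np n (hatf G n φ) ω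

/-- `η̂_n^N(φ) = γ̂_n^N(φ)/γ̂_n^N(1)`. -/
def etaHatN (G : ℕ → X → ℝ) (Np : ℕ → ℕ) (n : ℕ) (φ : X → ℝ)
    (ω : (ℕ → ℕ → X) × (ℕ → ℕ → ℕ)) : ℝ :=
  gammaHatN G Np n φ ω / gammaHatN G Np n 1 ω

/-- `v̂_{p,n}(φ) = v_{p,n}(φ̂)/η_n(G_n)²`. -/
def vpnHat (M0 : Measure X) (M : ℕ → Kernel X X) (G : ℕ → X → ℝ) (n p : ℕ) (φ : X → ℝ) : ℝ :=
  vpn M0 M G n p (hatf G n φ) / eInt M0 M G n (G n) ^ 2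

/-- `σ̂_n²(φ) = Σ_{p=0}^n c_p⁻¹ v̂_{p,n}(φ)`. -/
def sigma2Hat (M0 : Measure X) (M : ℕ → Kernel X X) (G : ℕ → X → ℝ) (c : ℕ → ℝ) (n : ℕ)
    (φ : X → ℝ) : ℝ :=
  ∑ p ∈ Finset.range (n + 1), (c p)⁻¹ * vpnHat M0 M G n p φ

/-- `V̂_n^N(φ) = V_n^N(φ̂)/η_n^N(G_n)²`. -/
def VestHat (G : ℕ → X → ℝ) (Np : ℕ → ℕ) (n : ℕ) (φ : X → ℝ)
    (ω : (ℕ → ℕ → X) × (ℕ → ℕ → ℕ)) : ℝ :=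
  Vest Np n (hatf G n φ) ω / etaN Np n (G n) ω ^ 2

/-- `v̂_{p,n}^N(φ) = v_{p,n}^N(φ̂)/η_n^N(G_n)²`. -/
def vpnHatN (G : ℕ → X → ℝ) (Np : ℕ → ℕ) (n p : ℕ) (φ : X → ℝ)
    (ω : (ℕ → ℕ → X) × (ℕ → ℕ → ℕ)) : ℝ :=
  vpnN G Np n p (hatf G n φ) ω / etaN Np n (G n) ω ^ 2

/-- `v̂_n^N(φ) = Σ_{p=0}^n c_p⁻¹ v̂_{p,n}^N(φ)`. -/
def vnHatN (G : ℕ → X → ℝ) (Np : ℕ → ℕ) (c : ℕ → ℝ) (n : ℕ) (φ : X → ℝ)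
    (ω : (ℕ → ℕ → X) × (ℕ → ℕ → ℕ)) : ℝ :=
  ∑ p ∈ Finset.range (n + 1), (c p)⁻¹ * vpnHatN G Np n p φ ω


open PFVar MeasureTheory ProbabilityTheory Filter

/-! ### Bounded measurable functions -/

/-- Bounded measurable real functions. -/
structure BddMeas {Ω : Type*} [MeasurableSpace Ω] (f : Ω → ℝ) : Prop where
  meas : Measurable f
  bdd : ∃ C, ∀ x, |f x| ≤ C

namespace BddMeas

variable {Ω Ω' : Type*} [MeasurableSpace Ω] [MeasurableSpace Ω'] {f g : Ω → ℝ}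

theorem integrable (hf : BddMeas f) (μ : Measure Ω) [IsFiniteMeasure μ] : Integrable f μ := by
  obtain ⟨C, hC⟩ := hf.bdd
  exact Integrable.of_bound hf.meas.aestronglyMeasurable C (Eventually.of_forall hC)

theorem const (c : ℝ) : BddMeas fun _ : Ω => c := ⟨measurable_const, |c|, fun _ => le_rfl⟩

theorem add (hf : BddMeas f) (hg : BddMeas g) : BddMeas fun x => f x + g x := by
  obtain ⟨C, hC⟩ := hf.bdd
  obtain ⟨D, hD⟩ := hg.bdd
  exact ⟨hf.meas.add hg.meas, C + D,
    fun x => (abs_add_le _ _).trans (add_le_add (hC x) (hD x))⟩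

theorem mul (hf : BddMeas f) (hg : BddMeas g) : BddMeas fun x => f x * g x := by
  obtain ⟨C, hC⟩ := hf.bdd
  obtain ⟨D, hD⟩ := hg.bdd
  refine ⟨hf.meas.mul hg.meas, C * D, fun x => ?_⟩
  rw [abs_mul]
  exact mul_le_mul (hC x) (hD x) (abs_nonneg _) ((abs_nonneg _).trans (hC x))

theorem sub (hf : BddMeas f) (hg : BddMeas g) : BddMeas fun x => f x - g x := by
  have := hf.add ((const (-1)).mul hg)
  simpa [sub_eq_add_neg] using this

theorem pow (hf : BddMeas f) (k : ℕ) : BddMeas fun x => f x ^ k := by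
  induction k with
  | zero => simpa using const 1
  | succ k ih => simpa [pow_succ] using ih.mul hf

theorem sum {ι : Type*} {s : Finset ι} {F : ι → Ω → ℝ} (hF : ∀ i ∈ s, BddMeas (F i)) :
    BddMeas fun x => ∑ i ∈ s, F i x := by
  induction s using Finset.induction_on with
  | empty => simpa using const 0
  | insert a s ha ih =>
    simp only [Finset.sum_insert ha]
    exact (hF a (by simp)).add (ih fun i hi => hF i (by simp [hi]))

theorem prod {ι : Type*} {s : Finset ι} {F : ι → Ω → ℝ} (hF : ∀ i ∈ s, BddMeas (F i)) :
    BddMeas fun x => ∏ i ∈ s, F i x := by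
  induction s using Finset.induction_on with
  | empty => simpa using const 1
  | insert a s ha ih =>
    simp only [Finset.prod_insert ha]
    exact (hF a (by simp)).mul (ih fun i hi => hF i (by simp [hi]))

theorem comp (hf : BddMeas f) {u : Ω' → Ω} (hu : Measurable u) : BddMeas fun x => f (u x) := by
  obtain ⟨C, hC⟩ := hf.bdd
  exact ⟨hf.meas.comp hu, C, fun x => hC _⟩

theorem ite (p : Prop) [Decidable p] (hf : BddMeas f) (hg : BddMeas g) :
    BddMeas fun x => if p then f x else g x := by
  split_ifs <;> assumption

theorem integral {κ : Ω' → Measure Ω} (hκ : Measurable κ) [∀ a, IsProbabilityMeasure (κ a)]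
    (hf : BddMeas f) : BddMeas fun a => ∫ x, f x ∂(κ a) := by
  obtain ⟨C, hC⟩ := hf.bdd
  refine ⟨?_, C, fun a => ?_⟩
  · exact (hf.meas.stronglyMeasurable.integral_kernel (κ := ⟨κ, hκ⟩)).measurable
  · have := norm_integral_le_of_norm_le_const (μ := κ a) (f := f) (C := C)
      (Eventually.of_forall hC)
    simpa using this

end BddMeas

theorem abs_integral_le_of_abs_le {Ω : Type*} [MeasurableSpace Ω] {μ : Measure Ω}
    [IsProbabilityMeasure μ] {f : Ω → ℝ} {C : ℝ} (hC : ∀ x, |f x| ≤ C) : |∫ x, f x ∂μ| ≤ C := by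
  have := norm_integral_le_of_norm_le_const (μ := μ) (f := f) (C := C) (Eventually.of_forall hC)
  simpa using this

theorem isProbabilityMeasure_bind {Ω Ω' : Type*} [MeasurableSpace Ω] [MeasurableSpace Ω']
    (μ : Measure Ω) [IsProbabilityMeasure μ] {κ : Ω → Measure Ω'} (hκ : Measurable κ)
    [∀ a, IsProbabilityMeasure (κ a)] : IsProbabilityMeasure (μ.bind κ) :=
  ⟨by rw [Measure.bind_apply .univ hκ.aemeasurable]; simp⟩

theorem integral_bind_of_bddMeas {Ω Ω' : Type*} [MeasurableSpace Ω] [MeasurableSpace Ω']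
    (μ : Measure Ω) [IsFiniteMeasure μ] {κ : Ω → Measure Ω'} (hκ : Measurable κ)
    [∀ a, IsProbabilityMeasure (κ a)] {f : Ω' → ℝ} (hf : BddMeas f) :
    ∫ y, f y ∂(μ.bind κ) = ∫ x, ∫ y, f y ∂(κ x) ∂μ := by
  let K : Kernel Ω Ω' := ⟨κ, hκ⟩
  have : IsMarkovKernel K := ⟨fun a => inferInstanceAs (IsProbabilityMeasure (κ a))⟩
  have : IsFiniteMeasure (μ.bind K) := by infer_instance
  have := Kernel.integral_comp (κ := Kernel.const Unit μ) (η := K) (a := ()) (f := f)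
    (by rw [← Measure.comp_eq_comp_const_apply]; exact hf.integrable _)
  rw [← Measure.comp_eq_comp_const_apply] at this
  exact this

theorem measurable_pi_measure {α ι Y : Type*} [MeasurableSpace α] [Fintype ι] [MeasurableSpace Y]
    {κ : α → Measure Y} (hκ : Measurable κ) [∀ a, IsProbabilityMeasure (κ a)] :
    Measurable fun a => Measure.pi fun _ : ι => κ a := by
  refine Measurable.measure_of_isPiSystem_of_isProbabilityMeasure
    (generateFrom_pi (α := fun _ : ι => Y)).symm isPiSystem_pi ?_
  rintro _ ⟨t, ht, rfl⟩
  simp only [Measure.pi_pi]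
  refine Finset.measurable_prod _ fun i _ => ?_
  exact (Measure.measurable_coe (ht i (Set.mem_univ i))).comp hκ

theorem measurable_map_of_uncurry {α β γ : Type*} [MeasurableSpace α] [MeasurableSpace β]
    [MeasurableSpace γ] {κ : α → Measure β} (hκ : Measurable κ) [∀ a, IsProbabilityMeasure (κ a)]
    {g : α → β → γ} (hg : Measurable fun q : α × β => g q.1 q.2) :
    Measurable fun a => (κ a).map (g a) := by
  let K : Kernel α β := ⟨κ, hκ⟩
  have : IsMarkovKernel K := ⟨fun a => inferInstanceAs (IsProbabilityMeasure (κ a))⟩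
  have h := ((Kernel.id ×ₖ K).map fun q : α × β => g q.1 q.2).measurable
  convert h using 2 with a
  rw [Kernel.map_apply _ hg, Kernel.prod_apply, Kernel.id_apply, Measure.dirac_prod,
    Measure.map_map hg (by fun_prop)]
  rfl

/-! ### Moments of pair sums -/

section PairSums

variable {Ω : Type*} [MeasurableSpace Ω] {ι : Type*} [Fintype ι]

theorem sum_mul_ite_le_sum_sq (H : ι → ι → ℝ) (hH : ∀ i j, H i j = H j i) :
    ∑ i, ∑ j, ∑ k, ∑ l, (((if i = k then H i j * H k l else 0) + (if i = l then H i j * H k l else 0)) +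
      ((if j = k then H i j * H k l else 0) + (if j = l then H i j * H k l else 0))) =
      4 * ∑ i, (∑ j, H i j) ^ 2 := by
  have h1 : ∑ i, ∑ j, ∑ k, ∑ l, (if i = k then H i j * H k l else 0) =
      ∑ i, (∑ j, H i j) ^ 2 := by
    refine Finset.sum_congr rfl fun i _ => ?_
    rw [sq, Finset.sum_mul_sum]
    refine Finset.sum_congr rfl fun j _ => ?_
    rw [Finset.sum_comm]
    simp
  have h2 : ∑ i, ∑ j, ∑ k, ∑ l, (if i = l then H i j * H k l else 0) =
      ∑ i, (∑ j, H i j) ^ 2 := by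
    rw [← h1]
    refine Finset.sum_congr rfl fun i _ => Finset.sum_congr rfl fun j _ => ?_
    rw [Finset.sum_comm]
    refine Finset.sum_congr rfl fun k _ => Finset.sum_congr rfl fun l _ => ?_
    rw [hH k l]
  have h3 : ∑ i, ∑ j, ∑ k, ∑ l, (if j = k then H i j * H k l else 0) =
      ∑ i, (∑ j, H i j) ^ 2 := by
    rw [← h1, Finset.sum_comm]
    refine Finset.sum_congr rfl fun i _ => Finset.sum_congr rfl fun j _ => ?_
    refine Finset.sum_congr rfl fun k _ => Finset.sum_congr rfl fun l _ => ?_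
    rw [hH i j]
  have h4 : ∑ i, ∑ j, ∑ k, ∑ l, (if j = l then H i j * H k l else 0) =
      ∑ i, (∑ j, H i j) ^ 2 := by
    rw [← h2, Finset.sum_comm]
    refine Finset.sum_congr rfl fun i _ => Finset.sum_congr rfl fun j _ => ?_
    refine Finset.sum_congr rfl fun k _ => Finset.sum_congr rfl fun l _ => ?_
    rw [hH i j]
  simp only [Finset.sum_add_distrib]
  rw [h1, h2, h3, h4]
  ring

/-- Variance bound for a double sum whose terms with disjoint indices are uncorrelated. -/
theorem integral_sq_sum_sub_le (μ : Measure Ω) [IsProbabilityMeasure μ]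
    {Z H : ι → ι → Ω → ℝ} (hZ : ∀ i j, BddMeas (Z i j)) (hHm : ∀ i j, BddMeas (H i j))
    (hZH : ∀ i j ω, |Z i j ω| ≤ H i j ω) (hH : ∀ i j ω, H i j ω = H j i ω)
    (hdisj : ∀ i j k l, i ≠ k → i ≠ l → j ≠ k → j ≠ l →
      ∫ ω, Z i j ω * Z k l ω ∂μ = (∫ ω, Z i j ω ∂μ) * ∫ ω, Z k l ω ∂μ)
    (hpos : ∀ i j k l, 0 ≤ (∫ ω, Z i j ω ∂μ) * ∫ ω, Z k l ω ∂μ) :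
    ∫ ω, (∑ i, ∑ j, Z i j ω - ∑ i, ∑ j, ∫ ω, Z i j ω ∂μ) ^ 2 ∂μ ≤
      4 * ∫ ω, ∑ i, (∑ j, H i j ω) ^ 2 ∂μ := by
  set e : ι → ι → ℝ := fun i j => ∫ ω, Z i j ω ∂μ with he
  have hS : BddMeas fun ω => ∑ i, ∑ j, Z i j ω :=
    BddMeas.sum fun i _ => BddMeas.sum fun j _ => hZ i j
  have hmean : ∫ ω, ∑ i, ∑ j, Z i j ω ∂μ = ∑ i, ∑ j, e i j := by
    rw [integral_finsetSum _ fun i _ => (BddMeas.sum fun j _ => hZ i j).integrable μ]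
    refine Finset.sum_congr rfl fun i _ => ?_
    rw [integral_finsetSum _ fun j _ => (hZ i j).integrable μ]
  have hvar : ∫ ω, (∑ i, ∑ j, Z i j ω - ∑ i, ∑ j, e i j) ^ 2 ∂μ =
      ∫ ω, (∑ i, ∑ j, Z i j ω) ^ 2 ∂μ - (∑ i, ∑ j, e i j) ^ 2 := by
    have h1 : ∀ ω, (∑ i, ∑ j, Z i j ω - ∑ i, ∑ j, e i j) ^ 2 =
        ((∑ i, ∑ j, Z i j ω) ^ 2 - 2 * (∑ i, ∑ j, e i j) * (∑ i, ∑ j, Z i j ω)) +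
          (∑ i, ∑ j, e i j) ^ 2 := fun ω => by ring
    simp only [h1]
    rw [integral_add (((hS.pow 2).sub ((BddMeas.const _).mul hS)).integrable μ)
      (integrable_const _), integral_sub ((hS.pow 2).integrable μ)
      (((BddMeas.const _).mul hS).integrable μ), integral_const_mul, hmean]
    simp
    ring
  rw [hvar]
  have hsq : ∀ a : ι → ι → ℝ, (∑ i, ∑ j, a i j) ^ 2 =
      ∑ i, ∑ j, ∑ k, ∑ l, a i j * a k l := by
    intro a
    rw [sq, Finset.sum_mul]
    refine Finset.sum_congr rfl fun i _ => ?_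
    rw [Finset.sum_mul]
    refine Finset.sum_congr rfl fun j _ => ?_
    rw [Finset.mul_sum]
    refine Finset.sum_congr rfl fun k _ => ?_
    rw [Finset.mul_sum]
  have hI : ∫ ω, (∑ i, ∑ j, Z i j ω) ^ 2 ∂μ =
      ∑ i, ∑ j, ∑ k, ∑ l, ∫ ω, Z i j ω * Z k l ω ∂μ := by
    simp only [hsq]
    rw [integral_finsetSum _ fun i _ => (BddMeas.sum fun j _ => BddMeas.sum fun k _ =>
      BddMeas.sum fun l _ => (hZ i j).mul (hZ k l)).integrable μ]
    refine Finset.sum_congr rfl fun i _ => ?_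
    rw [integral_finsetSum _ fun j _ => (BddMeas.sum fun k _ =>
      BddMeas.sum fun l _ => (hZ i j).mul (hZ k l)).integrable μ]
    refine Finset.sum_congr rfl fun j _ => ?_
    rw [integral_finsetSum _ fun k _ => (
      BddMeas.sum fun l _ => (hZ i j).mul (hZ k l)).integrable μ]
    refine Finset.sum_congr rfl fun k _ => ?_
    rw [integral_finsetSum _ fun l _ => ((hZ i j).mul (hZ k l)).integrable μ]
  have hH0 : ∀ i j ω, 0 ≤ H i j ω := fun i j ω => (abs_nonneg _).trans (hZH i j ω)
  set B : ι → ι → ι → ι → Ω → ℝ := fun i j k l ω =>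
    ((if i = k then H i j ω * H k l ω else 0) + (if i = l then H i j ω * H k l ω else 0)) +
      ((if j = k then H i j ω * H k l ω else 0) + (if j = l then H i j ω * H k l ω else 0)) with hB
  have hBm : ∀ i j k l, BddMeas (B i j k l) := by
    intro i j k l
    have hm := (hHm i j).mul (hHm k l)
    exact ((BddMeas.ite _ hm (.const 0)).add (BddMeas.ite _ hm (.const 0))).add
      ((BddMeas.ite _ hm (.const 0)).add (BddMeas.ite _ hm (.const 0)))
  have hB0 : ∀ i j k l ω, 0 ≤ B i j k l ω := by
    intro i j k l ω
    have := mul_nonneg (hH0 i j ω) (hH0 k l ω)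
    simp only [hB]
    positivity
  have hterm : ∀ i j k l, ∫ ω, Z i j ω * Z k l ω ∂μ - e i j * e k l ≤ ∫ ω, B i j k l ω ∂μ := by
    intro i j k l
    by_cases hd : i ≠ k ∧ i ≠ l ∧ j ≠ k ∧ j ≠ l
    · rw [hdisj i j k l hd.1 hd.2.1 hd.2.2.1 hd.2.2.2, sub_self]
      exact integral_nonneg (hB0 i j k l)
    · have : ∫ ω, Z i j ω * Z k l ω ∂μ ≤ ∫ ω, B i j k l ω ∂μ := by
        refine integral_mono (((hZ i j).mul (hZ k l)).integrable μ) ((hBm i j k l).integrable μ)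
          fun ω => ?_
        have h1 : Z i j ω * Z k l ω ≤ H i j ω * H k l ω := by
          refine (le_abs_self _).trans ?_
          rw [abs_mul]
          exact mul_le_mul (hZH i j ω) (hZH k l ω) (abs_nonneg _) (hH0 i j ω)
        have h2 := mul_nonneg (hH0 i j ω) (hH0 k l ω)
        refine h1.trans ?_
        simp only [hB]
        have hn : ∀ p : Prop, ∀ [Decidable p], 0 ≤ if p then H i j ω * H k l ω else 0 := by
          intro p _
          split_ifs <;> simp [h2]
        have hc : i = k ∨ i = l ∨ j = k ∨ j = l := by
          by_contra hcon
          push Not at hcon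
          exact hd hcon
        rcases hc with h | h | h | h
        · rw [if_pos h]; linarith [hn (i = l), hn (j = k), hn (j = l)]
        · rw [if_pos h]; linarith [hn (i = k), hn (j = k), hn (j = l)]
        · rw [if_pos h]; linarith [hn (i = l), hn (i = k), hn (j = l)]
        · rw [if_pos h]; linarith [hn (i = l), hn (j = k), hn (i = k)]
      linarith [hpos i j k l]
  calc ∫ ω, (∑ i, ∑ j, Z i j ω) ^ 2 ∂μ - (∑ i, ∑ j, e i j) ^ 2
      = ∑ i, ∑ j, ∑ k, ∑ l, (∫ ω, Z i j ω * Z k l ω ∂μ - e i j * e k l) := by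
        rw [hI, hsq]
        simp only [Finset.sum_sub_distrib]
    _ ≤ ∑ i, ∑ j, ∑ k, ∑ l, ∫ ω, B i j k l ω ∂μ := by
        refine Finset.sum_le_sum fun i _ => Finset.sum_le_sum fun j _ =>
          Finset.sum_le_sum fun k _ => Finset.sum_le_sum fun l _ => hterm i j k l
    _ = ∫ ω, ∑ i, ∑ j, ∑ k, ∑ l, B i j k l ω ∂μ := by
        rw [integral_finsetSum _ fun i _ => (BddMeas.sum fun j _ => BddMeas.sum fun k _ =>
          BddMeas.sum fun l _ => hBm i j k l).integrable μ]
        refine Finset.sum_congr rfl fun i _ => ?_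
        rw [integral_finsetSum _ fun j _ => (BddMeas.sum fun k _ =>
          BddMeas.sum fun l _ => hBm i j k l).integrable μ]
        refine Finset.sum_congr rfl fun j _ => ?_
        rw [integral_finsetSum _ fun k _ => (
          BddMeas.sum fun l _ => hBm i j k l).integrable μ]
        refine Finset.sum_congr rfl fun k _ => ?_
        rw [integral_finsetSum _ fun l _ => (hBm i j k l).integrable μ]
    _ = 4 * ∫ ω, ∑ i, (∑ j, H i j ω) ^ 2 ∂μ := by
        rw [← integral_const_mul]
        refine integral_congr_ae (Eventually.of_forall fun ω => ?_)
        exact sum_mul_ite_le_sum_sq (fun i j => H i j ω) fun i j => hH i j ω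

end PairSums

/-! ### Product measures with identical factors -/

section Pi

variable {Y ι : Type*} [MeasurableSpace Y] [Fintype ι]

theorem integral_pi_eval (ν : Measure Y) [IsProbabilityMeasure ν] (i : ι) {h : Y → ℝ}
    (hh : Measurable h) : ∫ f, h (f i) ∂(Measure.pi fun _ : ι => ν) = ∫ y, h y ∂ν := by
  have hp := measurePreserving_eval (fun _ : ι => ν) i
  have h1 := integral_map hp.measurable.aemeasurable
    (hh.aestronglyMeasurable (μ := (Measure.pi fun _ : ι => ν).map (Function.eval i)))
  rw [hp.map_eq] at h1
  exact h1.symm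

theorem iIndepFun_eval (ν : Measure Y) [IsProbabilityMeasure ν] :
    iIndepFun (fun (i : ι) (f : ι → Y) => f i) (Measure.pi fun _ : ι => ν) :=
  iIndepFun_pi (X := fun _ => id) fun _ => aemeasurable_id

theorem map_pi_eval_pair (ν : Measure Y) [IsProbabilityMeasure ν] {i j : ι} (hij : i ≠ j) :
    (Measure.pi fun _ : ι => ν).map (fun f => (f i, f j)) = ν.prod ν := by
  have h := (iIndepFun_eval (ι := ι) ν).indepFun hij
  rw [indepFun_iff_map_prod_eq_prod_map_map (measurable_pi_apply i).aemeasurable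
    (measurable_pi_apply j).aemeasurable] at h
  rw [h, (measurePreserving_eval (fun _ : ι => ν) i).map_eq,
    (measurePreserving_eval (fun _ : ι => ν) j).map_eq]

theorem integral_pi_pair (ν : Measure Y) [IsProbabilityMeasure ν] {i j : ι} (hij : i ≠ j)
    {h : Y × Y → ℝ} (hh : BddMeas h) :
    ∫ f, h (f i, f j) ∂(Measure.pi fun _ : ι => ν) = ∫ y, ∫ y', h (y, y') ∂ν ∂ν := by
  rw [← integral_prod _ (hh.integrable _), ← map_pi_eval_pair ν hij,
    integral_map (by fun_prop) hh.meas.aestronglyMeasurable]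

theorem integral_pi_triple (ν : Measure Y) [IsProbabilityMeasure ν] {i j k : ι} (hij : i ≠ j)
    (hik : i ≠ k) (hjk : j ≠ k) {h : (Y × Y) × Y → ℝ} (hh : BddMeas h) :
    ∫ f, h ((f i, f j), f k) ∂(Measure.pi fun _ : ι => ν) =
      ∫ y, ∫ y', ∫ y'', h ((y, y'), y'') ∂ν ∂ν ∂ν := by
  have hi := (iIndepFun_eval (ι := ι) ν).indepFun_prodMk (fun i => measurable_pi_apply i)
    i j k hik hjk
  rw [indepFun_iff_map_prod_eq_prod_map_map (by fun_prop)
      (measurable_pi_apply k).aemeasurable,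
    map_pi_eval_pair ν hij, (measurePreserving_eval (fun _ : ι => ν) k).map_eq] at hi
  have h1 : ∫ f, h ((f i, f j), f k) ∂(Measure.pi fun _ : ι => ν) =
      ∫ q, h q ∂((ν.prod ν).prod ν) := by
    rw [← hi, integral_map (by fun_prop) hh.meas.aestronglyMeasurable]
  rw [h1, integral_prod _ (hh.integrable _)]
  have h2 : BddMeas fun q : Y × Y => ∫ y'', h (q, y'') ∂ν := by
    obtain ⟨C, hC⟩ := hh.bdd
    exact ⟨(hh.meas.stronglyMeasurable.integral_prod_right').measurable, C,
      fun q => abs_integral_le_of_abs_le fun y => hC _⟩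
  rw [integral_prod _ (h2.integrable _)]

theorem integral_pi_mul_of_disjoint (ν : Measure Y) [IsProbabilityMeasure ν] {i j k l : ι}
    (hik : i ≠ k) (hil : i ≠ l) (hjk : j ≠ k) (hjl : j ≠ l) {h h' : Y × Y → ℝ}
    (hh : Measurable h) (hh' : Measurable h') :
    ∫ f, h (f i, f j) * h' (f k, f l) ∂(Measure.pi fun _ : ι => ν) =
      (∫ f, h (f i, f j) ∂(Measure.pi fun _ : ι => ν)) *
        ∫ f, h' (f k, f l) ∂(Measure.pi fun _ : ι => ν) := by
  have hi := (iIndepFun_eval (ι := ι) ν).indepFun_prodMk_prodMk (fun i => measurable_pi_apply i)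
    i j k l hik hil hjk hjl
  exact (hi.comp hh hh').integral_fun_mul_eq_mul_integral
    (hh.comp (by fun_prop)).aestronglyMeasurable (hh'.comp (by fun_prop)).aestronglyMeasurable

/-- Variance bound for `∑_{i,j} 1{i = j ↔ β} h(y_i, y_j)` under an i.i.d. law. -/
theorem integral_sq_pairSum_sub_le (ν : Measure Y) [IsProbabilityMeasure ν] (β : Prop)
    [inst : ∀ i j : ι, Decidable (i = j ↔ β)] {h H : Y × Y → ℝ} (hh : BddMeas h) (hH : BddMeas H) (hhH : ∀ q, |h q| ≤ H q)
    (hsymm : ¬ β → ∀ y y', H (y, y') = H (y', y)) {e : ℝ}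
    (he : ∀ i j : ι, (i = j ↔ β) → ∫ f, h (f i, f j) ∂(Measure.pi fun _ : ι => ν) = e) :
    ∫ f : ι → Y, ((∑ i, ∑ j, if (i = j ↔ β) then h (f i, f j) else 0) -
        (∑ i : ι, ∑ j : ι, if (i = j ↔ β) then e else 0)) ^ 2 ∂(Measure.pi fun _ : ι => ν) ≤
      4 * ∫ f : ι → Y, ∑ i, (∑ j, if (i = j ↔ β) then H (f i, f j) else 0) ^ 2
        ∂(Measure.pi fun _ : ι => ν) := by
  have hm : ∀ i j : ι, ∫ f : ι → Y, (if (i = j ↔ β) then h (f i, f j) else 0)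
      ∂(Measure.pi fun _ : ι => ν) = if (i = j ↔ β) then e else 0 := by
    intro i j
    split_ifs with hc
    · exact he i j hc
    · simp
  have key := integral_sq_sum_sub_le (Measure.pi fun _ : ι => ν)
    (Z := fun i j f => if (i = j ↔ β) then h (f i, f j) else 0)
    (H := fun i j f => if (i = j ↔ β) then H (f i, f j) else 0)
    (fun i j => BddMeas.ite _ (hh.comp (by fun_prop)) (.const 0))
    (fun i j => BddMeas.ite _ (hH.comp (by fun_prop)) (.const 0))
    (fun i j f => by
      split_ifs
      · exact hhH _
      · simp)
    (fun i j f => by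
      by_cases hij : i = j
      · subst hij; rfl
      · by_cases hb : β
        · simp [hij, hb, Ne.symm hij]
        · simp only [hij, hb, Ne.symm hij, if_true]
          exact hsymm hb _ _)
    (fun i j k l hik hil hjk hjl => by
      by_cases h1 : (i = j ↔ β)
      · by_cases h2 : (k = l ↔ β)
        · simp only [h1, h2, if_true]
          exact integral_pi_mul_of_disjoint ν hik hil hjk hjl hh.meas hh.meas
        · simp [h2]
      · simp [h1])
    (fun i j k l => by
      rw [hm, hm]
      split_ifs <;> simp [mul_self_nonneg])
  simpa only [hm] using key

end Pi

/-! ### Convergence in probability along a sequence of laws -/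

/-- The filter of sets whose sections have probability tending to one. -/
def probFilter {Ω : Type*} [MeasurableSpace Ω] (P : ℕ → Measure Ω) : Filter (ℕ × Ω) where
  sets := {S | Tendsto (fun N => P N {ω | (N, ω) ∉ S}) atTop (nhds 0)}
  univ_sets := by simp
  sets_of_superset := by
    intro S T hS hST
    exact tendsto_of_tendsto_of_tendsto_of_le_of_le tendsto_const_nhds hS (fun _ => zero_le)
      fun N => measure_mono fun ω h h' => h (hST h')
  inter_sets := by
    intro S T hS hT
    have h := Tendsto.add hS hT
    rw [add_zero] at h
    refine tendsto_of_tendsto_of_tendsto_of_le_of_le tendsto_const_nhds h (fun _ => zero_le)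
      fun N => (measure_mono ?_).trans (measure_union_le _ _)
    intro ω hω
    by_contra hcon
    simp only [Set.mem_union, Set.mem_ofPred_eq, not_or, not_not] at hcon
    exact hω ⟨hcon.1, hcon.2⟩

section ProbFilter

variable {Ω : Type*} [MeasurableSpace Ω] {P : ℕ → Measure Ω}

theorem mem_probFilter {S : Set (ℕ × Ω)} :
    S ∈ probFilter P ↔ Tendsto (fun N => P N {ω | (N, ω) ∉ S}) atTop (nhds 0) := Iff.rfl

theorem tendsto_probFilter_iff {Y : ℕ → Ω → ℝ} {y : ℝ} :
    Tendsto (fun q : ℕ × Ω => Y q.1 q.2) (probFilter P) (nhds y) ↔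
      ∀ ε : ℝ, 0 < ε → Tendsto (fun N => P N {ω | ε ≤ |Y N ω - y|}) atTop (nhds 0) := by
  rw [Metric.tendsto_nhds]
  refine forall_congr' fun ε => imp_congr_right fun _ => ?_
  rw [Filter.Eventually, mem_probFilter]
  simp [Real.dist_eq]

theorem eventually_probFilter_of_atTop {p : ℕ → Prop} (hp : ∀ᶠ N in atTop, p N) :
    ∀ᶠ q : ℕ × Ω in probFilter P, p q.1 := by
  rw [Filter.Eventually, mem_probFilter]
  refine tendsto_const_nhds.congr' ?_
  filter_upwards [hp] with N hN
  simp [hN]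

theorem tendsto_probFilter_of_sq (hP : ∀ᶠ N in atTop, IsFiniteMeasure (P N)) {Y : ℕ → Ω → ℝ} {y : ℝ}
    (hY : ∀ᶠ N in atTop, BddMeas (Y N))
    (h : Tendsto (fun N => ∫ ω, (Y N ω - y) ^ 2 ∂(P N)) atTop (nhds 0)) :
    Tendsto (fun q : ℕ × Ω => Y q.1 q.2) (probFilter P) (nhds y) := by
  rw [tendsto_probFilter_iff]
  intro ε hε
  have h2 : Tendsto (fun N => ENNReal.ofReal ((∫ ω, (Y N ω - y) ^ 2 ∂(P N)) / ε ^ 2))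
      atTop (nhds 0) := by
    have := ENNReal.tendsto_ofReal (h.div_const (ε ^ 2))
    simpa using this
  refine tendsto_of_tendsto_of_tendsto_of_le_of_le' tendsto_const_nhds h2
    (Eventually.of_forall fun _ => zero_le) ?_
  filter_upwards [hY, hP] with N hN hPN
  have hm := mul_meas_ge_le_integral_of_nonneg (μ := P N) (f := fun ω => (Y N ω - y) ^ 2)
    (Eventually.of_forall fun ω => sq_nonneg _) (((hN.sub (.const y)).pow 2).integrable _) (ε ^ 2)
  have hs : {ω | ε ≤ |Y N ω - y|} ⊆ {ω | ε ^ 2 ≤ (Y N ω - y) ^ 2} := by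
    intro ω hω
    have : ε ≤ |Y N ω - y| := hω
    show ε ^ 2 ≤ (Y N ω - y) ^ 2
    rw [← sq_abs (Y N ω - y)]
    gcongr
  refine (measure_mono hs).trans ?_
  rw [← ENNReal.ofReal_toReal (measure_ne_top (P N) _)]
  refine ENNReal.ofReal_le_ofReal ?_
  rw [le_div_iff₀ (by positivity), mul_comm]
  exact hm

end ProbFilter

/-! ### The particle system as a Markov chain -/

/-- Standing assumptions on the potentials up to time `n`. -/
structure Potentials (G : ℕ → X → ℝ) (B : ℝ) (n : ℕ) : Prop where
  meas : ∀ p ≤ n, Measurable (G p)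
  pos : ∀ p ≤ n, ∀ x, 0 < G p x
  le : ∀ p ≤ n, ∀ x, G p x ≤ B
  one_le : 1 ≤ B

theorem Potentials.bddMeas {G : ℕ → X → ℝ} {B : ℝ} {n : ℕ} (hG : Potentials G B n) {p : ℕ}
    (hp : p ≤ n) : BddMeas (G p) :=
  ⟨hG.meas p hp, B, fun x => by rw [abs_of_pos (hG.pos p hp x)]; exact hG.le p hp x⟩

theorem Potentials.mono {G : ℕ → X → ℝ} {B : ℝ} {n k : ℕ} (hG : Potentials G B n) (hk : k ≤ n) :
    Potentials G B k :=
  ⟨fun p hp => hG.meas p (hp.trans hk), fun p hp => hG.pos p (hp.trans hk),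
    fun p hp => hG.le p (hp.trans hk), hG.one_le⟩

section Categorical

theorem sum_range_ofReal_ne_zero {m : ℕ} {w : ℕ → ℝ} (hm : 0 < m) (hw : ∀ j < m, 0 < w j) :
    ∑ j ∈ Finset.range m, ENNReal.ofReal (w j) ≠ 0 := by
  intro h
  rw [Finset.sum_eq_zero_iff] at h
  have := h 0 (Finset.mem_range.2 hm)
  rw [ENNReal.ofReal_eq_zero] at this
  linarith [hw 0 hm]

theorem isProbabilityMeasure_cat {m : ℕ} {w : ℕ → ℝ} (hm : 0 < m) (hw : ∀ j < m, 0 < w j) :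
    IsProbabilityMeasure (cat m w) := by
  constructor
  rw [cat]
  simp only [Measure.smul_apply, Measure.coe_finsetSum, Finset.sum_apply, measure_univ,
    smul_eq_mul, mul_one]
  exact ENNReal.inv_mul_cancel (sum_range_ofReal_ne_zero hm hw)
    (ENNReal.sum_ne_top.2 fun _ _ => ENNReal.ofReal_ne_top)

theorem integral_cat {m : ℕ} {w : ℕ → ℝ} (hw : ∀ j < m, 0 < w j) (f : ℕ → ℝ) :
    ∫ j, f j ∂(cat m w) =
      ∑ j ∈ Finset.range m, w j / (∑ j ∈ Finset.range m, w j) * f j := by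
  rw [cat, integral_smul_measure, integral_finsetSum_measure]
  · rw [← ENNReal.ofReal_sum_of_nonneg fun j hj => (hw j (Finset.mem_range.1 hj)).le,
      ENNReal.toReal_inv, ENNReal.toReal_ofReal
        (Finset.sum_nonneg fun j hj => (hw j (Finset.mem_range.1 hj)).le),
      Finset.smul_sum]
    refine Finset.sum_congr rfl fun j hj => ?_
    rw [integral_smul_measure, integral_dirac,
      ENNReal.toReal_ofReal (hw j (Finset.mem_range.1 hj)).le]
    simp only [smul_eq_mul]
    ring
  · intro j _
    exact (integrable_dirac (by simp)).smul_measure ENNReal.ofReal_ne_top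

end Categorical

/-- Normalised resampling weights. -/
def resW (G : ℕ → X → ℝ) (Np : ℕ → ℕ) (p : ℕ) (z : ℕ → X) (a : ℕ) : ℝ :=
  G p (z a) / ∑ j ∈ Finset.range (Np p), G p (z j)

/-- Joint law of the ancestor index and the new position of one particle. -/
def stepLaw (M : ℕ → Kernel X X) (G : ℕ → X → ℝ) (Np : ℕ → ℕ) (p : ℕ) (z : ℕ → X) :
    Measure (ℕ × X) :=
  (cat (Np p) fun j => G p (z j)).bind fun a => (M (p + 1) (z a)).map fun x => (a, x)

section Step

variable {M : ℕ → Kernel X X} {G : ℕ → X → ℝ} {Np : ℕ → ℕ} {B : ℝ} {p : ℕ}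

theorem measurable_mutation (z : ℕ → X) :
    Measurable fun a => (M (p + 1) (z a)).map fun x => (a, x) := measurable_of_countable _

theorem measurable_stepLaw (hG : Potentials G B p) : Measurable (stepLaw M G Np p) := by
  refine Measure.measurable_of_measurable_coe _ fun s hs => ?_
  have h : ∀ z, stepLaw M G Np p z s =
      (∑ j ∈ Finset.range (Np p), ENNReal.ofReal (G p (z j)))⁻¹ *
        ∑ j ∈ Finset.range (Np p), ENNReal.ofReal (G p (z j)) *
          M (p + 1) (z j) (Prod.mk j ⁻¹' s) := by
    intro z
    rw [stepLaw, Measure.bind_apply hs (measurable_mutation z).aemeasurable, cat,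
      lintegral_smul_measure, lintegral_finsetSum_measure]
    simp only [lintegral_smul_measure, lintegral_dirac, smul_eq_mul]
    congr 1
    refine Finset.sum_congr rfl fun j _ => ?_
    rw [Measure.map_apply (by fun_prop) hs]
  simp only [h]
  have hGp := hG.meas p le_rfl
  have hM : ∀ j : ℕ, Measurable fun z : ℕ → X => M (p + 1) (z j) (Prod.mk j ⁻¹' s) := fun j =>
    ((M (p + 1)).measurable_coe (measurable_prodMk_left hs)).comp (measurable_pi_apply j)
  have hw : ∀ j : ℕ, Measurable fun z : ℕ → X => ENNReal.ofReal (G p (z j)) := fun j =>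
    (hGp.comp (measurable_pi_apply j)).ennreal_ofReal
  exact (Finset.measurable_sum _ fun j _ => hw j).inv.mul
    (Finset.measurable_sum _ fun j _ => (hw j).mul (hM j))

variable [∀ p, IsMarkovKernel (M p)]

instance isProbabilityMeasure_mutation (z : ℕ → X) (a : ℕ) :
    IsProbabilityMeasure ((M (p + 1) (z a)).map fun x => (a, x)) :=
  Measure.isProbabilityMeasure_map (by fun_prop)

theorem isProbabilityMeasure_stepLaw (hG : Potentials G B p) (hN : 0 < Np p) (z : ℕ → X) :
    IsProbabilityMeasure (stepLaw M G Np p z) := by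
  have := isProbabilityMeasure_cat (w := fun j => G p (z j)) hN fun j _ => hG.pos p le_rfl _
  exact isProbabilityMeasure_bind _ (measurable_mutation z)

theorem integral_stepLaw (hG : Potentials G B p) (hN : 0 < Np p) (z : ℕ → X) {h : ℕ × X → ℝ}
    (hh : BddMeas h) :
    ∫ y, h y ∂(stepLaw M G Np p z) =
      ∑ a ∈ Finset.range (Np p), resW G Np p z a * ∫ x, h (a, x) ∂(M (p + 1) (z a)) := by
  have := isProbabilityMeasure_cat (w := fun j => G p (z j)) hN fun j _ => hG.pos p le_rfl _
  rw [stepLaw, integral_bind_of_bddMeas _ (measurable_mutation z) hh,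
    integral_cat fun j _ => hG.pos p le_rfl _]
  refine Finset.sum_congr rfl fun a _ => ?_
  rw [integral_map (by fun_prop) hh.meas.aestronglyMeasurable]
  rfl

end Step

section Chain

variable [Nonempty X]

/-- Extend a particle history by the generation `k + 1`. -/
def extend (k : ℕ) {m : ℕ} (ω : (ℕ → ℕ → X) × (ℕ → ℕ → ℕ)) (f : Fin m → ℕ × X) :
    (ℕ → ℕ → X) × (ℕ → ℕ → ℕ) :=
  (Function.update ω.1 (k + 1) (padF fun i => (f i).2),
    Function.update ω.2 k (padF fun i => (f i).1))

theorem measurable_padF {Y : Type*} [MeasurableSpace Y] [Nonempty Y] {m : ℕ} :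
    Measurable (padF : (Fin m → Y) → ℕ → Y) := by
  refine measurable_pi_iff.2 fun i => ?_
  unfold padF
  split_ifs
  · exact measurable_pi_apply _
  · exact measurable_const

theorem measurable_extend (k m : ℕ) :
    Measurable fun q : ((ℕ → ℕ → X) × (ℕ → ℕ → ℕ)) × (Fin m → ℕ × X) => extend k q.1 q.2 := by
  have h1 : Measurable fun q : ((ℕ → ℕ → X) × (ℕ → ℕ → ℕ)) × (Fin m → ℕ × X) =>
      (padF fun i => (q.2 i).2 : ℕ → X) := measurable_padF.comp (by fun_prop)
  have h2 : Measurable fun q : ((ℕ → ℕ → X) × (ℕ → ℕ → ℕ)) × (Fin m → ℕ × X) =>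
      (padF fun i => (q.2 i).1 : ℕ → ℕ) := measurable_padF.comp (by fun_prop)
  refine Measurable.prodMk ?_ ?_
  · refine measurable_pi_iff.2 fun r => ?_
    by_cases hr : r = k + 1
    · subst hr; simpa [extend] using h1
    · simp only [Function.update_of_ne hr]
      fun_prop
  · refine measurable_pi_iff.2 fun r => ?_
    by_cases hr : r = k
    · subst hr; simpa [extend] using h2
    · simp only [Function.update_of_ne hr]
      fun_prop

variable {M0 : Measure X} {M : ℕ → Kernel X X} {G : ℕ → X → ℝ} {Np : ℕ → ℕ} {B : ℝ}

/-- The initial particle configuration as a function of the time-zero draws. -/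
def initConf {m : ℕ} (f : Fin m → X) : (ℕ → ℕ → X) × (ℕ → ℕ → ℕ) :=
  (fun p => if p = 0 then padF f else fun _ => Classical.arbitrary X, fun _ _ => 0)

theorem measurable_initConf {m : ℕ} : Measurable (initConf : (Fin m → X) → _) := by
  refine Measurable.prodMk ?_ measurable_const
  refine measurable_pi_iff.2 fun r => ?_
  by_cases hr : r = 0
  · simpa [hr] using measurable_padF
  · simp [hr]

theorem integral_pfLaw_zero {F : (ℕ → ℕ → X) × (ℕ → ℕ → ℕ) → ℝ} (hF : BddMeas F) :
    ∫ ω, F ω ∂(pfLaw M0 M G Np 0) =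
      ∫ f : Fin (Np 0) → X, F (initConf f) ∂(Measure.pi fun _ => M0) :=
  integral_map (μ := Measure.pi fun _ : Fin (Np 0) => M0) (φ := initConf)
    measurable_initConf.aemeasurable hF.meas.aestronglyMeasurable

theorem pfLaw_succ (k : ℕ) : pfLaw M0 M G Np (k + 1) =
    (pfLaw M0 M G Np k).bind fun ω =>
      (Measure.pi fun _ : Fin (Np (k + 1)) => stepLaw M G Np k (ω.1 k)).map (extend k ω) := by
  rw [pfLaw]
  congr 1
  funext ω
  rw [pfStep, Measure.map_map]
  · rfl
  · have h : Measurable fun az : (ℕ → ℕ) × (ℕ → X) => Function.update ω.1 (k + 1) az.2 :=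
      (measurable_update ω.1).comp measurable_snd
    have h' : Measurable fun az : (ℕ → ℕ) × (ℕ → X) => Function.update ω.2 k az.1 :=
      (measurable_update ω.2).comp measurable_fst
    exact h.prodMk h'
  · exact (measurable_padF.comp (by fun_prop)).prodMk (measurable_padF.comp (by fun_prop))

variable [IsProbabilityMeasure M0] [∀ p, IsMarkovKernel (M p)]

theorem measurable_chainStep {k : ℕ} (hG : Potentials G B k) (hN : 0 < Np k) :
    Measurable fun ω : (ℕ → ℕ → X) × (ℕ → ℕ → ℕ) =>
      (Measure.pi fun _ : Fin (Np (k + 1)) => stepLaw M G Np k (ω.1 k)).map (extend k ω) := by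
  have := fun z => isProbabilityMeasure_stepLaw (M := M) hG hN z
  have h : Measurable fun ω : (ℕ → ℕ → X) × (ℕ → ℕ → ℕ) => stepLaw M G Np k (ω.1 k) :=
    (measurable_stepLaw hG).comp (by fun_prop)
  exact measurable_map_of_uncurry (measurable_pi_measure h) (measurable_extend k _)

theorem isProbabilityMeasure_pfLaw {k : ℕ} (hG : Potentials G B k) (hN : ∀ p ≤ k, 0 < Np p) :
    IsProbabilityMeasure (pfLaw M0 M G Np k) := by
  induction k with
  | zero =>
    exact Measure.isProbabilityMeasure_map (μ := Measure.pi fun _ : Fin (Np 0) => M0)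
      (f := initConf) measurable_initConf.aemeasurable
  | succ k ih =>
    have := ih (hG.mono k.le_succ) fun p hp => hN p (hp.trans k.le_succ)
    have := fun z => isProbabilityMeasure_stepLaw (M := M) (hG.mono k.le_succ)
      (hN k k.le_succ) z
    rw [pfLaw_succ]
    have : ∀ ω : (ℕ → ℕ → X) × (ℕ → ℕ → ℕ), IsProbabilityMeasure
        ((Measure.pi fun _ : Fin (Np (k + 1)) => stepLaw M G Np k (ω.1 k)).map (extend k ω)) :=
      fun ω => Measure.isProbabilityMeasure_map
        ((measurable_extend k _).comp measurable_prodMk_left).aemeasurable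
    exact isProbabilityMeasure_bind _ (measurable_chainStep (hG.mono k.le_succ) (hN k k.le_succ))

theorem integral_pfLaw_succ {k : ℕ} (hG : Potentials G B k) (hN : ∀ p ≤ k, 0 < Np p)
    {F : (ℕ → ℕ → X) × (ℕ → ℕ → ℕ) → ℝ} (hF : BddMeas F) :
    ∫ ω, F ω ∂(pfLaw M0 M G Np (k + 1)) =
      ∫ ω, ∫ f : Fin (Np (k + 1)) → ℕ × X, F (extend k ω f)
        ∂(Measure.pi fun _ => stepLaw M G Np k (ω.1 k)) ∂(pfLaw M0 M G Np k) := by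
  have := isProbabilityMeasure_pfLaw (M0 := M0) (M := M) hG hN
  have := fun z => isProbabilityMeasure_stepLaw (M := M) hG (hN k le_rfl) z
  have hm : ∀ ω : (ℕ → ℕ → X) × (ℕ → ℕ → ℕ),
      Measurable fun f : Fin (Np (k + 1)) → ℕ × X => extend k ω f :=
    fun ω => (measurable_extend k _).comp measurable_prodMk_left
  have : ∀ ω : (ℕ → ℕ → X) × (ℕ → ℕ → ℕ), IsProbabilityMeasure
      ((Measure.pi fun _ : Fin (Np (k + 1)) => stepLaw M G Np k (ω.1 k)).map (extend k ω)) :=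
    fun ω => Measure.isProbabilityMeasure_map (hm ω).aemeasurable
  rw [pfLaw_succ, integral_bind_of_bddMeas _ (measurable_chainStep hG (hN k le_rfl)) hF]
  refine integral_congr_ae (Eventually.of_forall fun ω => ?_)
  exact integral_map (hm ω).aemeasurable hF.meas.aestronglyMeasurable

/-- The one-step conditional expectation of a bounded functional is bounded and measurable. -/
theorem bddMeas_integral_extend {k : ℕ} (hG : Potentials G B k) (hN : ∀ p ≤ k, 0 < Np p)
    {F : (ℕ → ℕ → X) × (ℕ → ℕ → ℕ) → ℝ} (hF : BddMeas F) :
    BddMeas fun ω : (ℕ → ℕ → X) × (ℕ → ℕ → ℕ) => ∫ f : Fin (Np (k + 1)) → ℕ × X, F (extend k ω f)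
        ∂(Measure.pi fun _ => stepLaw M G Np k (ω.1 k)) := by
  have := fun z => isProbabilityMeasure_stepLaw (M := M) hG (hN k le_rfl) z
  have hm : ∀ ω : (ℕ → ℕ → X) × (ℕ → ℕ → ℕ),
      Measurable fun f : Fin (Np (k + 1)) → ℕ × X => extend k ω f :=
    fun ω => (measurable_extend k _).comp measurable_prodMk_left
  have : ∀ ω : (ℕ → ℕ → X) × (ℕ → ℕ → ℕ), IsProbabilityMeasure
      ((Measure.pi fun _ : Fin (Np (k + 1)) => stepLaw M G Np k (ω.1 k)).map (extend k ω)) :=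
    fun ω => Measure.isProbabilityMeasure_map (hm ω).aemeasurable
  have h := hF.integral (measurable_chainStep (M := M) hG (hN k le_rfl))
  convert h using 2 with ω
  exact (integral_map (hm ω).aemeasurable hF.meas.aestronglyMeasurable).symm

end Chain

/-! ### Recursions for the limiting quantities -/

section Limits

variable {M0 : Measure X} [IsProbabilityMeasure M0] {M : ℕ → Kernel X X} [∀ p, IsMarkovKernel (M p)]
  {G : ℕ → X → ℝ} {B : ℝ} {b : ℕ → Bool}

instance isProbabilityMeasure_pairInit : IsProbabilityMeasure (pairInit M0 b) := by
  unfold pairInit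
  split_ifs
  · exact Measure.isProbabilityMeasure_map (by fun_prop)
  · infer_instance

instance isProbabilityMeasure_pairKer (p : ℕ) (q : X × X) :
    IsProbabilityMeasure (pairKer M b p q) := by
  unfold pairKer
  split_ifs
  · exact Measure.isProbabilityMeasure_map (by fun_prop)
  · infer_instance

theorem measurable_pairKer (p : ℕ) : Measurable (pairKer M b p) := by
  unfold pairKer
  split_ifs
  · exact (Measure.measurable_map _ (by fun_prop)).comp ((M p).measurable.comp measurable_fst)
  · have h := (((M p).comap Prod.fst measurable_fst) ×ₖ
      ((M p).comap (Prod.snd : X × X → X) measurable_snd)).measurable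
    convert h using 2 with q
    rw [Kernel.prod_apply, Kernel.comap_apply, Kernel.comap_apply]

theorem measurable_pathStep (k : ℕ) : Measurable fun ω : ℕ → X × X =>
    (pairKer M b (k + 1) (ω k)).map fun y => Function.update ω (k + 1) y := by
  refine measurable_map_of_uncurry (κ := fun ω : ℕ → X × X => pairKer M b (k + 1) (ω k))
    ((measurable_pairKer (k + 1)).comp (by fun_prop)) ?_
  refine measurable_pi_iff.2 fun r => ?_
  by_cases hr : r = k + 1
  · subst hr; simpa using measurable_snd
  · simp only [Function.update_of_ne hr]
    fun_prop

instance isProbabilityMeasure_pathStep (k : ℕ) (ω : ℕ → X × X) : IsProbabilityMeasure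
    ((pairKer M b (k + 1) (ω k)).map fun y => Function.update ω (k + 1) y) :=
  Measure.isProbabilityMeasure_map (measurable_update ω).aemeasurable

instance isProbabilityMeasure_markovPath (k : ℕ) :
    IsProbabilityMeasure (markovPath (pairInit M0 b) (pairKer M b) k) := by
  induction k with
  | zero => exact Measure.isProbabilityMeasure_map (by fun_prop)
  | succ k ih => exact isProbabilityMeasure_bind _ (measurable_pathStep k)

/-- The two-particle Feynman–Kac transition. -/
def pairQ (M : ℕ → Kernel X X) (G : ℕ → X → ℝ) (b : ℕ → Bool) (k : ℕ) (F : X × X → ℝ) :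
    X × X → ℝ := fun q => G k q.1 * G k q.2 * ∫ y, F y ∂(pairKer M b (k + 1) q)

theorem BddMeas.pairQ {k : ℕ} (hG : Potentials G B k) {F : X × X → ℝ} (hF : BddMeas F) :
    BddMeas (pairQ M G b k F) :=
  (((hG.bddMeas le_rfl).comp measurable_fst).mul ((hG.bddMeas le_rfl).comp measurable_snd)).mul
    (hF.integral (measurable_pairKer (k + 1)))

omit [IsProbabilityMeasure M0] [∀ p, IsMarkovKernel (M p)] in
theorem muB_zero {F : X × X → ℝ} (hF : BddMeas F) :
    muB M0 M G 0 b F = ∫ q, F q ∂(pairInit M0 b) := by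
  rw [muB, markovPath, integral_map (by fun_prop)]
  · simp
  · simpa [Function.comp_def] using (hF.meas.comp (measurable_pi_apply 0)).aestronglyMeasurable

theorem muB_succ {k : ℕ} (hG : Potentials G B k) {F : X × X → ℝ} (hF : BddMeas F) :
    muB M0 M G (k + 1) b F = muB M0 M G k b (pairQ M G b k F) := by
  have hg : ∀ m ≤ k + 1, BddMeas fun ω : ℕ → X × X =>
      ∏ p ∈ Finset.range m, G p (ω p).1 * G p (ω p).2 := by
    intro m hm
    refine BddMeas.prod fun p hp => ?_
    have hp := hG.bddMeas (p := p) (by have := Finset.mem_range.1 hp; omega)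
    exact (hp.comp (by fun_prop)).mul (hp.comp (by fun_prop))
  have hm : BddMeas fun ω : ℕ → X × X =>
      F (ω (k + 1)) * ∏ p ∈ Finset.range (k + 1), G p (ω p).1 * G p (ω p).2 :=
    (hF.comp (by fun_prop)).mul (hg _ le_rfl)
  rw [muB, markovPath, integral_bind_of_bddMeas _ (measurable_pathStep k) hm, muB]
  refine integral_congr_ae (Eventually.of_forall fun ω => ?_)
  dsimp only
  rw [integral_map (measurable_update ω).aemeasurable hm.meas.aestronglyMeasurable]
  have h : ∀ y, F (Function.update ω (k + 1) y (k + 1)) * ∏ p ∈ Finset.range (k + 1),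
      G p (Function.update ω (k + 1) y p).1 * G p (Function.update ω (k + 1) y p).2 =
      F y * ∏ p ∈ Finset.range (k + 1), G p (ω p).1 * G p (ω p).2 := by
    intro y
    rw [Function.update_self]
    congr 1
    refine Finset.prod_congr rfl fun p hp => ?_
    rw [Function.update_of_ne (Finset.mem_range.1 hp).ne]
  simp only [h]
  rw [integral_mul_const, Finset.prod_range_succ, pairQ]
  ring

theorem isFiniteMeasure_gammaFK {k : ℕ} (hG : Potentials G B k) :
    IsFiniteMeasure (gammaFK M0 M G k) := by
  induction k with
  | zero => exact inferInstanceAs (IsFiniteMeasure M0)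
  | succ k ih =>
    have := ih (hG.mono k.le_succ)
    have h : IsFiniteMeasure
        ((gammaFK M0 M G k).withDensity fun x => ENNReal.ofReal (G k x)) :=
      isFiniteMeasure_withDensity_ofReal
        ((hG.bddMeas k.le_succ).integrable _).hasFiniteIntegral
    rw [gammaFK]
    exact inferInstanceAs (IsFiniteMeasure (Measure.bind _ (M (k + 1))))

theorem gInt_succ {k : ℕ} (hG : Potentials G B k) {f : X → ℝ} (hf : BddMeas f) :
    gInt M0 M G (k + 1) f = gInt M0 M G k fun x => G k x * ∫ y, f y ∂(M (k + 1) x) := by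
  have := isFiniteMeasure_gammaFK (M0 := M0) (M := M) hG
  have h : IsFiniteMeasure
      ((gammaFK M0 M G k).withDensity fun x => ENNReal.ofReal (G k x)) :=
    isFiniteMeasure_withDensity_ofReal ((hG.bddMeas le_rfl).integrable _).hasFiniteIntegral
  rw [gInt, gammaFK, integral_bind_of_bddMeas _ (M (k + 1)).measurable hf, gInt,
    integral_withDensity_eq_integral_toReal_smul (hG.meas k le_rfl).ennreal_ofReal
      (Eventually.of_forall fun _ => ENNReal.ofReal_lt_top)]
  refine integral_congr_ae (Eventually.of_forall fun x => ?_)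
  simp [ENNReal.toReal_ofReal (hG.pos k le_rfl x).le]

theorem BddMeas.transition {k : ℕ} (hG : Potentials G B k) {f : X → ℝ} (hf : BddMeas f) :
    BddMeas fun x => G k x * ∫ y, f y ∂(M (k + 1) x) :=
  (hG.bddMeas le_rfl).mul (hf.integral (M (k + 1)).measurable)

theorem gInt_pos {k : ℕ} (hG : Potentials G B k) {f : X → ℝ} (hf : BddMeas f)
    (hpos : ∀ x, 0 < f x) : 0 < gInt M0 M G k f := by
  induction k generalizing f with
  | zero =>
    rw [gInt, gammaFK]
    rw [integral_pos_iff_support_of_nonneg (fun x => (hpos x).le) (hf.integrable _)]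
    have : Function.support f = Set.univ := Set.eq_univ_of_forall fun x => (hpos x).ne'
    simp [this]
  | succ k ih =>
    rw [gInt_succ (hG.mono k.le_succ) hf]
    refine ih (hG.mono k.le_succ) (hf.transition (hG.mono k.le_succ)) fun x => ?_
    refine mul_pos (hG.pos k k.le_succ x) ?_
    rw [integral_pos_iff_support_of_nonneg (fun x => (hpos x).le) (hf.integrable _)]
    have : Function.support f = Set.univ := Set.eq_univ_of_forall fun x => (hpos x).ne'
    simp [this]

end Limits

/-! ### Lineage weights -/

/-- Particle histories: positions and ancestor indices. -/
abbrev Hist (X : Type*) := (ℕ → ℕ → X) × (ℕ → ℕ → ℕ)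

/-- Propagate a pair weight through the selection step from time `p` to `p + 1`. -/
def stepWt (G : ℕ → X → ℝ) (Np : ℕ → ℕ) (b : ℕ → Bool) (p : ℕ) (z : ℕ → X) (u : ℕ → ℕ → ℝ)
    (a a' : ℕ) : ℝ :=
  if b (p + 1) then ∑ w ∈ Finset.range (Np p), resW G Np p z w * u a w else u a a'

/-- Conditional probability, given the particle system, that the two lineages ending in the
particles `i` and `j` of generation `p` follow the coalescence pattern `b`. -/
def lineWt (G : ℕ → X → ℝ) (Np : ℕ → ℕ) (b : ℕ → Bool) : ℕ → Hist X → ℕ → ℕ → ℝ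
  | 0 => fun _ i j => if i < Np 0 ∧ j < Np 0 ∧ (i = j ↔ b 0 = true) then 1 else 0
  | p + 1 => fun ω i j =>
      if i < Np (p + 1) ∧ j < Np (p + 1) ∧ (i = j ↔ b (p + 1) = true) then
        stepWt G Np b p (ω.1 p) (lineWt G Np b p ω) (ω.2 p i) (ω.2 p j)
      else 0

section Tracing

variable {G : ℕ → X → ℝ} {Np : ℕ → ℕ} {B : ℝ} {b : ℕ → Bool}

omit [MeasurableSpace X] in
theorem lineWt_zero (ω : Hist X) (i j : ℕ) : lineWt G Np b 0 ω i j =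
    if i < Np 0 ∧ j < Np 0 ∧ (i = j ↔ b 0 = true) then 1 else 0 := rfl

omit [MeasurableSpace X] in
theorem lineWt_succ (p : ℕ) (ω : Hist X) (i j : ℕ) : lineWt G Np b (p + 1) ω i j =
    if i < Np (p + 1) ∧ j < Np (p + 1) ∧ (i = j ↔ b (p + 1) = true) then
      stepWt G Np b p (ω.1 p) (lineWt G Np b p ω) (ω.2 p i) (ω.2 p j)
    else 0 := rfl

theorem resW_nonneg {p : ℕ} (hG : Potentials G B p) (z : ℕ → X) (a : ℕ) :
    0 ≤ resW G Np p z a :=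
  div_nonneg (hG.pos p le_rfl _).le (Finset.sum_nonneg fun _ _ => (hG.pos p le_rfl _).le)

theorem sum_G_pos {p : ℕ} (hG : Potentials G B p) (hN : 0 < Np p) (z : ℕ → X) :
    0 < ∑ j ∈ Finset.range (Np p), G p (z j) :=
  Finset.sum_pos (fun _ _ => hG.pos p le_rfl _) (by simpa using hN.ne')

theorem sum_resW {p : ℕ} (hG : Potentials G B p) (hN : 0 < Np p) (z : ℕ → X) :
    ∑ a ∈ Finset.range (Np p), resW G Np p z a = 1 := by
  simp only [resW]
  rw [← Finset.sum_div, div_self (sum_G_pos hG hN z).ne']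

theorem lineWt_bounds {p : ℕ} (hG : Potentials G B p) (hN : ∀ q ≤ p, 0 < Np q) (ω : Hist X)
    (i j : ℕ) : 0 ≤ lineWt G Np b p ω i j ∧ lineWt G Np b p ω i j ≤ 1 := by
  induction p generalizing i j with
  | zero => rw [lineWt_zero]; split_ifs <;> norm_num
  | succ p ih =>
    have hG' := hG.mono p.le_succ
    have ih := ih hG' fun q hq => hN q (hq.trans p.le_succ)
    rw [lineWt_succ]
    split_ifs
    · rw [stepWt]
      split_ifs
      · constructor
        · exact Finset.sum_nonneg fun w _ => mul_nonneg (resW_nonneg hG' _ _) (ih _ _).1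
        · rw [← sum_resW hG' (hN p p.le_succ) (ω.1 p)]
          exact Finset.sum_le_sum fun w _ =>
            mul_le_of_le_one_right (resW_nonneg hG' _ _) (ih _ _).2
      · exact ih _ _
    · norm_num

omit [MeasurableSpace X] in
theorem lineWt_eq_zero {p : ℕ} {ω : Hist X} {i j : ℕ}
    (h : ¬ (i < Np p ∧ j < Np p ∧ (i = j ↔ b p = true))) : lineWt G Np b p ω i j = 0 := by
  cases p
  · rw [lineWt_zero, if_neg h]
  · rw [lineWt_succ, if_neg h]

omit [MeasurableSpace X] in
theorem lineWt_comm {p : ℕ} {ω : Hist X} (i j : ℕ) :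
    lineWt G Np b p ω i j = lineWt G Np b p ω j i := by
  induction p generalizing i j with
  | zero => simp only [lineWt_zero]; congr 1; grind
  | succ p ih =>
    simp only [lineWt_succ]
    have hc : (i < Np (p + 1) ∧ j < Np (p + 1) ∧ (i = j ↔ b (p + 1) = true)) ↔
      (j < Np (p + 1) ∧ i < Np (p + 1) ∧ (j = i ↔ b (p + 1) = true)) := by grind
    by_cases h : i < Np (p + 1) ∧ j < Np (p + 1) ∧ (i = j ↔ b (p + 1) = true)
    · rw [if_pos h, if_pos (hc.1 h), stepWt, stepWt]
      split_ifs with hb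
      · rw [h.2.2.2 hb]
      · exact ih _ _
    · rw [if_neg h, if_neg (mt hc.2 h)]

theorem isProbabilityMeasure_k2Law {p : ℕ} (hG : Potentials G B p) (hN : ∀ q ≤ p, 0 < Np q)
    (ω : Hist X) (K : ℕ → ℕ) (v : ℕ) : IsProbabilityMeasure (k2Law G Np ω K p v) := by
  induction p generalizing v with
  | zero => rw [k2Law]; infer_instance
  | succ p ih =>
    have := ih (hG.mono p.le_succ) fun q hq => hN q (hq.trans p.le_succ)
    have h (w : ℕ) : IsProbabilityMeasure
        ((k2Law G Np ω K p w).map fun f => Function.update f (p + 1) v) :=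
      Measure.isProbabilityMeasure_map (by fun_prop)
    have : IsProbabilityMeasure (if v = K (p + 1) then cat (Np p) fun j => G p (ω.1 p j)
        else Measure.dirac (ω.2 p v)) := by
      split_ifs
      · exact isProbabilityMeasure_cat (hN p p.le_succ) fun j _ => hG.pos p p.le_succ _
      · infer_instance
    exact isProbabilityMeasure_bind _ (measurable_of_countable _)

theorem measurableSet_inI (p : ℕ) : MeasurableSet {k | inI Np p b k} := by
  have h : {k | inI Np p b k} = ⋂ q : ℕ, ⋂ _ : q ≤ p, (fun k : (ℕ → ℕ) × (ℕ → ℕ) =>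
      (k.1 q, k.2 q)) ⁻¹' {r | r.1 < Np q ∧ r.2 < Np q ∧ (r.1 = r.2 ↔ b q = true)} := by
    ext k; simp [inI]
  rw [h]
  refine MeasurableSet.iInter fun q => MeasurableSet.iInter fun _ => ?_
  exact (by fun_prop : Measurable fun k : (ℕ → ℕ) × (ℕ → ℕ) => (k.1 q, k.2 q))
    (Set.to_countable _).measurableSet

theorem bddMeas_inI_mul (p : ℕ) {g : ℕ → ℕ → ℝ} {C : ℝ} (hg : ∀ i j, |g i j| ≤ C) :
    BddMeas fun k => (if inI Np p b k then (1 : ℝ) else 0) * g (k.1 p) (k.2 p) := by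
  have h1 : BddMeas fun k => if inI Np p b k then (1 : ℝ) else 0 :=
    ⟨Measurable.ite (measurableSet_inI p) measurable_const measurable_const, 1,
      fun k => by split_ifs <;> norm_num⟩
  have h2 : BddMeas fun r : ℕ × ℕ => g r.1 r.2 :=
    ⟨measurable_of_countable _, C, fun r => hg _ _⟩
  exact h1.mul (h2.comp (u := fun k : (ℕ → ℕ) × (ℕ → ℕ) => (k.1 p, k.2 p)) (by fun_prop))

theorem integral_k2Law {n p : ℕ} (hp : p ≤ n) (hG : Potentials G B n) (hN : ∀ q ≤ n, 0 < Np q)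
    (ω : Hist X) (K : ℕ → ℕ) (hK : ∀ q < n, K q = ω.2 q (K (q + 1))) (v : ℕ) {g : ℕ → ℕ → ℝ}
    {C : ℝ} (hg : ∀ i j, |g i j| ≤ C) :
    ∫ f, (if inI Np p b (K, f) then (1 : ℝ) else 0) * g (K p) (f p) ∂(k2Law G Np ω K p v) =
      lineWt G Np b p ω (K p) v * g (K p) v := by
  induction p generalizing v g C with
  | zero =>
    have h := (bddMeas_inI_mul (Np := Np) (b := b) 0 hg).comp
      (u := fun f => (K, f)) (by fun_prop)
    rw [k2Law, integral_dirac' _ _ h.meas.stronglyMeasurable]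
    simp [lineWt, inI]
  | succ p ih =>
    have hN' : ∀ q ≤ p, 0 < Np q := fun q hq => hN q (by omega)
    have := isProbabilityMeasure_k2Law (hG.mono (by omega : p ≤ n)) hN' ω K
    have hpr (w : ℕ) : IsProbabilityMeasure
        ((k2Law G Np ω K p w).map fun f => Function.update f (p + 1) v) :=
      Measure.isProbabilityMeasure_map (by fun_prop)
    have h := (bddMeas_inI_mul (Np := Np) (b := b) (p + 1) hg).comp
      (u := fun f => (K, f)) (by fun_prop)
    have hin : ∀ w, ∫ f, (if inI Np (p + 1) b (K, f) then (1 : ℝ) else 0) * g (K (p + 1)) (f (p + 1))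
        ∂((k2Law G Np ω K p w).map fun f => Function.update f (p + 1) v) =
        (if K (p + 1) < Np (p + 1) ∧ v < Np (p + 1) ∧ (K (p + 1) = v ↔ b (p + 1) = true) then 1
          else 0) * lineWt G Np b p ω (K p) w * g (K (p + 1)) v := by
      intro w
      rw [integral_map (by fun_prop) h.meas.aestronglyMeasurable]
      have ih := ih (by omega) w (g := fun _ _ => 1) (C := 1) (by simp)
      simp only [mul_one] at ih
      rw [← ih, ← integral_const_mul, ← integral_mul_const]
      refine integral_congr_ae (Eventually.of_forall fun f => ?_)
      have he : inI Np (p + 1) b (K, Function.update f (p + 1) v) ↔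
          (K (p + 1) < Np (p + 1) ∧ v < Np (p + 1) ∧ (K (p + 1) = v ↔ b (p + 1) = true)) ∧
            inI Np p b (K, f) := by
        constructor
        · intro h
          refine ⟨by simpa using h (p + 1) le_rfl, fun q hq => ?_⟩
          have hne : q ≠ p + 1 := by omega
          simpa [Function.update_of_ne hne] using h q (by omega)
        · rintro ⟨h1, h2⟩ q hq
          rcases Nat.lt_or_eq_of_le hq with hq | rfl
          · simpa [Function.update_of_ne hq.ne] using h2 q (by omega)
          · simpa using h1
      simp only [he, Function.update_self]
      split_ifs <;> simp_all
    have : IsProbabilityMeasure (if v = K (p + 1) then cat (Np p) fun j => G p (ω.1 p j)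
        else Measure.dirac (ω.2 p v)) := by
      split_ifs
      · exact isProbabilityMeasure_cat (hN p (by omega)) fun j _ => hG.pos p (by omega) _
      · infer_instance
    rw [k2Law, integral_bind_of_bddMeas _ (measurable_of_countable _) h]
    simp only [hin]
    rw [integral_mul_const, integral_const_mul, lineWt_succ]
    split_ifs with hc hv hv
    · rw [integral_cat fun j _ => hG.pos p (by omega) _, stepWt, if_pos (hc.2.2.1 hv.symm),
        hK p (by omega)]
      simp [resW]
    · rw [integral_dirac, stepWt, if_neg fun hb => hv (hc.2.2.2 hb).symm, hK p (by omega), one_mul]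
    · simp
    · simp

theorem trace_self (A : ℕ → ℕ → ℕ) (n i : ℕ) : trace A n i n = i := by
  simp [trace, traceAux]

theorem trace_of_lt (A : ℕ → ℕ → ℕ) {n p : ℕ} (i : ℕ) (hp : p < n) :
    trace A n i p = A p (trace A n i (p + 1)) := by
  have h : n - p = n - (p + 1) + 1 := by omega
  rw [trace, trace, h, traceAux]
  congr 2
  omega

theorem integral_unif {m : ℕ} (f : ℕ → ℝ) :
    ∫ j, f j ∂(unif m) = (m : ℝ)⁻¹ * ∑ j ∈ Finset.range m, f j := by
  rw [unif, integral_cat fun _ _ => one_pos, Finset.mul_sum]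
  simp

theorem integral_kLaw {n : ℕ} (hG : Potentials G B n) (hN : ∀ q ≤ n, 0 < Np q) (ω : Hist X)
    {g : ℕ → ℕ → ℝ} {C : ℝ} (hg : ∀ i j, |g i j| ≤ C) :
    ∫ k, (if inI Np n b k then (1 : ℝ) else 0) * g (k.1 n) (k.2 n) ∂(kLaw G Np n ω) =
      (Np n : ℝ)⁻¹ ^ 2 * ∑ i ∈ Finset.range (Np n), ∑ j ∈ Finset.range (Np n),
        lineWt G Np b n ω i j * g i j := by
  have : IsProbabilityMeasure (unif (Np n)) := isProbabilityMeasure_cat (hN n le_rfl) (by simp)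
  have := isProbabilityMeasure_k2Law hG hN ω
  have hpr (k v : ℕ) : IsProbabilityMeasure
      ((k2Law G Np ω (trace ω.2 n k) n v).map fun f => (trace ω.2 n k, f)) :=
    Measure.isProbabilityMeasure_map (by fun_prop)
  have hpr' (k : ℕ) : IsProbabilityMeasure ((unif (Np n)).bind fun v =>
      (k2Law G Np ω (trace ω.2 n k) n v).map fun f => (trace ω.2 n k, f)) :=
    isProbabilityMeasure_bind _ (measurable_of_countable _)
  have h := bddMeas_inI_mul (Np := Np) (b := b) n hg
  rw [kLaw, integral_bind_of_bddMeas _ (measurable_of_countable _) h, integral_unif, pow_two,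
    mul_assoc]
  congr 1
  rw [Finset.mul_sum]
  refine Finset.sum_congr rfl fun i _ => ?_
  rw [integral_bind_of_bddMeas _ (measurable_of_countable _) h, integral_unif]
  congr 1
  refine Finset.sum_congr rfl fun j _ => ?_
  rw [integral_map (by fun_prop) h.meas.aestronglyMeasurable]
  have := integral_k2Law (b := b) le_rfl hG hN ω (trace ω.2 n i) (fun q hq => trace_of_lt _ _ hq) j hg
  rw [trace_self] at this
  simp only [trace_self]
  exact this

/-- The normalising constant of the pattern `b`. -/
def patConst (Np : ℕ → ℕ) (b : ℕ → Bool) (p : ℕ) : ℝ :=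
  ∏ q ∈ Finset.range (p + 1), if b q then (Np q : ℝ) else (Np q : ℝ) / ((Np q : ℝ) - 1)

/-- The product of the empirical means of the potentials. -/
def prodG (G : ℕ → X → ℝ) (Np : ℕ → ℕ) (p : ℕ) (ω : Hist X) : ℝ :=
  ∏ q ∈ Finset.range p, etaN Np q (G q) ω

/-- Explicit form of `μ_b^N(F)`. -/
def muE (G : ℕ → X → ℝ) (Np : ℕ → ℕ) (b : ℕ → Bool) (p : ℕ) (F : X × X → ℝ) (ω : Hist X) : ℝ :=
  patConst Np b p * prodG G Np p ω ^ 2 * (Np p : ℝ)⁻¹ ^ 2 *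
    ∑ i ∈ Finset.range (Np p), ∑ j ∈ Finset.range (Np p),
      lineWt G Np b p ω i j * F (ω.1 p i, ω.1 p j)

omit [MeasurableSpace X] in
theorem gammaN_one {n : ℕ} (hN : 0 < Np n) (ω : Hist X) : gammaN G Np n 1 ω = prodG G Np n ω := by
  rw [gammaN, prodG, etaN]
  have : (Np n : ℝ) ≠ 0 := by exact_mod_cast hN.ne'
  simp [this]

theorem muBN_eq_muE {n : ℕ} (hG : Potentials G B n) (hN : ∀ q ≤ n, 0 < Np q) {F : X × X → ℝ}
    (hF : BddMeas F) (ω : Hist X) : muBN G Np n b F ω = muE G Np b n F ω := by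
  obtain ⟨C, hC⟩ := hF.bdd
  rw [muBN, integral_kLaw hG hN ω (g := fun i j => F (ω.1 n i, ω.1 n j)) fun i j => hC _,
    gammaN_one (hN n le_rfl), muE, patConst, mul_assoc _ (_ ^ 2) (Finset.sum _ _)]

end Tracing

/-! ### One step of the pair estimators -/

section OneStep

variable [Nonempty X] {M : ℕ → Kernel X X} [∀ p, IsMarkovKernel (M p)] {G : ℕ → X → ℝ} {Np : ℕ → ℕ} {B : ℝ} {b : ℕ → Bool}

omit [MeasurableSpace X] in
theorem extend_fst_of_le {k m q : ℕ} (ω : Hist X) (f : Fin m → ℕ × X) (hq : q ≤ k) :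
    (extend k ω f).1 q = ω.1 q := Function.update_of_ne (by omega) _ _

omit [MeasurableSpace X] in
theorem extend_snd_of_lt {k m q : ℕ} (ω : Hist X) (f : Fin m → ℕ × X) (hq : q < k) :
    (extend k ω f).2 q = ω.2 q := Function.update_of_ne (by omega) _ _

omit [MeasurableSpace X] in
theorem extend_fst_self {k m : ℕ} (ω : Hist X) (f : Fin m → ℕ × X) (i : Fin m) :
    (extend k ω f).1 (k + 1) i = (f i).2 := by simp [extend, padF]

omit [MeasurableSpace X] in
theorem extend_snd_self {k m : ℕ} (ω : Hist X) (f : Fin m → ℕ × X) (i : Fin m) :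
    (extend k ω f).2 k i = (f i).1 := by simp [extend, padF]

omit [MeasurableSpace X] in
theorem lineWt_extend {k m p : ℕ} (ω : Hist X) (f : Fin m → ℕ × X) (hp : p ≤ k) :
    lineWt G Np b p (extend k ω f) = lineWt G Np b p ω := by
  induction p with
  | zero => rfl
  | succ p ih =>
    funext i j
    rw [lineWt_succ, lineWt_succ, ih (by omega), extend_fst_of_le ω f (by omega),
      extend_snd_of_lt ω f (by omega)]

omit [MeasurableSpace X] in
theorem prodG_extend {k m p : ℕ} (ω : Hist X) (f : Fin m → ℕ × X) (hp : p ≤ k + 1) :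
    prodG G Np p (extend k ω f) = prodG G Np p ω := by
  refine Finset.prod_congr rfl fun q hq => ?_
  have := Finset.mem_range.1 hq
  rw [etaN, etaN, extend_fst_of_le ω f (by omega)]

omit [Nonempty X] in
theorem measurable_lineWt {p : ℕ} (hG : Potentials G B p) (i j : ℕ) :
    Measurable fun ω : Hist X => lineWt G Np b p ω i j := by
  induction p generalizing i j with
  | zero => exact measurable_const
  | succ p ih =>
    have hG' := hG.mono p.le_succ
    have ih := ih hG'
    simp only [lineWt_succ]
    split_ifs
    swap
    · exact measurable_const
    have hp : Measurable fun q : Hist X × (ℕ × ℕ) => lineWt G Np b p q.1 q.2.1 q.2.2 :=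
      measurable_from_prod_countable_left fun r => ih r.1 r.2
    have hGp := hG'.meas p le_rfl
    have hr (w : ℕ) : Measurable fun ω : Hist X => resW G Np p (ω.1 p) w := by
      unfold resW; fun_prop
    unfold stepWt
    split_ifs
    · refine Finset.measurable_sum _ fun w _ => (hr w).mul ?_
      exact hp.comp (g := fun q : Hist X × (ℕ × ℕ) => lineWt G Np b p q.1 q.2.1 q.2.2)
        (f := fun ω : Hist X => (ω, (ω.2 p i, w))) (by fun_prop)
    · exact hp.comp (g := fun q : Hist X × (ℕ × ℕ) => lineWt G Np b p q.1 q.2.1 q.2.2)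
        (f := fun ω : Hist X => (ω, (ω.2 p i, ω.2 p j))) (by fun_prop)

omit [Nonempty X] in
theorem bddMeas_lineWt {p : ℕ} (hG : Potentials G B p) (hN : ∀ q ≤ p, 0 < Np q) (i j : ℕ) :
    BddMeas fun ω : Hist X => lineWt G Np b p ω i j :=
  ⟨measurable_lineWt hG i j, 1, fun ω => by
    rw [abs_of_nonneg (lineWt_bounds hG hN ω i j).1]; exact (lineWt_bounds hG hN ω i j).2⟩

omit [Nonempty X] in
theorem bddMeas_etaN {p : ℕ} {f : X → ℝ} (hf : BddMeas f) : BddMeas (etaN Np p f) :=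
  (BddMeas.const _).mul (BddMeas.sum fun i _ => hf.comp (by fun_prop))

omit [Nonempty X] in
theorem bddMeas_prodG {p : ℕ} (hG : Potentials G B p) : BddMeas (prodG G Np p) :=
  BddMeas.prod fun _ hq => bddMeas_etaN (hG.bddMeas (Finset.mem_range.1 hq).le)

omit [Nonempty X] in
theorem bddMeas_muE {p : ℕ} (hG : Potentials G B p) (hN : ∀ q ≤ p, 0 < Np q) {F : X × X → ℝ}
    (hF : BddMeas F) : BddMeas (muE G Np b p F) :=
  (((BddMeas.const _).mul ((bddMeas_prodG hG).pow 2)).mul (.const _)).mul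
    (BddMeas.sum fun i _ => BddMeas.sum fun j _ => (bddMeas_lineWt hG hN i j).mul
      (hF.comp (u := fun ω : Hist X => (ω.1 p i, ω.1 p j)) (by fun_prop)))

/-- Contribution of a pair of offspring to the pair estimators. -/
def stepFun (G : ℕ → X → ℝ) (Np : ℕ → ℕ) (b : ℕ → Bool) (k : ℕ) (ω : Hist X) (F : X × X → ℝ)
    (q : (ℕ × X) × (ℕ × X)) : ℝ :=
  stepWt G Np b k (ω.1 k) (lineWt G Np b k ω) q.1.1 q.2.1 * F (q.1.2, q.2.2)

omit [MeasurableSpace X] in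
theorem sum_lineWt_extend {k : ℕ} (ω : Hist X) (f : Fin (Np (k + 1)) → ℕ × X) (F : X × X → ℝ)
    (i : Fin (Np (k + 1))) :
    ∑ j ∈ Finset.range (Np (k + 1)), lineWt G Np b (k + 1) (extend k ω f) i j *
        F ((extend k ω f).1 (k + 1) i, (extend k ω f).1 (k + 1) j) =
      ∑ j, if (i = j ↔ b (k + 1) = true) then stepFun G Np b k ω F (f i, f j) else 0 := by
  rw [Finset.sum_range]
  refine Finset.sum_congr rfl fun j _ => ?_
  rw [lineWt_succ, extend_fst_of_le ω f le_rfl, extend_snd_self, extend_snd_self, extend_fst_self,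
    extend_fst_self, lineWt_extend ω f le_rfl, ite_mul, zero_mul]
  simp only [Fin.is_lt, true_and, Fin.ext_iff, stepFun]

omit [Nonempty X] in
theorem stepWt_bounds {k : ℕ} (hG : Potentials G B k) (hN : ∀ q ≤ k, 0 < Np q) (ω : Hist X)
    (a a' : ℕ) : 0 ≤ stepWt G Np b k (ω.1 k) (lineWt G Np b k ω) a a' ∧
      stepWt G Np b k (ω.1 k) (lineWt G Np b k ω) a a' ≤ 1 := by
  have ih := lineWt_bounds (b := b) hG hN ω
  rw [stepWt]
  split_ifs
  · constructor
    · exact Finset.sum_nonneg fun w _ => mul_nonneg (resW_nonneg hG _ _) (ih _ _).1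
    · rw [← sum_resW hG (hN k le_rfl) (ω.1 k)]
      exact Finset.sum_le_sum fun w _ => mul_le_of_le_one_right (resW_nonneg hG _ _) (ih _ _).2
  · exact ih _ _

omit [Nonempty X] in
theorem bddMeas_stepFun {k : ℕ} (hG : Potentials G B k) (hN : ∀ q ≤ k, 0 < Np q) (ω : Hist X)
    {F : X × X → ℝ} (hF : BddMeas F) : BddMeas (stepFun G Np b k ω F) := by
  have h : BddMeas fun r : ℕ × ℕ => stepWt G Np b k (ω.1 k) (lineWt G Np b k ω) r.1 r.2 :=
    ⟨measurable_of_countable _, 1, fun r => by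
      rw [abs_of_nonneg (stepWt_bounds hG hN ω _ _).1]; exact (stepWt_bounds hG hN ω _ _).2⟩
  exact (h.comp (u := fun q : (ℕ × X) × (ℕ × X) => (q.1.1, q.2.1)) (by fun_prop)).mul
    (hF.comp (u := fun q : (ℕ × X) × (ℕ × X) => (q.1.2, q.2.2)) (by fun_prop))

/-- Conditional mean of the contribution of an admissible pair of offspring. -/
def stepMean (M : ℕ → Kernel X X) (G : ℕ → X → ℝ) (Np : ℕ → ℕ) (b : ℕ → Bool) (k : ℕ)
    (ω : Hist X) (F : X × X → ℝ) : ℝ :=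
  ∑ a ∈ Finset.range (Np k), ∑ a' ∈ Finset.range (Np k),
    resW G Np k (ω.1 k) a * resW G Np k (ω.1 k) a' * lineWt G Np b k ω a a' *
      ∫ q, F q ∂(pairKer M b (k + 1) (ω.1 k a, ω.1 k a'))

omit [Nonempty X] in
theorem integral_stepFun {k : ℕ} (hG : Potentials G B k) (hN : ∀ q ≤ k, 0 < Np q) (ω : Hist X)
    {F : X × X → ℝ} (hF : BddMeas F) {ι : Type*} [Fintype ι] {i j : ι}
    (hij : i = j ↔ b (k + 1) = true) :
    ∫ f, stepFun G Np b k ω F (f i, f j) ∂(Measure.pi fun _ : ι => stepLaw M G Np k (ω.1 k)) =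
      stepMean M G Np b k ω F := by
  have := isProbabilityMeasure_stepLaw (M := M) hG (hN k le_rfl) (ω.1 k)
  have hs := bddMeas_stepFun (b := b) hG hN ω hF
  by_cases hb : b (k + 1) = true
  · obtain rfl := hij.2 hb
    have hs' := hs.comp (u := fun y : ℕ × X => (y, y)) (by fun_prop)
    rw [integral_pi_eval (h := fun y => stepFun G Np b k ω F (y, y)) _ _ hs'.meas,
      integral_stepLaw hG (hN k le_rfl) _ hs', stepMean]
    refine Finset.sum_congr rfl fun a _ => ?_
    have h : ∀ a', ∫ q, F q ∂(pairKer M b (k + 1) (ω.1 k a, ω.1 k a')) =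
        ∫ x, F (x, x) ∂(M (k + 1) (ω.1 k a)) := by
      intro a'
      rw [pairKer, if_pos hb, integral_map (by fun_prop) hF.meas.aestronglyMeasurable]
    simp only [h, stepFun, stepWt, if_pos hb]
    rw [integral_const_mul, ← Finset.sum_mul, ← mul_assoc, Finset.mul_sum]
    simp only [mul_assoc]
  · have hne : i ≠ j := fun h => hb (hij.1 h)
    have hin : BddMeas fun y => ∫ y', stepFun G Np b k ω F (y, y') ∂(stepLaw M G Np k (ω.1 k)) := by
      obtain ⟨C, hC⟩ := hs.bdd
      exact ⟨(hs.meas.stronglyMeasurable.integral_prod_right' (f := stepFun G Np b k ω F)).measurable, C,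
        fun y => abs_integral_le_of_abs_le fun y' => hC _⟩
    rw [integral_pi_pair _ hne hs, integral_stepLaw hG (hN k le_rfl) _ hin, stepMean]
    refine Finset.sum_congr rfl fun a _ => ?_
    have h1 : ∀ x, ∫ y', stepFun G Np b k ω F ((a, x), y') ∂(stepLaw M G Np k (ω.1 k)) =
        ∑ a' ∈ Finset.range (Np k), resW G Np k (ω.1 k) a' * (lineWt G Np b k ω a a' *
          ∫ x', F (x, x') ∂(M (k + 1) (ω.1 k a'))) := by
      intro x
      rw [integral_stepLaw (h := fun y' => stepFun G Np b k ω F ((a, x), y')) hG (hN k le_rfl) _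
        (hs.comp (by fun_prop))]
      simp only [stepFun, stepWt, if_neg hb, integral_const_mul]
    simp only [h1]
    have hFi : ∀ a', BddMeas fun x => ∫ x', F (x, x') ∂(M (k + 1) (ω.1 k a')) := by
      intro a'
      obtain ⟨C, hC⟩ := hF.bdd
      exact ⟨(hF.meas.stronglyMeasurable.integral_prod_right' (f := F)).measurable, C,
        fun y => abs_integral_le_of_abs_le fun y' => hC _⟩
    rw [integral_finsetSum _ fun a' _ =>
      ((BddMeas.const _).mul ((BddMeas.const _).mul (hFi a'))).integrable _, Finset.mul_sum]
    refine Finset.sum_congr rfl fun a' _ => ?_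
    rw [integral_const_mul, integral_const_mul, pairKer, if_neg hb,
      integral_prod _ (hF.integrable _)]
    ring

theorem sum_ite_iff_const {m : ℕ} (β : Prop) [Decidable β]
    [∀ i j : Fin m, Decidable (i = j ↔ β)] (e : ℝ) :
    (∑ i : Fin m, ∑ j : Fin m, if (i = j ↔ β) then e else 0) =
      (if β then (m : ℝ) else m * (m - 1)) * e := by
  by_cases hβ : β
  · simp [hβ]
  · have h : ∀ i : Fin m, (∑ j : Fin m, if (i = j ↔ β) then e else 0) = m * e - e := by
      intro i
      have : ∀ j : Fin m, (if (i = j ↔ β) then e else 0) = e - if i = j then e else 0 := by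
        intro j; by_cases h : i = j <;> simp [h, hβ]
      simp [this]
    simp only [h, if_neg hβ]
    simp
    ring

omit [Nonempty X] [MeasurableSpace X] in
theorem prodG_succ (k : ℕ) (ω : Hist X) :
    prodG G Np (k + 1) ω = prodG G Np k ω * etaN Np k (G k) ω := Finset.prod_range_succ _ _

theorem patConst_succ (k : ℕ) : patConst Np b (k + 1) = patConst Np b k *
    if b (k + 1) then (Np (k + 1) : ℝ) else (Np (k + 1) : ℝ) / ((Np (k + 1) : ℝ) - 1) :=
  Finset.prod_range_succ _ _

/-- Normalisation of the pair sums at generation `p`. -/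
def pairNorm (G : ℕ → X → ℝ) (Np : ℕ → ℕ) (b : ℕ → Bool) (p : ℕ) (ω : Hist X) : ℝ :=
  patConst Np b p * prodG G Np p ω ^ 2 * (Np p : ℝ)⁻¹ ^ 2

omit [Nonempty X] [∀ p, IsMarkovKernel (M p)] in
theorem pairNorm_mul_stepMean {k : ℕ} (hG : Potentials G B k) (hN : ∀ q ≤ k, 0 < Np q)
    (hN2 : 2 ≤ Np (k + 1)) (ω : Hist X) (F : X × X → ℝ) :
    pairNorm G Np b (k + 1) ω * ((if b (k + 1) = true then (Np (k + 1) : ℝ)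
        else Np (k + 1) * (Np (k + 1) - 1)) * stepMean M G Np b k ω F) =
      muE G Np b k (pairQ M G b k F) ω := by
  have hS := sum_G_pos hG (hN k le_rfl) (ω.1 k)
  have hNk : (0 : ℝ) < Np k := by exact_mod_cast hN k le_rfl
  have hN' : (2 : ℝ) ≤ Np (k + 1) := by exact_mod_cast hN2
  have hsum : stepMean M G Np b k ω F = ((∑ j ∈ Finset.range (Np k), G k (ω.1 k j)) ^ 2)⁻¹ *
      ∑ i ∈ Finset.range (Np k), ∑ j ∈ Finset.range (Np k),
        lineWt G Np b k ω i j * pairQ M G b k F (ω.1 k i, ω.1 k j) := by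
    rw [stepMean, Finset.mul_sum]
    refine Finset.sum_congr rfl fun a _ => ?_
    rw [Finset.mul_sum]
    refine Finset.sum_congr rfl fun a' _ => ?_
    rw [resW, resW, pairQ]
    field_simp
  rw [hsum, muE, pairNorm, patConst_succ, prodG_succ, etaN]
  have h1 : (Np (k + 1) : ℝ) - 1 ≠ 0 := by linarith
  have h2 : (Np (k + 1) : ℝ) ≠ 0 := by linarith
  split_ifs <;> field_simp

omit [MeasurableSpace X] in
theorem muE_extend {k : ℕ} (ω : Hist X) (f : Fin (Np (k + 1)) → ℕ × X) (F : X × X → ℝ) :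
    muE G Np b (k + 1) F (extend k ω f) = pairNorm G Np b (k + 1) ω *
      ∑ i, ∑ j, if (i = j ↔ b (k + 1) = true) then stepFun G Np b k ω F (f i, f j) else 0 := by
  rw [muE, prodG_extend ω f le_rfl, pairNorm]
  congr 1
  rw [Finset.sum_range]
  exact Finset.sum_congr rfl fun i _ => sum_lineWt_extend ω f F i

theorem integral_muE_extend {k : ℕ} (hG : Potentials G B k) (hN : ∀ q ≤ k, 0 < Np q)
    (hN2 : 2 ≤ Np (k + 1)) (ω : Hist X) {F : X × X → ℝ} (hF : BddMeas F) :
    ∫ f, muE G Np b (k + 1) F (extend k ω f)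
        ∂(Measure.pi fun _ : Fin (Np (k + 1)) => stepLaw M G Np k (ω.1 k)) =
      muE G Np b k (pairQ M G b k F) ω := by
  have := isProbabilityMeasure_stepLaw (M := M) hG (hN k le_rfl) (ω.1 k)
  have hs (i j : Fin (Np (k + 1))) := (bddMeas_stepFun (b := b) hG hN ω hF).comp
    (u := fun f : Fin (Np (k + 1)) → ℕ × X => (f i, f j)) (by fun_prop)
  simp only [muE_extend]
  rw [integral_const_mul, ← pairNorm_mul_stepMean hG hN hN2, ← sum_ite_iff_const]
  congr 1
  rw [integral_finsetSum _ fun i _ => (BddMeas.sum fun j _ => (hs i j).ite _ (.const 0)).integrable _]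
  refine Finset.sum_congr rfl fun i _ => ?_
  rw [integral_finsetSum _ fun j _ => ((hs i j).ite _ (.const 0)).integrable _]
  refine Finset.sum_congr rfl fun j _ => ?_
  split_ifs with hij
  · exact integral_stepFun hG hN ω hF hij
  · simp

/-- Second-order quantity controlling the conditional variance of the pair estimators. -/
def pairVar (G : ℕ → X → ℝ) (Np : ℕ → ℕ) (b : ℕ → Bool) (p : ℕ) (ω : Hist X) : ℝ :=
  pairNorm G Np b p ω ^ 2 *
    ∑ i ∈ Finset.range (Np p), (∑ j ∈ Finset.range (Np p), lineWt G Np b p ω i j) ^ 2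

omit [Nonempty X] in
theorem bddMeas_pairNorm {p : ℕ} (hG : Potentials G B p) : BddMeas (pairNorm G Np b p) :=
  ((BddMeas.const _).mul ((bddMeas_prodG hG).pow 2)).mul (.const _)

omit [Nonempty X] in
theorem bddMeas_pairVar {p : ℕ} (hG : Potentials G B p) (hN : ∀ q ≤ p, 0 < Np q) :
    BddMeas (pairVar G Np b p) :=
  ((bddMeas_pairNorm hG).pow 2).mul
    (BddMeas.sum fun i _ => (BddMeas.sum fun j _ => bddMeas_lineWt hG hN i j).pow 2)

theorem integral_sq_muE_extend_le {k : ℕ} (hG : Potentials G B k) (hN : ∀ q ≤ k, 0 < Np q)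
    (hN2 : 2 ≤ Np (k + 1)) (ω : Hist X) {F : X × X → ℝ} (hF : Measurable F) {A : ℝ}
    (hA : ∀ q, |F q| ≤ A) :
    ∫ f, (muE G Np b (k + 1) F (extend k ω f) - muE G Np b k (pairQ M G b k F) ω) ^ 2
        ∂(Measure.pi fun _ : Fin (Np (k + 1)) => stepLaw M G Np k (ω.1 k)) ≤
      4 * A ^ 2 * ∫ f, pairVar G Np b (k + 1) (extend k ω f)
        ∂(Measure.pi fun _ : Fin (Np (k + 1)) => stepLaw M G Np k (ω.1 k)) := by
  have := isProbabilityMeasure_stepLaw (M := M) hG (hN k le_rfl) (ω.1 k)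
  have hF' : BddMeas F := ⟨hF, A, hA⟩
  have key := integral_sq_pairSum_sub_le (ι := Fin (Np (k + 1))) (stepLaw M G Np k (ω.1 k))
    (b (k + 1) = true) (bddMeas_stepFun hG hN ω hF') (bddMeas_stepFun hG hN ω (.const A))
    (fun q => by
      rw [stepFun, stepFun, abs_mul, abs_of_nonneg (stepWt_bounds hG hN ω _ _).1]
      exact mul_le_mul_of_nonneg_left (hA _) (stepWt_bounds hG hN ω _ _).1)
    (fun hb y y' => by simp only [stepFun, stepWt, if_neg hb]; rw [lineWt_comm])
    (fun i j hij => integral_stepFun hG hN ω hF' hij)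
  rw [sum_ite_iff_const] at key
  have hl : ∀ f : Fin (Np (k + 1)) → ℕ × X, (muE G Np b (k + 1) F (extend k ω f) - muE G Np b k (pairQ M G b k F) ω) ^ 2 =
      pairNorm G Np b (k + 1) ω ^ 2 * ((∑ i, ∑ j, if (i = j ↔ b (k + 1) = true) then
        stepFun G Np b k ω F (f i, f j) else 0) - (if b (k + 1) = true then (Np (k + 1) : ℝ)
        else Np (k + 1) * (Np (k + 1) - 1)) * stepMean M G Np b k ω F) ^ 2 := by
    intro f
    rw [muE_extend, ← pairNorm_mul_stepMean hG hN hN2]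
    ring
  have hr : ∀ f : Fin (Np (k + 1)) → ℕ × X, A ^ 2 * pairVar G Np b (k + 1) (extend k ω f) = pairNorm G Np b (k + 1) ω ^ 2 *
      ∑ i, (∑ j, if (i = j ↔ b (k + 1) = true) then
        stepFun G Np b k ω (fun _ => A) (f i, f j) else 0) ^ 2 := by
    intro f
    rw [pairVar, pairNorm, prodG_extend ω f le_rfl, ← pairNorm, mul_left_comm, Finset.mul_sum,
      Finset.sum_range]
    congr 1
    refine Finset.sum_congr rfl fun i _ => ?_
    rw [← sum_lineWt_extend, ← Finset.sum_mul]
    ring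
  rw [mul_assoc, ← integral_const_mul (A ^ 2)]
  simp only [hl, hr, integral_const_mul]
  rw [mul_left_comm]
  exact mul_le_mul_of_nonneg_left key (sq_nonneg _)

end OneStep

/-! ### Unbiasedness and mean square error -/

section MeanSquare

variable [Nonempty X] {M0 : Measure X} [IsProbabilityMeasure M0] {M : ℕ → Kernel X X}
  [∀ p, IsMarkovKernel (M p)] {G : ℕ → X → ℝ} {Np : ℕ → ℕ} {B : ℝ} {b : ℕ → Bool}

omit [MeasurableSpace X] in
theorem sum_lineWt_initConf (f : Fin (Np 0) → X) (F : X × X → ℝ) (i : Fin (Np 0)) :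
    ∑ j ∈ Finset.range (Np 0), lineWt G Np b 0 (initConf f) i j *
        F ((initConf f).1 0 i, (initConf f).1 0 j) =
      ∑ j, if (i = j ↔ b 0 = true) then F (f i, f j) else 0 := by
  rw [Finset.sum_range]
  refine Finset.sum_congr rfl fun j _ => ?_
  rw [lineWt_zero, ite_mul, zero_mul, one_mul]
  simp [Fin.ext_iff, initConf, padF]

omit [MeasurableSpace X] in
theorem muE_initConf (f : Fin (Np 0) → X) (F : X × X → ℝ) :
    muE G Np b 0 F (initConf f) = patConst Np b 0 * (Np 0 : ℝ)⁻¹ ^ 2 *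
      ∑ i, ∑ j, if (i = j ↔ b 0 = true) then F (f i, f j) else 0 := by
  rw [muE, Finset.sum_range, prodG, Finset.prod_range_zero, one_pow, mul_one]
  congr 1
  exact Finset.sum_congr rfl fun i _ => sum_lineWt_initConf f F i

theorem patConst_zero_mul (hN2 : 2 ≤ Np 0) (e : ℝ) :
    patConst Np b 0 * (Np 0 : ℝ)⁻¹ ^ 2 *
      ((if b 0 = true then (Np 0 : ℝ) else Np 0 * (Np 0 - 1)) * e) = e := by
  have hN' : (2 : ℝ) ≤ Np 0 := by exact_mod_cast hN2
  have h1 : (Np 0 : ℝ) - 1 ≠ 0 := by linarith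
  have h2 : (Np 0 : ℝ) ≠ 0 := by linarith
  rw [patConst, Finset.prod_range_one]
  split_ifs <;> field_simp

omit [Nonempty X] in
theorem integral_pi_pairInit {F : X × X → ℝ} (hF : BddMeas F) {ι : Type*} [Fintype ι] {i j : ι}
    (hij : i = j ↔ b 0 = true) :
    ∫ f, F (f i, f j) ∂(Measure.pi fun _ : ι => M0) = ∫ q, F q ∂(pairInit M0 b) := by
  by_cases hb : b 0 = true
  · obtain rfl := hij.2 hb
    rw [integral_pi_eval (h := fun y => F (y, y)) _ _ (hF.meas.comp (by fun_prop)), pairInit,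
      if_pos hb, integral_map (by fun_prop) hF.meas.aestronglyMeasurable]
  · rw [integral_pi_pair _ (fun h => hb (hij.1 h)) hF, pairInit, if_neg hb,
      integral_prod _ (hF.integrable _)]

omit [∀ p, IsMarkovKernel (M p)] in
theorem integral_muE_zero (hG : Potentials G B 0) (hN2 : 2 ≤ Np 0) {F : X × X → ℝ}
    (hF : BddMeas F) : ∫ ω, muE G Np b 0 F ω ∂(pfLaw M0 M G Np 0) = muB M0 M G 0 b F := by
  have hs (i j : Fin (Np 0)) := hF.comp (u := fun f : Fin (Np 0) → X => (f i, f j)) (by fun_prop)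
  rw [integral_pfLaw_zero (bddMeas_muE hG (fun q hq => by obtain rfl := Nat.le_zero.1 hq; omega) hF),
    muB_zero hF]
  simp only [muE_initConf]
  rw [integral_const_mul, ← patConst_zero_mul (b := b) hN2 (∫ q, F q ∂(pairInit M0 b)),
    ← sum_ite_iff_const]
  congr 1
  rw [integral_finsetSum _ fun i _ => (BddMeas.sum fun j _ => (hs i j).ite _ (.const 0)).integrable _]
  refine Finset.sum_congr rfl fun i _ => ?_
  rw [integral_finsetSum _ fun j _ => ((hs i j).ite _ (.const 0)).integrable _]
  refine Finset.sum_congr rfl fun j _ => ?_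
  split_ifs with hij
  · exact integral_pi_pairInit hF hij
  · simp

omit [∀ p, IsMarkovKernel (M p)] in
theorem integral_sq_muE_zero_le (hG : Potentials G B 0) (hN2 : 2 ≤ Np 0) {F : X × X → ℝ}
    (hF : Measurable F) {A : ℝ} (hA : ∀ q, |F q| ≤ A) :
    ∫ ω, (muE G Np b 0 F ω - muB M0 M G 0 b F) ^ 2 ∂(pfLaw M0 M G Np 0) ≤
      4 * A ^ 2 * ∫ ω, pairVar G Np b 0 ω ∂(pfLaw M0 M G Np 0) := by
  have hF' : BddMeas F := ⟨hF, A, hA⟩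
  have hN : ∀ q ≤ 0, 0 < Np q := fun q hq => by obtain rfl := Nat.le_zero.1 hq; omega
  rw [integral_pfLaw_zero (((bddMeas_muE hG hN hF').sub (.const _)).pow 2),
    integral_pfLaw_zero (bddMeas_pairVar hG hN), muB_zero hF']
  have key := integral_sq_pairSum_sub_le (ι := Fin (Np 0)) M0 (b 0 = true) hF' (.const A) hA
    (fun _ _ _ => rfl) (fun i j hij => integral_pi_pairInit hF' hij)
  rw [sum_ite_iff_const] at key
  have hl : ∀ f : Fin (Np 0) → X,
      (muE G Np b 0 F (initConf f) - ∫ q, F q ∂(pairInit M0 b)) ^ 2 =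
      (patConst Np b 0 * (Np 0 : ℝ)⁻¹ ^ 2) ^ 2 * ((∑ i, ∑ j, if (i = j ↔ b 0 = true) then
        F (f i, f j) else 0) - (if b 0 = true then (Np 0 : ℝ)
        else Np 0 * (Np 0 - 1)) * ∫ q, F q ∂(pairInit M0 b)) ^ 2 := by
    intro f
    have := patConst_zero_mul (b := b) hN2 (∫ q, F q ∂(pairInit M0 b))
    rw [muE_initConf, ← mul_pow, mul_sub, this]
  have hr : ∀ f : Fin (Np 0) → X, A ^ 2 * pairVar G Np b 0 (initConf f) =
      (patConst Np b 0 * (Np 0 : ℝ)⁻¹ ^ 2) ^ 2 *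
      ∑ i : Fin (Np 0), (∑ j : Fin (Np 0), if (i = j ↔ b 0 = true) then A else 0) ^ 2 := by
    intro f
    rw [pairVar, pairNorm, prodG, Finset.prod_range_zero, one_pow, mul_one, mul_left_comm,
      Finset.mul_sum, Finset.sum_range]
    congr 1
    refine Finset.sum_congr rfl fun i _ => ?_
    rw [← sum_lineWt_initConf (G := G) f (fun _ => A), ← Finset.sum_mul]
    ring
  rw [mul_assoc, ← integral_const_mul (A ^ 2)]
  simp only [hl, hr, integral_const_mul] at key ⊢
  rw [mul_left_comm]
  exact mul_le_mul_of_nonneg_left key (sq_nonneg _)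

theorem integral_muE {k : ℕ} (hG : Potentials G B k) (hN : ∀ q ≤ k, 2 ≤ Np q) {F : X × X → ℝ}
    (hF : BddMeas F) : ∫ ω, muE G Np b k F ω ∂(pfLaw M0 M G Np k) = muB M0 M G k b F := by
  induction k generalizing F with
  | zero => exact integral_muE_zero hG (hN 0 le_rfl) hF
  | succ k ih =>
    have hG' := hG.mono k.le_succ
    have hN' : ∀ q ≤ k, 0 < Np q := fun q hq => by have := hN q (by omega); omega
    rw [integral_pfLaw_succ hG' hN' (bddMeas_muE hG (fun q hq => by have := hN q hq; omega) hF),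
      muB_succ hG' hF, ← ih hG' (fun q hq => hN q (by omega)) (hF.pairQ hG')]
    simp only [integral_muE_extend hG' hN' (hN (k + 1) le_rfl) _ hF]

theorem integral_sq_sub_const {Ω : Type*} [MeasurableSpace Ω] {μ : Measure Ω}
    [IsProbabilityMeasure μ] {Y : Ω → ℝ} (hY : BddMeas Y) (m : ℝ) :
    ∫ ω, (Y ω - m) ^ 2 ∂μ = ∫ ω, (Y ω - ∫ ω, Y ω ∂μ) ^ 2 ∂μ + (∫ ω, Y ω ∂μ - m) ^ 2 := by
  set e := ∫ ω, Y ω ∂μ with he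
  have h : ∀ ω, (Y ω - m) ^ 2 = (Y ω - e) ^ 2 + (2 * (e - m) * (Y ω - e) + (e - m) ^ 2) := by
    intro ω; ring
  simp only [h]
  have h1 := hY.sub (.const e)
  rw [integral_add ((h1.pow 2).integrable _)
    ((((BddMeas.const _).mul h1).add (.const _)).integrable _),
    integral_add (((BddMeas.const _).mul h1).integrable _) ((BddMeas.const _).integrable _),
    integral_const_mul, integral_sub (hY.integrable _) ((BddMeas.const _).integrable _)]
  simp [← he]

theorem integral_sq_muE_succ_le {k : ℕ} (hG : Potentials G B (k + 1)) (hN : ∀ q ≤ k + 1, 2 ≤ Np q)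
    {F : X × X → ℝ} (hF : Measurable F) {A : ℝ} (hA : ∀ q, |F q| ≤ A) :
    ∫ ω, (muE G Np b (k + 1) F ω - muB M0 M G (k + 1) b F) ^ 2 ∂(pfLaw M0 M G Np (k + 1)) ≤
      4 * A ^ 2 * ∫ ω, pairVar G Np b (k + 1) ω ∂(pfLaw M0 M G Np (k + 1)) +
      ∫ ω, (muE G Np b k (pairQ M G b k F) ω - muB M0 M G k b (pairQ M G b k F)) ^ 2
        ∂(pfLaw M0 M G Np k) := by
  have hF' : BddMeas F := ⟨hF, A, hA⟩
  have hG' := hG.mono k.le_succ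
  have hN0 : ∀ q ≤ k + 1, 0 < Np q := fun q hq => by have := hN q hq; omega
  have hN' : ∀ q ≤ k, 0 < Np q := fun q hq => hN0 q (by omega)
  have := isProbabilityMeasure_pfLaw (M0 := M0) (M := M) hG' hN'
  have hm := bddMeas_muE (b := b) hG hN0 hF'
  have hv := bddMeas_pairVar (b := b) hG hN0
  have hq := bddMeas_muE (b := b) hG' hN' (hF'.pairQ (M := M) (b := b) hG')
  have hvi := bddMeas_integral_extend (M := M) hG' hN' hv
  rw [integral_pfLaw_succ hG' hN' ((hm.sub (.const _)).pow 2), integral_pfLaw_succ hG' hN' hv,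
    muB_succ hG' hF', ← integral_const_mul,
    ← integral_add (((BddMeas.const _).mul hvi).integrable _)
      (((hq.sub (.const _)).pow 2).integrable _)]
  refine integral_mono
    ((bddMeas_integral_extend hG' hN' ((hm.sub (.const _)).pow 2)).integrable _)
    ((((BddMeas.const _).mul hvi).add ((hq.sub (.const _)).pow 2)).integrable _) fun ω => ?_
  have := isProbabilityMeasure_stepLaw (M := M) hG' (hN' k le_rfl) (ω.1 k)
  have hme := hm.comp (u := fun f : Fin (Np (k + 1)) → ℕ × X => extend k ω f)
    ((measurable_extend k _).comp measurable_prodMk_left)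
  dsimp only
  rw [integral_sq_sub_const hme, integral_muE_extend hG' hN' (hN (k + 1) le_rfl) ω hF']
  gcongr
  exact integral_sq_muE_extend_le hG' hN' (hN (k + 1) le_rfl) ω hF hA

theorem tendsto_integral_sq_muE {Np : ℕ → ℕ → ℕ} {k : ℕ} (hG : Potentials G B k)
    (hN : ∀ᶠ N in atTop, ∀ q ≤ k, 2 ≤ Np N q)
    (hV : ∀ j ≤ k, Tendsto (fun N => ∫ ω, pairVar G (Np N) b j ω ∂(pfLaw M0 M G (Np N) j))
      atTop (nhds 0)) {F : X × X → ℝ} (hF : BddMeas F) :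
    Tendsto (fun N => ∫ ω, (muE G (Np N) b k F ω - muB M0 M G k b F) ^ 2
      ∂(pfLaw M0 M G (Np N) k)) atTop (nhds 0) := by
  induction k generalizing F with
  | zero =>
    obtain ⟨A, hA⟩ := hF.bdd
    have h := (hV 0 le_rfl).const_mul (4 * A ^ 2)
    rw [mul_zero] at h
    refine tendsto_of_tendsto_of_tendsto_of_le_of_le' tendsto_const_nhds h
      (Eventually.of_forall fun N => integral_nonneg fun ω => sq_nonneg _) ?_
    filter_upwards [hN] with N hN
    exact integral_sq_muE_zero_le hG (hN 0 le_rfl) hF.meas hA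
  | succ k ih =>
    obtain ⟨A, hA⟩ := hF.bdd
    have h := ((hV (k + 1) le_rfl).const_mul (4 * A ^ 2)).add
      (ih (hG.mono k.le_succ) (hN.mono fun N h q hq => h q (by omega))
        (fun j hj => hV j (by omega)) (hF.pairQ (M := M) (b := b) (hG.mono k.le_succ)))
    rw [mul_zero, zero_add] at h
    refine tendsto_of_tendsto_of_tendsto_of_le_of_le' tendsto_const_nhds h
      (Eventually.of_forall fun N => integral_nonneg fun ω => sq_nonneg _) ?_
    filter_upwards [hN] with N hN
    exact integral_sq_muE_succ_le hG hN hF.meas hA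

end MeanSquare

/-! ### Decay of the second-order quantity -/

section Decay

theorem sum_sq_add_sum_le {ι : Type*} [Fintype ι] [DecidableEq ι] {v : ι → ι → ℝ} (h0 : ∀ i j, 0 ≤ v i j)
    (h1 : ∀ i j, v i j ≤ 1) :
    ∑ i, ((∑ j, if ¬ i = j then v i j else 0) ^ 2 + ∑ j, if ¬ i = j then v i j else 0) ≤
      (∑ i, ∑ j, ∑ l, if ¬ i = j ∧ ¬ i = l ∧ ¬ j = l then v i j * v i l else 0) +
        2 * ∑ i, ∑ j, if ¬ i = j then v i j else 0 := by
  rw [Finset.mul_sum, ← Finset.sum_add_distrib]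
  refine Finset.sum_le_sum fun i _ => ?_
  have h : (∑ j, if ¬ i = j then v i j else 0) ^ 2 ≤
      (∑ j, ∑ l, if ¬ i = j ∧ ¬ i = l ∧ ¬ j = l then v i j * v i l else 0) +
        ∑ j, if ¬ i = j then v i j else 0 := by
    rw [sq, Finset.sum_mul_sum, ← Finset.sum_add_distrib]
    refine Finset.sum_le_sum fun j _ => ?_
    have hd : (if ¬ i = j then v i j else 0) =
        ∑ l, if j = l then (if ¬ i = j then v i j else 0) else 0 := by simp
    rw [hd, ← Finset.sum_add_distrib]
    refine Finset.sum_le_sum fun l _ => ?_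
    by_cases hij : i = j
    · simp [hij]
    by_cases hjl : j = l
    · subst hjl
      simpa [hij] using mul_le_of_le_one_left (h0 i j) (h1 i j)
    · by_cases hil : i = l <;> simp [hij, hil, hjl]
  linarith

theorem integral_sum_sq_add_sum_le {Ω ι : Type*} [MeasurableSpace Ω] {μ : Measure Ω}
    [IsProbabilityMeasure μ] [Fintype ι] [DecidableEq ι] {v : Ω → ι → ι → ℝ} (hv : ∀ i j, BddMeas fun ω => v ω i j)
    (h0 : ∀ ω i j, 0 ≤ v ω i j) (h1 : ∀ ω i j, v ω i j ≤ 1) {D T : ℝ} (hD : 0 ≤ D) (hT : 0 ≤ T)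
    (hvD : ∀ i j, i ≠ j → ∫ ω, v ω i j ∂μ ≤ D)
    (hvT : ∀ i j l, i ≠ j → i ≠ l → j ≠ l → ∫ ω, v ω i j * v ω i l ∂μ ≤ T) :
    ∫ ω, ∑ i, ((∑ j, if ¬ i = j then v ω i j else 0) ^ 2 + ∑ j, if ¬ i = j then v ω i j else 0) ∂μ ≤
      (Fintype.card ι : ℝ) ^ 3 * T + 2 * ((Fintype.card ι : ℝ) ^ 2 * D) := by
  have h2 (i j : ι) : BddMeas fun ω => if ¬ i = j then v ω i j else 0 := (hv i j).ite _ (.const 0)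
  have h3 (i j l : ι) : BddMeas fun ω =>
      if ¬ i = j ∧ ¬ i = l ∧ ¬ j = l then v ω i j * v ω i l else 0 :=
    ((hv i j).mul (hv i l)).ite _ (.const 0)
  have hS2 : BddMeas fun ω => ∑ i, ∑ j, if ¬ i = j then v ω i j else 0 :=
    BddMeas.sum fun i _ => BddMeas.sum fun j _ => h2 i j
  have hS3 : BddMeas fun ω => ∑ i, ∑ j, ∑ l,
      if ¬ i = j ∧ ¬ i = l ∧ ¬ j = l then v ω i j * v ω i l else 0 :=
    BddMeas.sum fun i _ => BddMeas.sum fun j _ => BddMeas.sum fun l _ => h3 i j l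
  have hS : BddMeas fun ω =>
      ∑ i, ((∑ j, if ¬ i = j then v ω i j else 0) ^ 2 + ∑ j, if ¬ i = j then v ω i j else 0) :=
    BddMeas.sum fun i _ => ((BddMeas.sum fun j _ => h2 i j).pow 2).add
      (BddMeas.sum fun j _ => h2 i j)
  refine (integral_mono (hS.integrable μ) ((hS3.add ((BddMeas.const 2).mul hS2)).integrable μ)
    fun ω => sum_sq_add_sum_le (h0 ω) (h1 ω)).trans ?_
  rw [integral_add (hS3.integrable μ) (((BddMeas.const 2).mul hS2).integrable μ),
    integral_const_mul]
  refine add_le_add ?_ (mul_le_mul_of_nonneg_left ?_ zero_le_two)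
  · have : ∀ i j l, ∫ ω, (if ¬ i = j ∧ ¬ i = l ∧ ¬ j = l then v ω i j * v ω i l else 0) ∂μ ≤ T := by
      intro i j l
      split_ifs with h
      · exact hvT i j l h.1 h.2.1 h.2.2
      · simpa using hT
    calc _ ≤ ∑ _i : ι, ∑ _j : ι, ∑ _l : ι, T := by
          rw [integral_finsetSum _ fun i _ =>
            (BddMeas.sum fun j _ => BddMeas.sum fun l _ => h3 i j l).integrable μ]
          refine Finset.sum_le_sum fun i _ => ?_
          rw [integral_finsetSum _ fun j _ => (BddMeas.sum fun l _ => h3 i j l).integrable μ]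
          refine Finset.sum_le_sum fun j _ => ?_
          rw [integral_finsetSum _ fun l _ => (h3 i j l).integrable μ]
          exact Finset.sum_le_sum fun l _ => this i j l
      _ = _ := by simp; ring
  · have : ∀ i j, ∫ ω, (if ¬ i = j then v ω i j else 0) ∂μ ≤ D := by
      intro i j
      split_ifs with h
      · simpa using hD
      · exact hvD i j h
    calc _ ≤ ∑ _i : ι, ∑ _j : ι, D := by
          rw [integral_finsetSum _ fun i _ => (BddMeas.sum fun j _ => h2 i j).integrable μ]
          refine Finset.sum_le_sum fun i _ => ?_
          rw [integral_finsetSum _ fun j _ => (h2 i j).integrable μ]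
          exact Finset.sum_le_sum fun j _ => this i j
      _ = _ := by simp; ring

variable [Nonempty X] {M0 : Measure X} [IsProbabilityMeasure M0] {M : ℕ → Kernel X X}
  [∀ p, IsMarkovKernel (M p)] {G : ℕ → X → ℝ} {Np : ℕ → ℕ} {B : ℝ} {b : ℕ → Bool}

/-- Total weight of the pairs whose first component is the lineage of particle `i`. -/
def rowSum (G : ℕ → X → ℝ) (Np : ℕ → ℕ) (b : ℕ → Bool) (p : ℕ) (ω : Hist X) (i : ℕ) : ℝ :=
  ∑ j ∈ Finset.range (Np p), lineWt G Np b p ω i j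

/-- A majorant of `pairVar` that propagates along generations without collision. -/
def pairVarAux (G : ℕ → X → ℝ) (Np : ℕ → ℕ) (b : ℕ → Bool) (p : ℕ) (ω : Hist X) : ℝ :=
  pairNorm G Np b p ω ^ 2 *
    ∑ i ∈ Finset.range (Np p), (rowSum G Np b p ω i ^ 2 + rowSum G Np b p ω i)

omit [Nonempty X] in
theorem rowSum_nonneg {p : ℕ} (hG : Potentials G B p) (hN : ∀ q ≤ p, 0 < Np q) (ω : Hist X)
    (i : ℕ) : 0 ≤ rowSum G Np b p ω i :=
  Finset.sum_nonneg fun j _ => (lineWt_bounds hG hN ω i j).1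

omit [Nonempty X] in
theorem bddMeas_pairVarAux {p : ℕ} (hG : Potentials G B p) (hN : ∀ q ≤ p, 0 < Np q) :
    BddMeas (pairVarAux G Np b p) := by
  have h (i : ℕ) : BddMeas fun ω : Hist X => rowSum G Np b p ω i :=
    BddMeas.sum fun j _ => bddMeas_lineWt hG hN i j
  exact ((bddMeas_pairNorm hG).pow 2).mul (BddMeas.sum fun i _ => ((h i).pow 2).add (h i))

omit [Nonempty X] [MeasurableSpace X] in
theorem pairVar_nonneg {p : ℕ} (ω : Hist X) : 0 ≤ pairVar G Np b p ω :=
  mul_nonneg (sq_nonneg _) (Finset.sum_nonneg fun _ _ => sq_nonneg _)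

omit [Nonempty X] in
theorem pairVar_le_pairVarAux {p : ℕ} (hG : Potentials G B p) (hN : ∀ q ≤ p, 0 < Np q)
    (ω : Hist X) : pairVar G Np b p ω ≤ pairVarAux G Np b p ω := by
  refine mul_le_mul_of_nonneg_left (Finset.sum_le_sum fun i _ => ?_) (sq_nonneg _)
  rw [rowSum]
  exact le_add_of_nonneg_right (rowSum_nonneg hG hN ω i)

/-- Conditional mean of the product of two pair weights sharing their first component. -/
def tripleMean (G : ℕ → X → ℝ) (Np : ℕ → ℕ) (b : ℕ → Bool) (k : ℕ) (ω : Hist X) : ℝ :=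
  ∑ a ∈ Finset.range (Np k), resW G Np k (ω.1 k) a *
    (∑ a' ∈ Finset.range (Np k), resW G Np k (ω.1 k) a' * lineWt G Np b k ω a a') ^ 2

/-- Conditional mean of a pair weight. -/
def doubleMean (G : ℕ → X → ℝ) (Np : ℕ → ℕ) (b : ℕ → Bool) (k : ℕ) (ω : Hist X) : ℝ :=
  ∑ a ∈ Finset.range (Np k), resW G Np k (ω.1 k) a *
    ∑ a' ∈ Finset.range (Np k), resW G Np k (ω.1 k) a' * lineWt G Np b k ω a a'

omit [Nonempty X] in
theorem bddMeas_lineWt_fst {k : ℕ} (hG : Potentials G B k) (hN : ∀ q ≤ k, 0 < Np q)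
    (ω : Hist X) :
    BddMeas fun q : (ℕ × X) × (ℕ × X) => lineWt G Np b k ω q.1.1 q.2.1 := by
  have h : BddMeas fun r : ℕ × ℕ => lineWt G Np b k ω r.1 r.2 :=
    ⟨measurable_of_countable _, 1, fun r => by
      rw [abs_of_nonneg (lineWt_bounds hG hN ω _ _).1]; exact (lineWt_bounds hG hN ω _ _).2⟩
  exact h.comp (u := fun q : (ℕ × X) × (ℕ × X) => (q.1.1, q.2.1)) (by fun_prop)

omit [Nonempty X] in
theorem integral_lineWt_fst {k : ℕ} (hG : Potentials G B k) (hN : ∀ q ≤ k, 0 < Np q)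
    (ω : Hist X) (y : ℕ × X) :
    ∫ y', lineWt G Np b k ω y.1 y'.1 ∂(stepLaw M G Np k (ω.1 k)) =
      ∑ a' ∈ Finset.range (Np k), resW G Np k (ω.1 k) a' * lineWt G Np b k ω y.1 a' := by
  rw [integral_stepLaw (h := fun y' => lineWt G Np b k ω y.1 y'.1) hG (hN k le_rfl) _
    ((bddMeas_lineWt_fst hG hN ω).comp (u := fun y' => (y, y')) (by fun_prop))]
  simp

omit [Nonempty X] in
theorem bddMeas_sum_resW_fst {k : ℕ} (hG : Potentials G B k) (hN : ∀ q ≤ k, 0 < Np q)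
    (ω : Hist X) : BddMeas fun y : ℕ × X =>
      ∑ a' ∈ Finset.range (Np k), resW G Np k (ω.1 k) a' * lineWt G Np b k ω y.1 a' :=
  BddMeas.sum fun a' _ => (BddMeas.const _).mul
    ⟨(measurable_of_countable fun i => lineWt G Np b k ω i a').comp measurable_fst, 1, fun r => by
      rw [abs_of_nonneg (lineWt_bounds hG hN ω _ _).1]; exact (lineWt_bounds hG hN ω _ _).2⟩

omit [Nonempty X] in
theorem integral_lineWt_pair {k : ℕ} (hG : Potentials G B k) (hN : ∀ q ≤ k, 0 < Np q)
    (ω : Hist X) {ι : Type*} [Fintype ι] {i j : ι} (hij : i ≠ j) :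
    ∫ f, lineWt G Np b k ω (f i).1 (f j).1
        ∂(Measure.pi fun _ : ι => stepLaw M G Np k (ω.1 k)) = doubleMean G Np b k ω := by
  have := isProbabilityMeasure_stepLaw (M := M) hG (hN k le_rfl) (ω.1 k)
  rw [integral_pi_pair (h := fun q : (ℕ × X) × (ℕ × X) => lineWt G Np b k ω q.1.1 q.2.1) _ hij
    (bddMeas_lineWt_fst hG hN ω)]
  simp only [integral_lineWt_fst hG hN ω]
  rw [integral_stepLaw hG (hN k le_rfl) _ (bddMeas_sum_resW_fst hG hN ω)]
  simp [doubleMean]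

omit [Nonempty X] in
theorem integral_lineWt_triple {k : ℕ} (hG : Potentials G B k) (hN : ∀ q ≤ k, 0 < Np q)
    (ω : Hist X) {ι : Type*} [Fintype ι] {i j l : ι} (hij : i ≠ j) (hil : i ≠ l) (hjl : j ≠ l) :
    ∫ f, lineWt G Np b k ω (f i).1 (f j).1 * lineWt G Np b k ω (f i).1 (f l).1
        ∂(Measure.pi fun _ : ι => stepLaw M G Np k (ω.1 k)) = tripleMean G Np b k ω := by
  have := isProbabilityMeasure_stepLaw (M := M) hG (hN k le_rfl) (ω.1 k)
  have hw := bddMeas_lineWt_fst (b := b) hG hN ω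
  rw [integral_pi_triple (h := fun q : ((ℕ × X) × (ℕ × X)) × (ℕ × X) =>
      lineWt G Np b k ω q.1.1.1 q.1.2.1 * lineWt G Np b k ω q.1.1.1 q.2.1) _ hij hil hjl
    ((hw.comp (u := fun q : ((ℕ × X) × (ℕ × X)) × (ℕ × X) => q.1) (by fun_prop)).mul
      (hw.comp (u := fun q : ((ℕ × X) × (ℕ × X)) × (ℕ × X) => (q.1.1, q.2)) (by fun_prop)))]
  simp only [integral_const_mul, integral_mul_const, integral_lineWt_fst hG hN ω]
  simp only [← sq]
  rw [integral_stepLaw hG (hN k le_rfl) _ ((bddMeas_sum_resW_fst hG hN ω).pow 2)]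
  simp [tripleMean]

omit [MeasurableSpace X] in
theorem rowSum_extend {k : ℕ} (hb : b (k + 1) = false) (ω : Hist X)
    (f : Fin (Np (k + 1)) → ℕ × X) (i : Fin (Np (k + 1))) :
    rowSum G Np b (k + 1) (extend k ω f) i =
      ∑ j, if ¬ i = j then lineWt G Np b k ω (f i).1 (f j).1 else 0 := by
  have := sum_lineWt_extend (G := G) (b := b) ω f (fun _ => 1) i
  simp only [mul_one] at this
  rw [rowSum, this]
  simp [hb, stepFun, stepWt]

theorem integral_pairVarAux_extend_le {k : ℕ} (hG : Potentials G B k) (hN : ∀ q ≤ k, 0 < Np q)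
    (hb : b (k + 1) = false) (ω : Hist X) :
    ∫ f, pairVarAux G Np b (k + 1) (extend k ω f)
        ∂(Measure.pi fun _ : Fin (Np (k + 1)) => stepLaw M G Np k (ω.1 k)) ≤
      pairNorm G Np b (k + 1) ω ^ 2 * ((Np (k + 1) : ℝ) ^ 3 * tripleMean G Np b k ω +
        2 * ((Np (k + 1) : ℝ) ^ 2 * doubleMean G Np b k ω)) := by
  have := isProbabilityMeasure_stepLaw (M := M) hG (hN k le_rfl) (ω.1 k)
  have hT : 0 ≤ tripleMean G Np b k ω :=
    Finset.sum_nonneg fun a _ => mul_nonneg (resW_nonneg hG _ _) (sq_nonneg _)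
  have hD : 0 ≤ doubleMean G Np b k ω :=
    Finset.sum_nonneg fun a _ => mul_nonneg (resW_nonneg hG _ _) (Finset.sum_nonneg fun a' _ =>
      mul_nonneg (resW_nonneg hG _ _) (lineWt_bounds hG hN ω _ _).1)
  have e : ∀ f : Fin (Np (k + 1)) → ℕ × X, pairVarAux G Np b (k + 1) (extend k ω f) =
      pairNorm G Np b (k + 1) ω ^ 2 *
        ∑ i, ((∑ j, if ¬ i = j then lineWt G Np b k ω (f i).1 (f j).1 else 0) ^ 2 +
          ∑ j, if ¬ i = j then lineWt G Np b k ω (f i).1 (f j).1 else 0) := by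
    intro f
    rw [pairVarAux, pairNorm, prodG_extend ω f le_rfl, ← pairNorm, Finset.sum_range]
    simp only [rowSum_extend hb]
  simp only [e]
  rw [integral_const_mul]
  refine mul_le_mul_of_nonneg_left ?_ (sq_nonneg _)
  have := integral_sum_sq_add_sum_le (μ := Measure.pi fun _ : Fin (Np (k + 1)) =>
      stepLaw M G Np k (ω.1 k)) (v := fun f i j => lineWt G Np b k ω (f i).1 (f j).1)
    (fun i j => (bddMeas_lineWt_fst (b := b) hG hN ω).comp
      (u := fun f : Fin (Np (k + 1)) → ℕ × X => (f i, f j)) (by fun_prop))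
    (fun f i j => (lineWt_bounds hG hN ω _ _).1) (fun f i j => (lineWt_bounds hG hN ω _ _).2)
    hD hT (fun i j hij => (integral_lineWt_pair hG hN ω hij).le)
    (fun i j l hij hil hjl => (integral_lineWt_triple hG hN ω hij hil hjl).le)
  simpa using this

end Decay

section DecaySequence

variable [Nonempty X] {M0 : Measure X} [IsProbabilityMeasure M0] {M : ℕ → Kernel X X}
  [∀ p, IsMarkovKernel (M p)] {G : ℕ → X → ℝ} {Np : ℕ → ℕ} {B : ℝ} {b : ℕ → Bool}

omit [Nonempty X] [MeasurableSpace X] in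
theorem pairNorm_succ_of_false {k : ℕ} (hb : b (k + 1) = false) (ω : Hist X) :
    pairNorm G Np b (k + 1) ω = pairNorm G Np b k ω *
      (∑ j ∈ Finset.range (Np k), G k (ω.1 k j)) ^ 2 *
      ((Np (k + 1) : ℝ) / ((Np (k + 1) : ℝ) - 1)) * (Np (k + 1) : ℝ)⁻¹ ^ 2 := by
  rw [pairNorm, pairNorm, patConst_succ, prodG_succ, etaN, hb]
  simp only [Bool.false_eq_true, if_false]
  ring

omit [Nonempty X] in
theorem sum_G_pow_mul_tripleMean_le {k : ℕ} (hG : Potentials G B k) (hN : ∀ q ≤ k, 0 < Np q)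
    (ω : Hist X) :
    (∑ j ∈ Finset.range (Np k), G k (ω.1 k j)) ^ 3 * tripleMean G Np b k ω ≤
      B ^ 3 * ∑ i ∈ Finset.range (Np k), rowSum G Np b k ω i ^ 2 := by
  have hB : 0 ≤ B := zero_le_one.trans hG.one_le
  have hS := sum_G_pos hG (hN k le_rfl) (ω.1 k)
  have hl := lineWt_bounds (b := b) hG hN ω
  rw [tripleMean, Finset.mul_sum, Finset.mul_sum]
  refine Finset.sum_le_sum fun a _ => ?_
  have e : (∑ j ∈ Finset.range (Np k), G k (ω.1 k j)) ^ 3 * (resW G Np k (ω.1 k) a *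
      (∑ a' ∈ Finset.range (Np k), resW G Np k (ω.1 k) a' * lineWt G Np b k ω a a') ^ 2) =
      G k (ω.1 k a) * (∑ a' ∈ Finset.range (Np k), G k (ω.1 k a') * lineWt G Np b k ω a a') ^ 2 := by
    have : ∑ a' ∈ Finset.range (Np k), resW G Np k (ω.1 k) a' * lineWt G Np b k ω a a' =
        (∑ a' ∈ Finset.range (Np k), G k (ω.1 k a') * lineWt G Np b k ω a a') /
          ∑ j ∈ Finset.range (Np k), G k (ω.1 k j) := by
      rw [Finset.sum_div]
      exact Finset.sum_congr rfl fun a' _ => by rw [resW]; ring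
    rw [this, resW]
    field_simp
  have h2 : ∑ a' ∈ Finset.range (Np k), G k (ω.1 k a') * lineWt G Np b k ω a a' ≤
      B * rowSum G Np b k ω a := by
    rw [rowSum, Finset.mul_sum]
    exact Finset.sum_le_sum fun a' _ =>
      mul_le_mul_of_nonneg_right (hG.le k le_rfl _) (hl _ _).1
  have h3 : 0 ≤ ∑ a' ∈ Finset.range (Np k), G k (ω.1 k a') * lineWt G Np b k ω a a' :=
    Finset.sum_nonneg fun a' _ => mul_nonneg (hG.pos k le_rfl _).le (hl _ _).1
  calc _ = _ := e
    _ ≤ B * (B * rowSum G Np b k ω a) ^ 2 :=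
      mul_le_mul (hG.le k le_rfl _) (pow_le_pow_left₀ h3 h2 2) (sq_nonneg _) hB
    _ = _ := by ring

omit [Nonempty X] in
theorem sum_G_pow_mul_doubleMean_le {k : ℕ} (hG : Potentials G B k) (hN : ∀ q ≤ k, 0 < Np q)
    (ω : Hist X) :
    (∑ j ∈ Finset.range (Np k), G k (ω.1 k j)) ^ 2 * doubleMean G Np b k ω ≤
      B ^ 2 * ∑ i ∈ Finset.range (Np k), rowSum G Np b k ω i := by
  have hB : 0 ≤ B := zero_le_one.trans hG.one_le
  have hS := sum_G_pos hG (hN k le_rfl) (ω.1 k)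
  have hl := lineWt_bounds (b := b) hG hN ω
  rw [doubleMean, Finset.mul_sum, Finset.mul_sum]
  refine Finset.sum_le_sum fun a _ => ?_
  rw [rowSum, Finset.mul_sum, Finset.mul_sum, Finset.mul_sum]
  refine Finset.sum_le_sum fun a' _ => ?_
  calc _ = G k (ω.1 k a) * G k (ω.1 k a') * lineWt G Np b k ω a a' := by
        rw [resW, resW]; field_simp
    _ ≤ B * B * lineWt G Np b k ω a a' :=
        mul_le_mul_of_nonneg_right (mul_le_mul (hG.le k le_rfl _) (hG.le k le_rfl _)
          (hG.pos k le_rfl _).le hB) (hl _ _).1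
    _ = _ := by ring

omit [Nonempty X] in
theorem pairNorm_succ_mul_le {k : ℕ} (hG : Potentials G B k) (hN : ∀ q ≤ k, 0 < Np q)
    (hN2 : 2 ≤ Np (k + 1)) (hb : b (k + 1) = false) {ρ : ℝ} (hρ : 1 ≤ ρ)
    (hr : (Np k : ℝ) ≤ ρ * Np (k + 1)) (ω : Hist X) :
    pairNorm G Np b (k + 1) ω ^ 2 * ((Np (k + 1) : ℝ) ^ 3 * tripleMean G Np b k ω +
        2 * ((Np (k + 1) : ℝ) ^ 2 * doubleMean G Np b k ω)) ≤
      8 * ρ ^ 2 * B ^ 4 * pairVarAux G Np b k ω := by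
  have hB : 1 ≤ B := hG.one_le
  have hS := sum_G_pos hG (hN k le_rfl) (ω.1 k)
  have hSle : ∑ j ∈ Finset.range (Np k), G k (ω.1 k j) ≤ Np k * B := by
    have := Finset.sum_le_sum fun j (_ : j ∈ Finset.range (Np k)) => hG.le k le_rfl (ω.1 k j)
    simpa using this
  have h3 := sum_G_pow_mul_tripleMean_le (b := b) hG hN ω
  have h2 := sum_G_pow_mul_doubleMean_le (b := b) hG hN ω
  have hR1 : 0 ≤ ∑ i ∈ Finset.range (Np k), rowSum G Np b k ω i :=
    Finset.sum_nonneg fun i _ => rowSum_nonneg hG hN ω i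
  have hR2 : 0 ≤ ∑ i ∈ Finset.range (Np k), rowSum G Np b k ω i ^ 2 :=
    Finset.sum_nonneg fun i _ => sq_nonneg _
  rw [pairNorm_succ_of_false hb, pairVarAux, Finset.sum_add_distrib]
  set S := ∑ j ∈ Finset.range (Np k), G k (ω.1 k j)
  set R1 := ∑ i ∈ Finset.range (Np k), rowSum G Np b k ω i
  set R2 := ∑ i ∈ Finset.range (Np k), rowSum G Np b k ω i ^ 2
  set T := tripleMean G Np b k ω
  set D := doubleMean G Np b k ω
  set P := pairNorm G Np b k ω
  have hm : (2 : ℝ) ≤ Np (k + 1) := by exact_mod_cast hN2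
  set m := (Np (k + 1) : ℝ)
  have hm1 : 0 < m - 1 := by linarith
  have hm0 : 0 < m := by linarith
  have hc : (m / (m - 1)) ^ 2 ≤ 4 := by
    have h : m / (m - 1) ≤ 2 := by rw [div_le_iff₀ hm1]; linarith
    have h0 : 0 ≤ m / (m - 1) := by positivity
    nlinarith
  have hSm : S / m ≤ ρ * B := by
    rw [div_le_iff₀ hm0]
    nlinarith [mul_le_mul_of_nonneg_right hr (zero_le_one.trans hB)]
  have hSm0 : 0 ≤ S / m := by positivity
  have hSm2 : (S / m) ^ 2 ≤ (ρ * B) ^ 2 := pow_le_pow_left₀ hSm0 hSm 2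
  have hρB : ρ * B ≤ ρ ^ 2 * B := by
    have : ρ ≤ ρ ^ 2 := by nlinarith
    exact mul_le_mul_of_nonneg_right this (by linarith)
  have e : (P * S ^ 2 * (m / (m - 1)) * m⁻¹ ^ 2) ^ 2 * (m ^ 3 * T + 2 * (m ^ 2 * D)) =
      (m / (m - 1)) ^ 2 * (P ^ 2 * (S / m * (S ^ 3 * T) + 2 * ((S / m) ^ 2 * (S ^ 2 * D)))) := by
    field_simp
  have b1 : S / m * (S ^ 3 * T) ≤ ρ ^ 2 * B * (B ^ 3 * R2) :=
    (mul_le_mul_of_nonneg_left h3 hSm0).trans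
      (mul_le_mul_of_nonneg_right (hSm.trans hρB) (by positivity))
  have b2 : (S / m) ^ 2 * (S ^ 2 * D) ≤ (ρ * B) ^ 2 * (B ^ 2 * R1) :=
    (mul_le_mul_of_nonneg_left h2 (sq_nonneg _)).trans
      (mul_le_mul_of_nonneg_right hSm2 (by positivity))
  have b3 : P ^ 2 * (S / m * (S ^ 3 * T) + 2 * ((S / m) ^ 2 * (S ^ 2 * D))) ≤
      P ^ 2 * (2 * (ρ ^ 2 * B ^ 4) * (R2 + R1)) := by
    refine mul_le_mul_of_nonneg_left ?_ (sq_nonneg _)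
    have : 0 ≤ ρ ^ 2 * B ^ 4 * R2 := by positivity
    nlinarith
  rw [e]
  calc _ ≤ (m / (m - 1)) ^ 2 * (P ^ 2 * (2 * (ρ ^ 2 * B ^ 4) * (R2 + R1))) :=
        mul_le_mul_of_nonneg_left b3 (sq_nonneg _)
    _ ≤ 4 * (P ^ 2 * (2 * (ρ ^ 2 * B ^ 4) * (R2 + R1))) :=
        mul_le_mul_of_nonneg_right hc (by positivity)
    _ = _ := by ring

theorem integral_pairVarAux_succ_le {k : ℕ} (hG : Potentials G B (k + 1))
    (hN : ∀ q ≤ k + 1, 2 ≤ Np q) (hb : b (k + 1) = false) {ρ : ℝ} (hρ : 1 ≤ ρ)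
    (hr : (Np k : ℝ) ≤ ρ * Np (k + 1)) :
    ∫ ω, pairVarAux G Np b (k + 1) ω ∂(pfLaw M0 M G Np (k + 1)) ≤
      8 * ρ ^ 2 * B ^ 4 * ∫ ω, pairVarAux G Np b k ω ∂(pfLaw M0 M G Np k) := by
  have hG' := hG.mono k.le_succ
  have hN0 : ∀ q ≤ k + 1, 0 < Np q := fun q hq => by have := hN q hq; omega
  have hN' : ∀ q ≤ k, 0 < Np q := fun q hq => hN0 q (by omega)
  have := isProbabilityMeasure_pfLaw (M0 := M0) (M := M) hG' hN'
  have hv := bddMeas_pairVarAux (b := b) hG hN0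
  rw [integral_pfLaw_succ hG' hN' hv, ← integral_const_mul]
  refine integral_mono ((bddMeas_integral_extend hG' hN' hv).integrable _)
    (((BddMeas.const _).mul (bddMeas_pairVarAux hG' hN')).integrable _) fun ω => ?_
  exact (integral_pairVarAux_extend_le hG' hN' hb ω).trans
    (pairNorm_succ_mul_le hG' hN' (hN _ le_rfl) hb hρ hr ω)

omit [Nonempty X] in
theorem prodG_bounds {k : ℕ} (hG : Potentials G B k) (hN : ∀ q ≤ k, 0 < Np q) (ω : Hist X) :
    0 < prodG G Np k ω ∧ prodG G Np k ω ≤ B ^ k := by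
  have h : ∀ q ∈ Finset.range k, 0 < etaN Np q (G q) ω ∧ etaN Np q (G q) ω ≤ B := by
    intro q hq
    have hq := (Finset.mem_range.1 hq).le
    have hNq : (0 : ℝ) < Np q := by exact_mod_cast hN q hq
    have hS := sum_G_pos (hG.mono hq) (hN q hq) (ω.1 q)
    refine ⟨mul_pos (inv_pos.2 hNq) hS, ?_⟩
    have := Finset.sum_le_sum fun j (_ : j ∈ Finset.range (Np q)) => hG.le q hq (ω.1 q j)
    rw [etaN, inv_mul_le_iff₀ hNq]
    simpa using this
  refine ⟨Finset.prod_pos fun q hq => (h q hq).1, ?_⟩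
  have := Finset.prod_le_prod (fun q hq => (h q hq).1.le) fun q hq => (h q hq).2
  simpa [prodG] using this

theorem patConst_bounds {k : ℕ} (hN : ∀ q ≤ k, 2 ≤ Np q) (hb : ∀ j < k, b j = false) :
    0 ≤ patConst Np b k ∧
      patConst Np b k ≤ 2 ^ k * if b k = true then (Np k : ℝ) else 2 := by
  have h : ∀ q ≤ k, 0 ≤ (Np q : ℝ) / ((Np q : ℝ) - 1) ∧ (Np q : ℝ) / ((Np q : ℝ) - 1) ≤ 2 := by
    intro q hq
    have hm : (2 : ℝ) ≤ Np q := by exact_mod_cast hN q hq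
    have hm1 : (0 : ℝ) < (Np q : ℝ) - 1 := by linarith
    exact ⟨by positivity, by rw [div_le_iff₀ hm1]; linarith⟩
  have hp : 0 ≤ ∏ q ∈ Finset.range k, (if b q then (Np q : ℝ) else (Np q : ℝ) / ((Np q : ℝ) - 1)) ∧
      ∏ q ∈ Finset.range k, (if b q then (Np q : ℝ) else (Np q : ℝ) / ((Np q : ℝ) - 1)) ≤ 2 ^ k := by
    have e : ∀ q ∈ Finset.range k, (if b q then (Np q : ℝ) else (Np q : ℝ) / ((Np q : ℝ) - 1)) =
        (Np q : ℝ) / ((Np q : ℝ) - 1) := fun q hq => by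
      simp [hb q (Finset.mem_range.1 hq)]
    rw [Finset.prod_congr rfl e]
    refine ⟨Finset.prod_nonneg fun q hq => (h q (Finset.mem_range.1 hq).le).1, ?_⟩
    have := Finset.prod_le_prod (fun q hq => (h q (Finset.mem_range.1 hq).le).1)
      fun q hq => (h q (Finset.mem_range.1 hq).le).2
    simpa using this
  have hl := h k le_rfl
  rw [patConst, Finset.prod_range_succ]
  have h1 : 0 ≤ (if b k then (Np k : ℝ) else (Np k : ℝ) / ((Np k : ℝ) - 1)) := by
    split_ifs
    · positivity
    · exact hl.1
  refine ⟨mul_nonneg hp.1 h1, mul_le_mul hp.2 ?_ h1 (by positivity)⟩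
  split_ifs
  · exact le_rfl
  · exact hl.2

omit [Nonempty X] in
theorem rowSum_le {k : ℕ} (hG : Potentials G B k) (hN : ∀ q ≤ k, 0 < Np q) (ω : Hist X) (i : ℕ) :
    rowSum G Np b k ω i ≤ if b k = true then 1 else (Np k : ℝ) := by
  have hl := lineWt_bounds (b := b) hG hN ω
  split_ifs with h
  · by_cases hi : i < Np k
    · rw [rowSum, Finset.sum_eq_single_of_mem i (Finset.mem_range.2 hi)]
      · exact (hl i i).2
      · intro j _ hj
        exact lineWt_eq_zero fun H => hj (H.2.2.2 h).symm
    · rw [rowSum, Finset.sum_eq_zero fun j _ => lineWt_eq_zero fun H => hi H.1]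
      exact zero_le_one
  · have := Finset.sum_le_sum fun j (_ : j ∈ Finset.range (Np k)) => (hl i j).2
    simpa [rowSum] using this

omit [Nonempty X] in
theorem pairVarAux_le_div {k : ℕ} (hG : Potentials G B k) (hN : ∀ q ≤ k, 2 ≤ Np q)
    (hb : ∀ j < k, b j = false) (ω : Hist X) :
    pairVarAux G Np b k ω ≤ 2 * (2 ^ (k + 1) * (B ^ k) ^ 2) ^ 2 / Np k := by
  have hN' : ∀ q ≤ k, 0 < Np q := fun q hq => by have := hN q hq; omega
  have hB : 0 ≤ B := zero_le_one.trans hG.one_le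
  have hm : (2 : ℝ) ≤ Np k := by exact_mod_cast hN k le_rfl
  have hp := patConst_bounds hN hb
  have hg := prodG_bounds hG hN' ω
  have hr := rowSum_le (b := b) hG hN' ω
  have hr0 := rowSum_nonneg (b := b) hG hN' ω
  have hm0 : (0 : ℝ) < Np k := by linarith
  have hgs : prodG G Np k ω ^ 2 ≤ (B ^ k) ^ 2 := pow_le_pow_left₀ hg.1.le hg.2 2
  set r : ℝ := if b k = true then 1 else (Np k : ℝ) with hrdef
  have hrr : (1 : ℝ) ≤ r := by rw [hrdef]; split_ifs <;> linarith
  have hpr : patConst Np b k * r ≤ 2 ^ (k + 1) * Np k := by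
    have h1 : patConst Np b k * r ≤ (2 ^ k * if b k = true then (Np k : ℝ) else 2) * r :=
      mul_le_mul_of_nonneg_right hp.2 (by linarith)
    refine h1.trans ?_
    have h2 : (0 : ℝ) < 2 ^ k := by positivity
    rw [hrdef, pow_succ]
    split_ifs <;> nlinarith
  have hsum : ∑ i ∈ Finset.range (Np k), (rowSum G Np b k ω i ^ 2 + rowSum G Np b k ω i) ≤
      Np k * (2 * r ^ 2) := by
    have := Finset.sum_le_sum fun i (_ : i ∈ Finset.range (Np k)) =>
      (show rowSum G Np b k ω i ^ 2 + rowSum G Np b k ω i ≤ 2 * r ^ 2 by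
        nlinarith [hr i, hr0 i])
    simpa using this
  have hn : 0 ≤ pairNorm G Np b k ω := by
    unfold pairNorm
    have := hp.1
    positivity
  have hnr : pairNorm G Np b k ω * r ≤ 2 ^ (k + 1) * (B ^ k) ^ 2 * (Np k : ℝ)⁻¹ := by
    calc pairNorm G Np b k ω * r = (patConst Np b k * r) * prodG G Np k ω ^ 2 *
          (Np k : ℝ)⁻¹ ^ 2 := by rw [pairNorm]; ring
      _ ≤ (2 ^ (k + 1) * Np k) * (B ^ k) ^ 2 * (Np k : ℝ)⁻¹ ^ 2 := by gcongr
      _ = _ := by field_simp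
  calc pairVarAux G Np b k ω ≤ pairNorm G Np b k ω ^ 2 * (Np k * (2 * r ^ 2)) :=
        mul_le_mul_of_nonneg_left hsum (sq_nonneg _)
    _ = 2 * Np k * (pairNorm G Np b k ω * r) ^ 2 := by ring
    _ ≤ 2 * Np k * (2 ^ (k + 1) * (B ^ k) ^ 2 * (Np k : ℝ)⁻¹) ^ 2 := by
        have : 0 ≤ pairNorm G Np b k ω * r := mul_nonneg hn (by linarith)
        gcongr
    _ = _ := by field_simp

/-- Growth conditions on a sequence of particle numbers up to generation `k`. -/
structure Growth (Np : ℕ → ℕ → ℕ) (k : ℕ) : Prop where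
  tendsto : ∀ q ≤ k, Tendsto (fun N => Np N q) atTop atTop
  ratio : ∀ q < k, ∃ ρ : ℝ, 1 ≤ ρ ∧ ∀ᶠ N in atTop, (Np N q : ℝ) ≤ ρ * Np N (q + 1)

theorem Growth.mono {Np : ℕ → ℕ → ℕ} {k l : ℕ} (h : Growth Np k) (hl : l ≤ k) : Growth Np l :=
  ⟨fun q hq => h.tendsto q (hq.trans hl), fun q hq => h.ratio q (hq.trans_le hl)⟩

theorem Growth.eventually_le {Np : ℕ → ℕ → ℕ} {k : ℕ} (h : Growth Np k) (m : ℕ) :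
    ∀ᶠ N in atTop, ∀ q ≤ k, m ≤ Np N q := by
  have := (eventually_all_finset (Finset.range (k + 1))).2 fun q hq =>
    (h.tendsto q (Nat.lt_succ_iff.1 (Finset.mem_range.1 hq))).eventually_ge_atTop m
  filter_upwards [this] with N hN q hq
  exact hN q (Finset.mem_range.2 (by omega))

omit [IsProbabilityMeasure M0] [∀ p, IsMarkovKernel (M p)] in
theorem integral_pairVarAux_nonneg {k : ℕ} (hG : Potentials G B k) (hN : ∀ q ≤ k, 0 < Np q) :
    0 ≤ ∫ ω, pairVarAux G Np b k ω ∂(pfLaw M0 M G Np k) :=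
  integral_nonneg fun ω => (pairVar_nonneg ω).trans (pairVar_le_pairVarAux hG hN ω)

theorem tendsto_integral_pairVarAux_of_false {Np : ℕ → ℕ → ℕ} {k : ℕ} (hG : Potentials G B k)
    (hN : Growth Np k) (hb : ∀ j < k, b j = false) :
    Tendsto (fun N => ∫ ω, pairVarAux G (Np N) b k ω ∂(pfLaw M0 M G (Np N) k))
      atTop (nhds 0) := by
  have h := (tendsto_const_nhds (x := 2 * (2 ^ (k + 1) * (B ^ k) ^ 2) ^ 2)).div_atTop
    (tendsto_natCast_atTop_atTop (R := ℝ) |>.comp (hN.tendsto k le_rfl))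
  refine tendsto_of_tendsto_of_tendsto_of_le_of_le' tendsto_const_nhds h
    ((hN.eventually_le 1).mono fun N hN => integral_pairVarAux_nonneg hG hN) ?_
  filter_upwards [hN.eventually_le 2] with N hN
  have hN' : ∀ q ≤ k, 0 < Np N q := fun q hq => by have := hN q hq; omega
  have := isProbabilityMeasure_pfLaw (M0 := M0) (M := M) hG hN'
  refine (integral_mono ((bddMeas_pairVarAux hG hN').integrable _)
    ((BddMeas.const _).integrable _) fun ω => pairVarAux_le_div hG hN hb ω).trans ?_
  simp

theorem tendsto_integral_pairVarAux {Np : ℕ → ℕ → ℕ} {k : ℕ} (hG : Potentials G B k)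
    (hN : Growth Np k) (hb : ∀ j, b j = true → ∀ i < j, b i = false) :
    Tendsto (fun N => ∫ ω, pairVarAux G (Np N) b k ω ∂(pfLaw M0 M G (Np N) k))
      atTop (nhds 0) := by
  induction k with
  | zero => exact tendsto_integral_pairVarAux_of_false hG hN fun j hj => absurd hj j.not_lt_zero
  | succ k ih =>
    cases hbk : b (k + 1) with
    | true => exact tendsto_integral_pairVarAux_of_false hG hN (hb _ hbk)
    | false =>
      obtain ⟨ρ, hρ, hr⟩ := hN.ratio k k.lt_succ_self
      have h := (ih (hG.mono k.le_succ) (hN.mono k.le_succ)).const_mul (8 * ρ ^ 2 * B ^ 4)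
      rw [mul_zero] at h
      refine tendsto_of_tendsto_of_tendsto_of_le_of_le' tendsto_const_nhds h
        ((hN.eventually_le 1).mono fun N hN => integral_pairVarAux_nonneg hG hN) ?_
      filter_upwards [hN.eventually_le 2, hr] with N hN hr
      exact integral_pairVarAux_succ_le hG hN hbk hρ hr

theorem tendsto_integral_pairVar {Np : ℕ → ℕ → ℕ} {k : ℕ} (hG : Potentials G B k)
    (hN : Growth Np k) (hb : ∀ j, b j = true → ∀ i < j, b i = false) :
    Tendsto (fun N => ∫ ω, pairVar G (Np N) b k ω ∂(pfLaw M0 M G (Np N) k))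
      atTop (nhds 0) := by
  refine tendsto_of_tendsto_of_tendsto_of_le_of_le' tendsto_const_nhds
    (tendsto_integral_pairVarAux (M0 := M0) (M := M) hG hN hb)
    (Eventually.of_forall fun N => integral_nonneg fun ω => pairVar_nonneg ω) ?_
  filter_upwards [hN.eventually_le 1] with N hN
  have := isProbabilityMeasure_pfLaw (M0 := M0) (M := M) hG hN
  exact integral_mono ((bddMeas_pairVar (b := b) hG hN).integrable _)
    ((bddMeas_pairVarAux hG hN).integrable _) fun ω => pairVar_le_pairVarAux hG hN ω

theorem tendsto_probFilter_muE {Np : ℕ → ℕ → ℕ} {k : ℕ} (hG : Potentials G B k)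
    (hN : Growth Np k) (hb : ∀ j, b j = true → ∀ i < j, b i = false) {F : X × X → ℝ}
    (hF : BddMeas F) :
    Tendsto (fun q : ℕ × Hist X => muE G (Np q.1) b k F q.2)
      (probFilter fun N => pfLaw M0 M G (Np N) k) (nhds (muB M0 M G k b F)) := by
  have h1 := hN.eventually_le 1
  refine tendsto_probFilter_of_sq (Y := fun N => muE G (Np N) b k F) ?_ ?_
    (tendsto_integral_sq_muE hG (hN.eventually_le 2)
      (fun j hj => tendsto_integral_pairVar (hG.mono hj) (hN.mono hj) hb) hF)
  · filter_upwards [h1] with N hN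
    have := isProbabilityMeasure_pfLaw (M0 := M0) (M := M) hG hN
    infer_instance
  · filter_upwards [h1] with N hN
    exact bddMeas_muE hG hN hF

end DecaySequence

/-! ### Convergence of the particle approximations -/

section Gamma

theorem integral_sq_mean_sub_le {Y : Type*} [MeasurableSpace Y] (ν : Measure Y)
    [IsProbabilityMeasure ν] {m : ℕ} (hm : 0 < m) {h : Y → ℝ} (hh : Measurable h) {C : ℝ}
    (hC : ∀ y, |h y| ≤ C) :
    ∫ f : Fin m → Y, ((m : ℝ)⁻¹ * ∑ i, h (f i) - ∫ y, h y ∂ν) ^ 2 ∂(Measure.pi fun _ => ν) ≤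
      4 * C ^ 2 / m := by
  have hm0 : (m : ℝ) ≠ 0 := by exact_mod_cast hm.ne'
  have hb : BddMeas h := ⟨hh, C, hC⟩
  have key := integral_sq_pairSum_sub_le (ι := Fin m) ν True
    (h := fun q => h q.1) (H := fun _ => C) (hb.comp measurable_fst) (.const C)
    (fun q => hC _) (fun h => absurd trivial h) (e := ∫ y, h y ∂ν)
    (fun i j _ => integral_pi_eval (h := h) ν i hh)
  simp only [iff_true, Finset.sum_ite_eq, Finset.mem_univ, if_true, Finset.sum_const,
    Finset.card_univ, Fintype.card_fin, nsmul_eq_mul, integral_const, probReal_univ, one_smul] at key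
  have e : ∀ f : Fin m → Y, ((m : ℝ)⁻¹ * ∑ i, h (f i) - ∫ y, h y ∂ν) ^ 2 =
      (m : ℝ)⁻¹ ^ 2 * (∑ i, h (f i) - m * ∫ y, h y ∂ν) ^ 2 := by
    intro f
    field_simp
  simp only [e]
  rw [integral_const_mul]
  calc _ ≤ (m : ℝ)⁻¹ ^ 2 * (4 * (m * C ^ 2)) := mul_le_mul_of_nonneg_left key (sq_nonneg _)
    _ = _ := by field_simp

variable [Nonempty X] {M0 : Measure X} [IsProbabilityMeasure M0] {M : ℕ → Kernel X X}
  [∀ p, IsMarkovKernel (M p)] {G : ℕ → X → ℝ} {Np : ℕ → ℕ} {B : ℝ}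

omit [MeasurableSpace X] [Nonempty X] in
theorem gammaN_eq_prodG_mul (k : ℕ) (f : X → ℝ) (ω : Hist X) :
    gammaN G Np k f ω = prodG G Np k ω * etaN Np k f ω := rfl

omit [Nonempty X] in
theorem bddMeas_gammaN {k : ℕ} (hG : Potentials G B k) {f : X → ℝ} (hf : BddMeas f) :
    BddMeas (gammaN G Np k f) := (bddMeas_prodG hG).mul (bddMeas_etaN hf)

omit [MeasurableSpace X] in
theorem gammaN_extend {k : ℕ} (ω : Hist X) (g : Fin (Np (k + 1)) → ℕ × X) (f : X → ℝ) :
    gammaN G Np (k + 1) f (extend k ω g) =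
      prodG G Np (k + 1) ω * ((Np (k + 1) : ℝ)⁻¹ * ∑ i, f (g i).2) := by
  rw [gammaN_eq_prodG_mul, prodG_extend ω g le_rfl, etaN, Finset.sum_range]
  simp only [extend_fst_self]

omit [Nonempty X] in
theorem prodG_succ_mul_integral_stepLaw {k : ℕ} (hG : Potentials G B k) (hN : 0 < Np k)
    (ω : Hist X) {f : X → ℝ} (hf : BddMeas f) :
    prodG G Np (k + 1) ω * ∫ y, f y.2 ∂(stepLaw M G Np k (ω.1 k)) =
      gammaN G Np k (fun x => G k x * ∫ y, f y ∂(M (k + 1) x)) ω := by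
  have hS := sum_G_pos hG hN (ω.1 k)
  rw [integral_stepLaw (h := fun y => f y.2) hG hN _ (hf.comp measurable_snd), prodG_succ,
    gammaN_eq_prodG_mul, mul_assoc, etaN, etaN, mul_assoc, Finset.mul_sum]
  congr 2
  refine Finset.sum_congr rfl fun a _ => ?_
  rw [resW]
  field_simp

theorem integral_sq_gammaN_extend_le {k : ℕ} (hG : Potentials G B (k + 1))
    (hN : ∀ q ≤ k + 1, 0 < Np q) (ω : Hist X) {f : X → ℝ} (hf : Measurable f) {C : ℝ}
    (hC : ∀ x, |f x| ≤ C) (m : ℝ) :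
    ∫ g, (gammaN G Np (k + 1) f (extend k ω g) - m) ^ 2
        ∂(Measure.pi fun _ : Fin (Np (k + 1)) => stepLaw M G Np k (ω.1 k)) ≤
      (B ^ (k + 1)) ^ 2 * (4 * C ^ 2 / Np (k + 1)) +
        (gammaN G Np k (fun x => G k x * ∫ y, f y ∂(M (k + 1) x)) ω - m) ^ 2 := by
  have hG' := hG.mono k.le_succ
  have hN' : ∀ q ≤ k, 0 < Np q := fun q hq => hN q (by omega)
  have := isProbabilityMeasure_stepLaw (M := M) hG' (hN' k le_rfl) (ω.1 k)
  have hfb : BddMeas f := ⟨hf, C, hC⟩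
  have hf2 := hfb.comp (u := fun y : ℕ × X => y.2) measurable_snd
  have hY : BddMeas fun g : Fin (Np (k + 1)) → ℕ × X => gammaN G Np (k + 1) f (extend k ω g) := by
    simp only [gammaN_extend]
    exact (BddMeas.const _).mul ((BddMeas.const _).mul (BddMeas.sum fun i _ =>
      hf2.comp (u := fun g : Fin (Np (k + 1)) → ℕ × X => g i) (by fun_prop)))
  have hmean : ∫ g, gammaN G Np (k + 1) f (extend k ω g)
      ∂(Measure.pi fun _ : Fin (Np (k + 1)) => stepLaw M G Np k (ω.1 k)) =
      prodG G Np (k + 1) ω * ∫ y, f y.2 ∂(stepLaw M G Np k (ω.1 k)) := by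
    have hNk : (Np (k + 1) : ℝ) ≠ 0 := by exact_mod_cast (hN (k + 1) le_rfl).ne'
    simp only [gammaN_extend]
    rw [integral_const_mul, integral_const_mul, integral_finsetSum _ fun i _ =>
      (hf2.comp (u := fun g : Fin (Np (k + 1)) → ℕ × X => g i) (by fun_prop)).integrable _]
    have : ∀ i, ∫ g : Fin (Np (k + 1)) → ℕ × X, f (g i).2
        ∂(Measure.pi fun _ => stepLaw M G Np k (ω.1 k)) =
        ∫ y, f y.2 ∂(stepLaw M G Np k (ω.1 k)) := fun i =>
      integral_pi_eval (h := fun y : ℕ × X => f y.2) _ i hf2.meas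
    simp [this, hNk]
  rw [integral_sq_sub_const hY, hmean, prodG_succ_mul_integral_stepLaw hG' (hN' k le_rfl) ω hfb]
  refine add_le_add ?_ le_rfl
  rw [← prodG_succ_mul_integral_stepLaw hG' (hN' k le_rfl) ω hfb]
  simp only [gammaN_extend, ← mul_sub, mul_pow _ _ 2]
  rw [integral_const_mul]
  have hg := prodG_bounds hG hN ω
  exact mul_le_mul (pow_le_pow_left₀ hg.1.le hg.2 2)
    (integral_sq_mean_sub_le _ (hN _ le_rfl) hf2.meas fun y => hC _)
    (integral_nonneg fun _ => sq_nonneg _) (sq_nonneg _)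

theorem integral_sq_gammaN_succ_le {k : ℕ} (hG : Potentials G B (k + 1))
    (hN : ∀ q ≤ k + 1, 0 < Np q) {f : X → ℝ} (hf : Measurable f) {C : ℝ}
    (hC : ∀ x, |f x| ≤ C) :
    ∫ ω, (gammaN G Np (k + 1) f ω - gInt M0 M G (k + 1) f) ^ 2 ∂(pfLaw M0 M G Np (k + 1)) ≤
      (B ^ (k + 1)) ^ 2 * (4 * C ^ 2 / Np (k + 1)) +
        ∫ ω, (gammaN G Np k (fun x => G k x * ∫ y, f y ∂(M (k + 1) x)) ω -
          gInt M0 M G k fun x => G k x * ∫ y, f y ∂(M (k + 1) x)) ^ 2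
          ∂(pfLaw M0 M G Np k) := by
  have hG' := hG.mono k.le_succ
  have hN' : ∀ q ≤ k, 0 < Np q := fun q hq => hN q (by omega)
  have hfb : BddMeas f := ⟨hf, C, hC⟩
  have := isProbabilityMeasure_pfLaw (M0 := M0) (M := M) hG' hN'
  have h1 := (((bddMeas_gammaN (Np := Np) hG hfb).sub (.const (gInt M0 M G (k + 1) f))).pow 2)
  have h2 := ((bddMeas_gammaN (Np := Np) hG' (hfb.transition (M := M) hG')).sub
    (.const (gInt M0 M G (k + 1) f))).pow 2
  rw [integral_pfLaw_succ hG' hN' h1, ← gInt_succ hG' hfb]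
  refine (integral_mono ((bddMeas_integral_extend hG' hN' h1).integrable _)
    (((BddMeas.const _).add h2).integrable _)
    fun ω => integral_sq_gammaN_extend_le hG hN ω hf hC _).trans ?_
  rw [integral_add ((BddMeas.const _).integrable _) (h2.integrable _)]
  simp

omit [∀ p, IsMarkovKernel (M p)] in
theorem integral_sq_gammaN_zero_le (hN : 0 < Np 0) {f : X → ℝ} (hf : Measurable f) {C : ℝ}
    (hC : ∀ x, |f x| ≤ C) :
    ∫ ω, (gammaN G Np 0 f ω - gInt M0 M G 0 f) ^ 2 ∂(pfLaw M0 M G Np 0) ≤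
      4 * C ^ 2 / Np 0 := by
  have hfb : BddMeas f := ⟨hf, C, hC⟩
  have h1 : BddMeas fun ω : Hist X => (gammaN G Np 0 f ω - gInt M0 M G 0 f) ^ 2 :=
    (((BddMeas.prod fun q hq => absurd hq (by simp)).mul (bddMeas_etaN hfb)).sub (.const _)).pow 2
  rw [integral_pfLaw_zero h1]
  have e : ∀ g : Fin (Np 0) → X, gammaN G Np 0 f (initConf g) = (Np 0 : ℝ)⁻¹ * ∑ i, f (g i) := by
    intro g
    rw [gammaN, etaN, Finset.sum_range]
    simp [initConf, padF]
  simp only [e]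
  exact integral_sq_mean_sub_le M0 hN hf hC

theorem tendsto_integral_sq_gammaN {Np : ℕ → ℕ → ℕ} {k : ℕ} (hG : Potentials G B k)
    (hN : Growth Np k) {f : X → ℝ} (hf : BddMeas f) :
    Tendsto (fun N => ∫ ω, (gammaN G (Np N) k f ω - gInt M0 M G k f) ^ 2
      ∂(pfLaw M0 M G (Np N) k)) atTop (nhds 0) := by
  have hdiv (j : ℕ) (hj : j ≤ k) (C : ℝ) :
      Tendsto (fun N => 4 * C ^ 2 / (Np N j : ℝ)) atTop (nhds 0) :=
    (tendsto_const_nhds (x := 4 * C ^ 2)).div_atTop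
      ((tendsto_natCast_atTop_atTop (R := ℝ)).comp (hN.tendsto j hj))
  induction k generalizing f with
  | zero =>
    obtain ⟨C, hC⟩ := hf.bdd
    refine tendsto_of_tendsto_of_tendsto_of_le_of_le' tendsto_const_nhds (hdiv 0 le_rfl C)
      (Eventually.of_forall fun N => integral_nonneg fun ω => sq_nonneg _) ?_
    filter_upwards [hN.eventually_le 1] with N hN
    exact integral_sq_gammaN_zero_le (hN 0 le_rfl) hf.meas hC
  | succ k ih =>
    obtain ⟨C, hC⟩ := hf.bdd
    have h := ((hdiv (k + 1) le_rfl C).const_mul ((B ^ (k + 1)) ^ 2)).add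
      (ih (hG.mono k.le_succ) (hN.mono k.le_succ) (hf.transition (M := M) (hG.mono k.le_succ))
        fun j hj => hdiv j (by omega))
    rw [mul_zero, zero_add] at h
    refine tendsto_of_tendsto_of_tendsto_of_le_of_le' tendsto_const_nhds h
      (Eventually.of_forall fun N => integral_nonneg fun ω => sq_nonneg _) ?_
    filter_upwards [hN.eventually_le 1] with N hN
    exact integral_sq_gammaN_succ_le hG hN hf.meas hC

theorem tendsto_probFilter_gammaN {Np : ℕ → ℕ → ℕ} {k : ℕ} (hG : Potentials G B k)
    (hN : Growth Np k) {f : X → ℝ} (hf : BddMeas f) :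
    Tendsto (fun q : ℕ × Hist X => gammaN G (Np q.1) k f q.2)
      (probFilter fun N => pfLaw M0 M G (Np N) k) (nhds (gInt M0 M G k f)) := by
  refine tendsto_probFilter_of_sq (Y := fun N => gammaN G (Np N) k f) ?_
    (Eventually.of_forall fun N => bddMeas_gammaN hG hf) (tendsto_integral_sq_gammaN hG hN hf)
  filter_upwards [hN.eventually_le 1] with N hN
  have := isProbabilityMeasure_pfLaw (M0 := M0) (M := M) hG hN
  infer_instance

end Gamma

/-! ### The asymptotic variance -/

section Variance

theorem exists_potentials {G : ℕ → X → ℝ} {n : ℕ} (hGm : ∀ p ≤ n, Measurable (G p))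
    (hGpos : ∀ p ≤ n, ∀ x, 0 < G p x) (hGbd : ∀ p ≤ n, ∃ C, ∀ x, G p x ≤ C) :
    ∃ B, Potentials G B n := by
  have h : ∀ p, ∃ C, p ≤ n → ∀ x, G p x ≤ C := fun p => by
    by_cases hp : p ≤ n
    · obtain ⟨C, hC⟩ := hGbd p hp
      exact ⟨C, fun _ => hC⟩
    · exact ⟨0, fun h => absurd h hp⟩
  choose C hC using h
  refine ⟨1 + ∑ p ∈ Finset.range (n + 1), |C p|, hGm, hGpos, fun p hp x => ?_,
    le_add_of_nonneg_right (Finset.sum_nonneg fun _ _ => abs_nonneg _)⟩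
  have h1 : |C p| ≤ ∑ p ∈ Finset.range (n + 1), |C p| :=
    Finset.single_le_sum (f := fun p => |C p|) (fun _ _ => abs_nonneg _)
      (Finset.mem_range.2 (by omega))
  linarith [hC p hp x, le_abs_self (C p)]

theorem growth_npart {c : ℕ → ℝ} {n : ℕ} (hc : ∀ p ≤ n, 0 < c p) : Growth (npart c) n where
  tendsto q hq :=
    tendsto_nat_ceil_atTop.comp (tendsto_natCast_atTop_atTop.const_mul_atTop (hc q hq))
  ratio q hq := by
    have h1 := hc q hq.le
    have h2 := hc (q + 1) hq
    refine ⟨max 1 ((c q + 1) / c (q + 1)), le_max_left _ _, ?_⟩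
    filter_upwards [eventually_ge_atTop 1] with N hN
    have hN' : (1 : ℝ) ≤ N := by exact_mod_cast hN
    calc (npart c N q : ℝ) ≤ c q * N + 1 := (Nat.ceil_lt_add_one (by positivity)).le
      _ ≤ (c q + 1) * N := by linarith
      _ = (c q + 1) / c (q + 1) * (c (q + 1) * N) := by field_simp
      _ ≤ max 1 ((c q + 1) / c (q + 1)) * npart c N (q + 1) :=
        mul_le_mul (le_max_right _ _) (Nat.le_ceil _) (by positivity) (by positivity)

theorem BddMeas.tens {f : X → ℝ} (hf : BddMeas f) : BddMeas (tens f) :=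
  (hf.comp measurable_fst).mul (hf.comp measurable_snd)

theorem eVec_eq_true_imp {p j : ℕ} (hj : eVec p j = true) (i : ℕ) (hi : i < j) :
    eVec p i = false := by
  simp only [eVec, beq_iff_eq, beq_eq_false_iff_ne] at hj ⊢
  omega

omit [MeasurableSpace X] in
theorem muE_tens_sub {G : ℕ → X → ℝ} {Np : ℕ → ℕ} {b : ℕ → Bool} {k : ℕ} (f : X → ℝ) (a : ℝ)
    (ω : Hist X) : muE G Np b k (tens fun x => f x - a) ω =
      muE G Np b k (tens f) ω - a * muE G Np b k (fun q => f q.1 + f q.2) ω +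
        a ^ 2 * muE G Np b k (fun _ => 1) ω := by
  simp only [muE, mul_left_comm a, mul_left_comm (a ^ 2), ← mul_sub, ← mul_add, Finset.mul_sum,
    ← Finset.sum_sub_distrib, ← Finset.sum_add_distrib]
  refine Finset.sum_congr rfl fun i _ => Finset.sum_congr rfl fun j _ => ?_
  rw [tens, tens]
  ring

variable [Nonempty X] {M0 : Measure X} [IsProbabilityMeasure M0] {M : ℕ → Kernel X X}
  [∀ p, IsMarkovKernel (M p)] {G : ℕ → X → ℝ} {B : ℝ} {n : ℕ} {φ : X → ℝ}

theorem muB_tens_sub (hG : Potentials G B n) (b : ℕ → Bool) (hφ : BddMeas φ) (a : ℝ) :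
    muB M0 M G n b (tens fun x => φ x - a) =
      muB M0 M G n b (tens φ) - a * muB M0 M G n b (fun q => φ q.1 + φ q.2) +
        a ^ 2 * muB M0 M G n b (fun _ => 1) := by
  have h2 : ∀ q ≤ n, 2 ≤ (fun _ : ℕ => 2) q := fun _ _ => le_rfl
  have h0 : ∀ q ≤ n, 0 < (fun _ : ℕ => 2) q := fun _ _ => two_pos
  have := isProbabilityMeasure_pfLaw (M0 := M0) (M := M) hG h0
  have hs : BddMeas fun q : X × X => φ q.1 + φ q.2 :=
    (hφ.comp measurable_fst).add (hφ.comp measurable_snd)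
  have h1 : BddMeas fun _ : X × X => (1 : ℝ) := .const 1
  have b1 := bddMeas_muE (b := b) hG h0 hφ.tens
  have b2 := (BddMeas.const a).mul (bddMeas_muE (b := b) hG h0 hs)
  have b3 := (BddMeas.const (a ^ 2)).mul (bddMeas_muE (b := b) hG h0 h1)
  rw [← integral_muE hG h2 hφ.tens, ← integral_muE hG h2 hs, ← integral_muE hG h2 h1,
    ← integral_muE hG h2 (hφ.sub (.const a)).tens, ← integral_const_mul, ← integral_const_mul,
    ← integral_sub (b1.integrable _) (b2.integrable _),
    ← integral_add ((b1.sub b2).integrable _) (b3.integrable _)]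
  simp only [muE_tens_sub]

omit [Nonempty X] in
theorem gInt_one_ne_zero (hG : Potentials G B n) : gInt M0 M G n 1 ≠ 0 :=
  (gInt_pos hG (f := 1) (.const 1) fun _ => one_pos).ne'

omit [Nonempty X] in
theorem sq_gammaN_mul_vpnN {Np : ℕ → ℕ} (hG : Potentials G B n) (hN : ∀ q ≤ n, 0 < Np q)
    (p : ℕ) (hφ : BddMeas φ) (ω : Hist X) : gammaN G Np n 1 ω ^ 2 * vpnN G Np n p φ ω =
      muE G Np (eVec p) n (tens φ) ω - muE G Np zeroVec n (tens φ) ω := by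
  rw [vpnN, muBN_eq_muE hG hN hφ.tens, muBN_eq_muE hG hN hφ.tens, gammaN_one (hN n le_rfl)]
  exact mul_div_cancel₀ _ (pow_ne_zero 2 (prodG_bounds hG hN ω).1.ne')

theorem integral_sq_gammaN_mul_vpnN {Np : ℕ → ℕ} (hG : Potentials G B n)
    (hN : ∀ q ≤ n, 2 ≤ Np q) (p : ℕ) (hφ : BddMeas φ) :
    ∫ ω, gammaN G Np n 1 ω ^ 2 * vpnN G Np n p φ ω ∂(pfLaw M0 M G Np n) =
      gInt M0 M G n 1 ^ 2 * vpn M0 M G n p φ := by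
  have h0 : ∀ q ≤ n, 0 < Np q := fun q hq => two_pos.trans_le (hN q hq)
  have := isProbabilityMeasure_pfLaw (M0 := M0) (M := M) hG h0
  simp only [sq_gammaN_mul_vpnN hG h0 p hφ]
  rw [integral_sub ((bddMeas_muE hG h0 hφ.tens).integrable _)
    ((bddMeas_muE hG h0 hφ.tens).integrable _), integral_muE hG hN hφ.tens,
    integral_muE hG hN hφ.tens, vpn, mul_div_cancel₀ _ (pow_ne_zero 2 (gInt_one_ne_zero hG))]

theorem integral_sq_gammaN_mul_vnN {Np : ℕ → ℕ} (hG : Potentials G B n)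
    (hN : ∀ q ≤ n, 2 ≤ Np q) (c : ℕ → ℝ) (hφ : BddMeas φ) :
    ∫ ω, gammaN G Np n 1 ω ^ 2 * vnN G Np c n φ ω ∂(pfLaw M0 M G Np n) =
      gInt M0 M G n 1 ^ 2 * sigma2 M0 M G c n φ := by
  have h0 : ∀ q ≤ n, 0 < Np q := fun q hq => two_pos.trans_le (hN q hq)
  have := isProbabilityMeasure_pfLaw (M0 := M0) (M := M) hG h0
  have hb (p : ℕ) : BddMeas fun ω => gammaN G Np n 1 ω ^ 2 * vpnN G Np n p φ ω := by
    simp only [sq_gammaN_mul_vpnN hG h0 p hφ]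
    exact (bddMeas_muE hG h0 hφ.tens).sub (bddMeas_muE hG h0 hφ.tens)
  simp only [vnN, sigma2, Finset.mul_sum, mul_left_comm _ (c _)⁻¹]
  rw [integral_finsetSum _ fun p _ => ((BddMeas.const _).mul (hb p)).integrable _]
  refine Finset.sum_congr rfl fun p _ => ?_
  rw [integral_const_mul, integral_sq_gammaN_mul_vpnN hG hN p hφ]

variable {Np : ℕ → ℕ → ℕ}

/-- The variance estimators are consistent, even when centred at a consistent random constant. -/
theorem tendsto_probFilter_vpnN_sub (hG : Potentials G B n) (hN : Growth Np n) (p : ℕ)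
    (hφ : BddMeas φ) {Y : ℕ → Hist X → ℝ} {a : ℝ}
    (hY : Tendsto (fun q : ℕ × Hist X => Y q.1 q.2)
      (probFilter fun N => pfLaw M0 M G (Np N) n) (nhds a)) :
    Tendsto (fun q : ℕ × Hist X => vpnN G (Np q.1) n p (fun x => φ x - Y q.1 q.2) q.2)
      (probFilter fun N => pfLaw M0 M G (Np N) n) (nhds (vpn M0 M G n p fun x => φ x - a)) := by
  have hs : BddMeas fun q : X × X => φ q.1 + φ q.2 :=
    (hφ.comp measurable_fst).add (hφ.comp measurable_snd)
  have key (b : ℕ → Bool) (hb : ∀ j, b j = true → ∀ i < j, b i = false) :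
      Tendsto (fun q : ℕ × Hist X => muE G (Np q.1) b n (tens fun x => φ x - Y q.1 q.2) q.2)
        (probFilter fun N => pfLaw M0 M G (Np N) n)
        (nhds (muB M0 M G n b (tens fun x => φ x - a))) := by
    simp only [muE_tens_sub]
    rw [muB_tens_sub hG b hφ a]
    exact ((tendsto_probFilter_muE hG hN hb hφ.tens).sub
      (hY.mul (tendsto_probFilter_muE hG hN hb hs))).add
      ((hY.pow 2).mul (tendsto_probFilter_muE hG hN hb (.const 1)))
  have h := ((key (eVec p) fun j hj => eVec_eq_true_imp hj).sub
    (key zeroVec fun j hj => by simp [zeroVec] at hj)).div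
    ((tendsto_probFilter_gammaN hG hN (f := 1) (.const 1)).pow 2)
    (pow_ne_zero 2 (gInt_one_ne_zero hG))
  refine h.congr' ?_
  filter_upwards [eventually_probFilter_of_atTop (hN.eventually_le 1)] with q hq
  rw [vpnN, muBN_eq_muE hG hq (hφ.sub (.const _)).tens, muBN_eq_muE hG hq (hφ.sub (.const _)).tens]
  rfl

theorem tendsto_probFilter_vpnN (hG : Potentials G B n) (hN : Growth Np n) (p : ℕ)
    (hφ : BddMeas φ) :
    Tendsto (fun q : ℕ × Hist X => vpnN G (Np q.1) n p φ q.2)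
      (probFilter fun N => pfLaw M0 M G (Np N) n) (nhds (vpn M0 M G n p φ)) := by
  have := tendsto_probFilter_vpnN_sub (M0 := M0) (M := M) hG hN p hφ (Y := fun _ _ => 0)
    tendsto_const_nhds
  simpa only [sub_zero] using this

theorem tendsto_probFilter_etaN (hG : Potentials G B n) (hN : Growth Np n) (hφ : BddMeas φ) :
    Tendsto (fun q : ℕ × Hist X => etaN (Np q.1) n φ q.2)
      (probFilter fun N => pfLaw M0 M G (Np N) n) (nhds (eInt M0 M G n φ)) := by
  refine ((tendsto_probFilter_gammaN hG hN hφ).div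
    (tendsto_probFilter_gammaN hG hN (f := 1) (.const 1)) (gInt_one_ne_zero hG)).congr' ?_
  filter_upwards [eventually_probFilter_of_atTop (hN.eventually_le 1)] with q hq
  simp only [Pi.div_apply]
  rw [gammaN_one (hq n le_rfl), gammaN_eq_prodG_mul]
  exact mul_div_cancel_left₀ _ (prodG_bounds hG hq q.2).1.ne'

theorem tendsto_probFilter_vnN (hG : Potentials G B n) (hN : Growth Np n) (c : ℕ → ℝ)
    (hφ : BddMeas φ) :
    Tendsto (fun q : ℕ × Hist X => vnN G (Np q.1) c n φ q.2)
      (probFilter fun N => pfLaw M0 M G (Np N) n) (nhds (sigma2 M0 M G c n φ)) :=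
  tendsto_finsetSum _ fun p _ => (tendsto_probFilter_vpnN hG hN p hφ).const_mul _

end Variance

theorem statement15
    {X : Type*} [MeasurableSpace X] [Nonempty X] (hX : ∃ x y : X, x ≠ y) (n : ℕ)
    (M0 : Measure X) [IsProbabilityMeasure M0]
    (M : ℕ → Kernel X X) [∀ p, IsMarkovKernel (M p)]
    (G : ℕ → X → ℝ) (hGm : ∀ p ≤ n, Measurable (G p))
    (hGpos : ∀ p ≤ n, ∀ x, 0 < G p x) (hGbd : ∀ p ≤ n, ∃ C, ∀ x, G p x ≤ C)
    (c : ℕ → ℝ) (hc : ∀ p ≤ n, 0 < c p)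
    (φ : X → ℝ) (hφm : Measurable φ) (hφb : ∃ C, ∀ x, |φ x| ≤ C) :
    (∀ p ≤ n,
      (∀ N : ℕ, 1 ≤ N → (∀ q ≤ n, 2 ≤ npart c N q) →
        ∫ ω, gammaN G (npart c N) n (1 : X → ℝ) ω ^ 2 * vpnN G (npart c N) n p φ ω
            ∂(pfLaw M0 M G (npart c N) n)
          = gInt M0 M G n 1 ^ 2 * vpn M0 M G n p φ) ∧
      (∀ ε : ℝ, 0 < ε →
        Tendsto (fun N : ℕ =>
            pfLaw M0 M G (npart c N) n
              {ω | ε ≤ |vpnN G (npart c N) n p φ ω - vpn M0 M G n p φ|})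
          atTop (nhds 0)) ∧
      (∀ ε : ℝ, 0 < ε →
        Tendsto (fun N : ℕ =>
            pfLaw M0 M G (npart c N) n
              {ω | ε ≤ |vpnN G (npart c N) n p
                    (fun x => φ x - etaN (npart c N) n φ ω) ω
                  - vpn M0 M G n p fun x => φ x - eInt M0 M G n φ|})
          atTop (nhds 0))) ∧
    (∀ N : ℕ, 1 ≤ N → (∀ q ≤ n, 2 ≤ npart c N q) →
      ∫ ω, gammaN G (npart c N) n (1 : X → ℝ) ω ^ 2 * vnN G (npart c N) c n φ ω
          ∂(pfLaw M0 M G (npart c N) n)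
        = gInt M0 M G n 1 ^ 2 * sigma2 M0 M G c n φ) ∧
    (∀ ε : ℝ, 0 < ε →
      Tendsto (fun N : ℕ =>
          pfLaw M0 M G (npart c N) n
            {ω | ε ≤ |vnN G (npart c N) c n φ ω - sigma2 M0 M G c n φ|})
        atTop (nhds 0)) := by
  obtain ⟨B, hG⟩ := exists_potentials hGm hGpos hGbd
  have hN := growth_npart hc
  have hφ : BddMeas φ := ⟨hφm, hφb⟩
  refine ⟨fun p _ => ⟨fun N _ h2 => integral_sq_gammaN_mul_vpnN hG h2 p hφ,
    tendsto_probFilter_iff.1 (tendsto_probFilter_vpnN hG hN p hφ), ?_⟩,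
    fun N _ h2 => integral_sq_gammaN_mul_vnN hG h2 c hφ,
    tendsto_probFilter_iff.1 (tendsto_probFilter_vnN hG hN c hφ)⟩
  have h := tendsto_probFilter_vpnN_sub (M0 := M0) (M := M) hG hN p hφ
    (Y := fun N => etaN (npart c N) n φ) (tendsto_probFilter_etaN hG hN hφ)
  exact tendsto_probFilter_iff (Y := fun N ω =>
    vpnN G (npart c N) n p (fun x => φ x - etaN (npart c N) n φ ω) ω).1 h
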